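/- Let f(x) = c_k x^k + ⋯ + c_1 x + c_0 ∈ ℤ[x] with c_k > 0 and k ≥ 1, and let A > 0. Then R_f(N) = 𝔖(f) · c_k^{−1/k} · (k/(k+1)) · N^{(k+1)/k} + O(N^{(k+1)/k}/log^A N), where the implied constant depends only on f and A. -/

import Mathlib

open Real Filter Asymptotics

/-- Truncated von Mangoldt function: `Λ_N(n) = log p` if `n = p^j ≤ N`, else `0`. -/
noncomputable def LamN (N : ℕ) (n : ℤ) : ℝ :=
  if 1 ≤ n ∧ n ≤ (N : ℤ) then ArithmeticFunction.vonMangoldt n.toNat else 0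

/-- `M = (N/c_k)^{1/k}`. -/
noncomputable def Mf (f : Polynomial ℤ) (k : ℕ) (N : ℕ) : ℕ :=
  ⌊((N : ℝ) / (f.leadingCoeff : ℝ)) ^ ((1 : ℝ) / k)⌋₊

/-- `R_f(N) = Σ_{d=1}^{M} Σ_{n∈ℤ} Λ_N(n) Λ_N(n − f(d))` with `M = (N/c_k)^{1/k}`. -/
noncomputable def Rf (f : Polynomial ℤ) (k : ℕ) (N : ℕ) : ℝ :=
  ∑ d ∈ Finset.Icc 1 (Mf f k N), ∑' n : ℤ, LamN N n * LamN N (n - f.eval (d : ℤ))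

/-- The complete exponential sum `S_{a/q} = Σ_{r=0}^{q−1} e^{2πi f(r) a/q}`. -/
noncomputable def Saq (f : Polynomial ℤ) (a : ℤ) (q : ℕ) : ℂ :=
  ∑ r ∈ Finset.range q,
    Complex.exp (2 * Real.pi * Complex.I * (f.eval (r : ℤ)) * a / q)

/-- The singular series
`𝔖(f) = Σ_{q=1}^∞ (μ(q)²/(q φ(q)²)) Σ_{0 ≤ a < q, (a,q)=1} S_{a/q}`. -/
noncomputable def SingSeries (f : Polynomial ℤ) : ℂ :=
  ∑' q : ℕ,
    ((((ArithmeticFunction.moebius q : ℝ) ^ 2 /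
        ((q : ℝ) * (Nat.totient q : ℝ) ^ 2)) : ℝ) : ℂ) *
      ∑ a ∈ (Finset.range q).filter fun a => Nat.Coprime a q, Saq f (a : ℤ) q

open Finset (range Icc filter mem_Icc mem_Ico mem_coe mem_erase mem_filter mem_image mem_insert mem_insert_of_mem mem_insert_self mem_map mem_product mem_range mem_univ sum_Ico_consecutive sum_Ico_eq_sub sum_Ico_eq_sum_range sum_add_distrib sum_biUnion sum_comm sum_congr sum_const sum_disjSum sum_empty sum_eq_single sum_eq_single_of_mem sum_eq_zero sum_filter sum_filter_add_sum_filter_not sum_filter_ne_zero sum_ite_mem sum_le_card_nsmul sum_le_sum sum_le_sum_of_subset_of_nonneg sum_map sum_mul sum_mul_sum sum_nbij sum_neg_distrib sum_nonneg sum_product sum_range_add sum_range_add_sum_Ico sum_range_by_parts sum_range_reflect sum_range_sub sum_range_succ sum_sigma sum_singleton sum_sub_distrib)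

/-! ### Weyl sums -/

noncomputable def ee (x : ℝ) : ℂ := Complex.exp ((2 * π * x : ℝ) * Complex.I)

lemma ee_add (x y : ℝ) : ee (x + y) = ee x * ee y := by
  rw [ee, ee, ee, ← Complex.exp_add]; congr 1; push_cast; ring

lemma norm_ee (x : ℝ) : ‖ee x‖ = 1 := Complex.norm_exp_ofReal_mul_I _

lemma ee_zero : ee 0 = 1 := by simp [ee]

lemma ee_int (n : ℤ) : ee n = 1 := by
  rw [ee, Complex.exp_eq_one_iff]; exact ⟨n, by push_cast; ring⟩

lemma ee_add_int (x : ℝ) (n : ℤ) : ee (x + n) = ee x := by rw [ee_add, ee_int, mul_one]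

lemma ee_neg (x : ℝ) : ee (-x) = (starRingEnd ℂ) (ee x) := by
  rw [ee, ee, ← Complex.exp_conj]; congr 1; simp [Complex.conj_ofNat]

lemma ee_sub (x y : ℝ) : ee (x - y) = ee x * (starRingEnd ℂ) (ee y) := by
  rw [sub_eq_add_neg, ee_add, ee_neg]

lemma ee_sub_le (x y : ℝ) : ‖ee x - ee y‖ ≤ 2 * π * |x - y| := by
  have h : ee x - ee y = ee y * (ee (x - y) - 1) := by
    rw [mul_sub, ← ee_add]; simp
  rw [h, norm_mul, norm_ee, one_mul, ee, mul_comm _ Complex.I]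
  refine (norm_exp_I_mul_ofReal_sub_one_le).trans ?_
  rw [norm_eq_abs, abs_mul, abs_of_pos (by positivity : (0:ℝ) < 2 * π)]

/-- lower bound for `ee x - 1`. -/
lemma ee_sub_one_ge {x b : ℝ} (h : ∀ m : ℤ, b ≤ |x - m|) : 4 * b ≤ ‖ee x - 1‖ := by
  have h1 := h (round x)
  have h2 := abs_sub_round x
  set y := x - round x with hy
  have h3 : ee x = ee y := by
    rw [← ee_add_int y (round x)]; congr 1; simp [hy]
  rw [h3, ee, mul_comm _ Complex.I, Complex.norm_exp_I_mul_ofReal_sub_one, norm_eq_abs,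
    abs_mul, abs_two, show 2 * π * y / 2 = π * y by ring]
  have h4 : 2 * |y| ≤ |Real.sin (π * y)| := by
    have := Real.mul_abs_le_abs_sin (x := π * y) (by
      rw [abs_mul, abs_of_pos pi_pos]; nlinarith [pi_pos])
    rw [abs_mul, abs_of_pos pi_pos] at this
    calc 2 * |y| = 2 / π * (π * |y|) := by field_simp
      _ ≤ _ := this
  linarith

lemma geom_ee_le (x : ℝ) {b : ℝ} (hb : 0 < b) (h : ∀ m : ℤ, b ≤ |x - m|) (n : ℕ) :
    ‖∑ i ∈ range n, ee (i * x)‖ ≤ 1 / (2 * b) := by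
  have h1 := ee_sub_one_ge h
  have h2 : ee x ≠ 1 := by
    intro h0; rw [h0] at h1; simp at h1; linarith
  have h3 : ∀ i : ℕ, ee (i * x) = ee x ^ i := by
    intro i; induction i with
    | zero => simp [ee_zero]
    | succ i ih => rw [pow_succ, ← ih, ← ee_add]; congr 1; push_cast; ring
  simp_rw [h3]
  rw [geom_sum_eq h2, norm_div]
  have h4 : ‖ee x ^ n - 1‖ ≤ 2 := by
    refine (norm_sub_le _ _).trans ?_
    rw [norm_pow, norm_ee]; norm_num
  rw [div_le_div_iff₀ (by linarith) (by positivity)]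
  nlinarith

/-- Vinogradov's lemma. -/
lemma vino (β ε δ : ℝ) (M : ℕ) (hδ : 0 < δ) (hε : 0 < ε) (h1 : 100 * ε ≤ δ)
    (h2 : 100 ≤ δ * M) (H : Finset ℕ) (hH : ∀ h ∈ H, 1 ≤ h ∧ h ≤ M ∧ ∃ b : ℤ, |h * β - b| ≤ ε)
    (hc : δ * M ≤ H.card) :
    ∃ q : ℕ, 1 ≤ q ∧ (q : ℝ) ≤ 4 / δ ∧ ∃ b : ℤ, |q * β - b| ≤ ε / (δ * M) := by
  have hM : 0 < M := by
    rcases Nat.eq_zero_or_pos M with h | h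
    · subst h; simp at h2; linarith
    · exact h
  have hMr : (0:ℝ) < M := by exact_mod_cast hM
  obtain ⟨r, hr1, hr2⟩ := Real.exists_rat_abs_sub_le_and_den_le β (n := 4 * M) (by omega)
  set q := r.den with hq
  set a := r.num with ha
  have hq1 : 1 ≤ q := r.den_pos
  have hqr : (1:ℝ) ≤ q := by exact_mod_cast hq1
  have hqp : (0:ℝ) < q := by linarith
  have hq4 : (q:ℝ) ≤ 4 * M := by exact_mod_cast hr2
  have hcop : IsCoprime a (q:ℤ) := by
    rw [Int.isCoprime_iff_gcd_eq_one]; exact r.reduced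
  have hra : ((r:ℚ):ℝ) = a / q := by
    rw [ha, hq]; exact_mod_cast congrArg (fun x : ℚ => (x:ℝ)) (Rat.num_div_den r).symm
  have hth : |q * β - a| ≤ 1 / (4 * M + 1) := by
    have : q * β - a = q * (β - r) := by rw [hra]; field_simp
    rw [this, abs_mul, abs_of_pos hqp]
    calc (q:ℝ) * |β - r| ≤ q * (1 / (((4 * M : ℕ) + 1) * q)) := by gcongr
      _ = _ := by push_cast; field_simp
  choose! b hb using fun h hh => (hH h hh).2.2
  -- the integers t
  have ht : ∀ h ∈ H, |((h * a - b h * q : ℤ) : ℝ)| ≤ ε * q + 1 / 4 := by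
    intro h hh
    have e1 : ((h * a - b h * q : ℤ) : ℝ) = q * (h * β - b h) - h * (q * β - a) := by
      push_cast; ring
    rw [e1]
    refine (abs_sub _ _).trans ?_
    rw [abs_mul, abs_mul, abs_of_pos hqp, Nat.abs_cast]
    have e2 : (h:ℝ) ≤ M := by exact_mod_cast (hH h hh).2.1
    have e3 : (h:ℝ) * |q * β - a| ≤ M * (1 / (4 * M + 1)) := by gcongr
    have e4 : (M:ℝ) * (1 / (4 * M + 1)) ≤ 1 / 4 := by
      rw [mul_one_div, div_le_div_iff₀ (by positivity) (by norm_num)]; linarith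
    nlinarith [hb h hh]
  have hcard : (H.card : ℝ) ≤ (M / q + 1) * (2 * (ε * q + 1 / 4) + 1) := by
    set T := ⌊ε * q + 1 / 4⌋₊
    have hle : H.card ≤ ((range (M / q + 1)) ×ˢ (Icc (-(T:ℤ)) T)).card := by
      refine Finset.card_le_card_of_injOn (fun h => (h / q, (h * a - b h * q : ℤ))) ?_ ?_
      · intro h hh
        have := ht h hh
        simp only [Finset.coe_product, Set.mem_prod, mem_coe, mem_range,
          mem_Icc]
        refine ⟨Nat.lt_succ_of_le (Nat.div_le_div_right (hH h hh).2.1), ?_⟩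
        rw [← abs_le]
        have h5 : ((h * a - b h * q : ℤ)).natAbs ≤ T := by
          apply Nat.le_floor
          rw [Nat.cast_natAbs]; push_cast at this ⊢; exact this
        rw [Int.abs_eq_natAbs]; exact_mod_cast h5
      · intro h _ h' _ he
        simp only [Prod.mk.injEq] at he
        have e1 : (q:ℤ) ∣ ((h:ℤ) - h') * a := ⟨b h - b h', by linear_combination he.2⟩
        have e2 : (q:ℤ) ∣ (h:ℤ) - h' := hcop.symm.dvd_of_dvd_mul_right e1
        have e3 : h' ≡ h [MOD q] := (Nat.modEq_iff_dvd).2 e2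
        rw [← Nat.div_add_mod h q, ← Nat.div_add_mod h' q, he.1, e3]
    rw [Finset.card_product, Finset.card_range, Int.card_Icc] at hle
    have e5 : ((T:ℤ) + 1 - -(T:ℤ)).toNat = 2 * T + 1 := by omega
    rw [e5] at hle
    calc (H.card : ℝ) ≤ ((M / q : ℕ) + 1) * (2 * T + 1) := by exact_mod_cast hle
      _ ≤ _ := by
        gcongr
        · exact Nat.cast_div_le
        · exact Nat.floor_le (by positivity)
  have hqd : (q:ℝ) ≤ 2 / δ := by
    have e1 : (M / q + 1) * (2 * (ε * q + 1 / 4) + 1) =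
      2 * ε * M + 2 * ε * q + 3 / 2 * (M / q) + 3 / 2 := by field_simp; ring
    have e2 : ε * q ≤ ε * (4 * M) := by gcongr
    have e3 : ε * M ≤ δ / 100 * M := by gcongr; linarith
    have e4 : 0.8 * (δ * M) ≤ 3 / 2 * (M / q) := by linarith
    rw [← mul_div_assoc, le_div_iff₀ hqp] at e4
    rw [le_div_iff₀ hδ]
    nlinarith
  have hεq : ε * q ≤ 1 / 50 := by
    calc ε * q ≤ (δ / 100) * (2 / δ) := by gcongr; linarith
      _ = _ := by field_simp; norm_num
  refine ⟨q, hq1, hqd.trans (by gcongr; norm_num), a, ?_⟩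
  have hdiv : ∀ h ∈ H, ∃ m : ℕ, 1 ≤ m ∧ h = q * m ∧ m * |q * β - a| ≤ ε := by
    intro h hh
    have e1 : (h * a - b h * q : ℤ) = 0 := by
      have := ht h hh
      have h5 : |((h * a - b h * q : ℤ) : ℝ)| < 1 := by linarith
      rw [← Int.abs_lt_one_iff]; exact_mod_cast h5
    have e2 : (q:ℤ) ∣ h := hcop.symm.dvd_of_dvd_mul_right ⟨b h, by linear_combination e1⟩
    obtain ⟨m, rfl⟩ := Int.natCast_dvd_natCast.1 e2
    refine ⟨m, ?_, rfl, ?_⟩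
    · have := (hH _ hh).1
      rcases Nat.eq_zero_or_pos m with h0 | h0
      · simp [h0] at this
      · exact h0
    · have e3 : b (q * m) = m * a := by
        have : (q:ℤ) ≠ 0 := by positivity
        apply mul_left_cancel₀ this
        push_cast at e1; linarith
      have := hb _ hh
      rw [e3] at this
      rw [← Nat.abs_cast m, ← abs_mul]
      refine le_trans (le_of_eq ?_) this
      congr 1; push_cast; ring
  rcases (abs_nonneg (q * β - a)).eq_or_lt with h0 | h0
  · rw [← h0]; positivity
  · rw [le_div_iff₀ (by positivity)]
    have : H.card ≤ (Icc 1 ⌊ε / |q * β - a|⌋₊).card := by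
      refine (Finset.card_le_card ?_).trans (Finset.card_image_le (f := fun m => q * m))
      intro h hh
      obtain ⟨m, m1, m2, m3⟩ := hdiv h hh
      refine mem_image.2 ⟨m, mem_Icc.2 ⟨m1, Nat.le_floor ?_⟩, m2.symm⟩
      rw [le_div_iff₀ h0]; exact m3
    rw [Nat.card_Icc, Nat.add_sub_cancel] at this
    have h6 : δ * M ≤ ε / |q * β - a| :=
      hc.trans ((Nat.cast_le.2 this).trans (Nat.floor_le (by positivity)))
    rw [le_div_iff₀ h0] at h6
    linarith

lemma vdc_id (a : ℕ → ℂ) (h1 : ∀ n, ‖a n‖ = 1) (L : ℕ) :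
    ‖∑ n ∈ range L, a n‖ ^ 2 = L + 2 * (∑ h ∈ range L,
      ∑ n ∈ range (L - 1 - h), a (n + (h + 1)) * (starRingEnd ℂ) (a n)).re := by
  induction L with
  | zero => simp
  | succ L ih =>
    have e1 : ∑ h ∈ range (L + 1), ∑ n ∈ range (L + 1 - 1 - h),
        a (n + (h + 1)) * (starRingEnd ℂ) (a n) = ∑ h ∈ range L,
        ∑ n ∈ range (L - 1 - h), a (n + (h + 1)) * (starRingEnd ℂ) (a n) +
        a L * (starRingEnd ℂ) (∑ n ∈ range L, a n) := by
      rw [sum_range_succ, map_sum, Finset.mul_sum, ← sum_range_reflect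
        (fun n => a L * (starRingEnd ℂ) (a n)), ← sum_add_distrib]
      simp only [Nat.add_sub_cancel, Nat.sub_self, Finset.range_zero, sum_empty, add_zero]
      refine sum_congr rfl fun h hh => ?_
      rw [mem_range] at hh
      rw [show L - h = (L - 1 - h) + 1 by omega, sum_range_succ,
        show L - 1 - h + (h + 1) = L by omega]
    rw [e1, sum_range_succ, Complex.sq_norm, Complex.normSq_add, ← Complex.sq_norm, ih,
      ← Complex.sq_norm, h1, Complex.add_re]
    have : (∑ n ∈ range L, a n) * (starRingEnd ℂ) (a L) =
      (starRingEnd ℂ) (a L * (starRingEnd ℂ) (∑ n ∈ range L, a n)) := by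
      simp [mul_comm]
    rw [this, Complex.conj_re]; push_cast; ring

def DD : ℕ → ℝ → (ℤ → ℝ) → Prop
  | 0, θ, u => ∀ n, u (n + 1) - u n = θ
  | k + 1, θ, u => ∀ h : ℤ, DD k (h * θ) (fun n => u (n + h) - u n)

lemma weyl (k : ℕ) : ∃ C : ℕ, ∀ K : ℝ, 2 ≤ K → ∀ M : ℕ, 1 ≤ M → ∀ (u : ℤ → ℝ) (θ : ℝ),
    DD k θ u → ∀ L ≤ M, M / K ≤ ‖∑ n ∈ range L, ee (u n)‖ →
    ∃ q : ℕ, 1 ≤ q ∧ (q : ℝ) ≤ K ^ C ∧ ∃ b : ℤ, |q * θ - b| ≤ K ^ C / M ^ (k + 1) := by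
  induction k with
  | zero =>
    refine ⟨1, fun K hK M hM u θ hu L hL hS => ⟨1, le_rfl, by simp; linarith, ?_⟩⟩
    have hMr : (0:ℝ) < M := by exact_mod_cast hM
    by_contra! hcon
    have e1 : ∀ n : ℕ, u n = u 0 + n * θ := by
      intro n; induction n with
      | zero => simp
      | succ n ih => have := hu n; push_cast; linarith
    have e2 : ∑ n ∈ range L, ee (u n) = ee (u 0) * ∑ n ∈ range L, ee (n * θ) := by
      rw [Finset.mul_sum]; exact sum_congr rfl fun n _ => by rw [e1, ee_add]
    rw [e2, norm_mul, norm_ee, one_mul] at hS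
    have e3 := geom_ee_le θ (b := K / M) (by positivity)
      (fun m => by have := hcon m; simp at this; exact this.le) L
    have : (M:ℝ) / K ≤ M / K / 2 := hS.trans (e3.trans (le_of_eq (by field_simp)))
    have : 0 < (M:ℝ) / K := by positivity
    linarith
  | succ k IH =>
    obtain ⟨C, IH⟩ := IH
    refine ⟨(11 + 10 * C) * (k + 2), fun K hK M hM u θ hu L hL hS => ?_⟩
    have hMr : (0:ℝ) < M := by exact_mod_cast hM
    have hK0 : 0 < K := by linarith
    have hK1 : 1 ≤ K := by linarith
    by_cases hbig : (M : ℝ) ≤ K ^ (11 + 10 * C)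
    · refine ⟨1, le_rfl, by simpa using one_le_pow₀ hK1, round θ, ?_⟩
      rw [Nat.cast_one, one_mul]
      refine (abs_sub_round θ).trans (le_trans (by norm_num : (1/2:ℝ) ≤ 1) ?_)
      rw [le_div_iff₀ (by positivity), one_mul, pow_mul]; gcongr
    push Not at hbig
    set K' := 8 * K ^ 2 with hK'
    have hK'5 : K' ≤ K ^ 5 := by
      rw [hK', show K ^ 5 = K ^ 3 * K ^ 2 by ring]
      gcongr; calc (8:ℝ) = 2 ^ 3 := by norm_num
        _ ≤ _ := by gcongr
    have hK'C : K' ^ C ≤ K ^ (5 * C) := by rw [pow_mul]; gcongr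
    have hK'1 : 1 ≤ K' ^ C := one_le_pow₀ (by nlinarith)
    set T : ℕ → ℂ := fun h => ∑ n ∈ range (L - 1 - h), ee (u (n + ((h:ℤ) + 1)) - u n) with hT
    have hvdc : ‖∑ n ∈ range L, ee (u n)‖ ^ 2 ≤ M + 2 * ∑ h ∈ range M, ‖T h‖ := by
      rw [vdc_id (fun n => ee (u n)) (fun n => norm_ee _)]
      gcongr
      refine (Complex.re_le_norm _).trans ((norm_sum_le _ _).trans ?_)
      refine le_trans (le_of_eq ?_) (sum_le_sum_of_subset_of_nonneg
        (Finset.range_mono hL) fun i _ _ => norm_nonneg _)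
      refine sum_congr rfl fun h _ => ?_
      rw [hT]; congr 1
      refine sum_congr rfl fun n _ => ?_
      rw [ee_sub]; push_cast; rfl
    have hTM : ∀ h, ‖T h‖ ≤ M := by
      intro h
      refine (norm_sum_le _ _).trans ?_
      simp only [norm_ee, sum_const, Finset.card_range, nsmul_eq_mul, mul_one]
      exact_mod_cast (by omega : L - 1 - h ≤ M)
    set H := (range M).filter fun h => M / K' ≤ ‖T h‖ with hH
    have hsum : ∑ h ∈ range M, ‖T h‖ ≤ H.card * M + M * (M / K') := by
      rw [← sum_filter_add_sum_filter_not _ (fun h => M / K' ≤ ‖T h‖)]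
      refine add_le_add ?_ ?_
      · rw [← nsmul_eq_mul]; exact sum_le_card_nsmul _ _ _ fun h _ => hTM h
      · refine (sum_le_card_nsmul _ _ (M / K') fun h hh => ?_).trans ?_
        · exact (not_le.1 (mem_filter.1 hh).2).le
        · rw [nsmul_eq_mul]; gcongr
          exact (Finset.card_filter_le _ _).trans (by simp)
    have hM4 : 400 * K ^ 2 * (K' ^ C) ^ 2 ≤ M := by
      refine le_trans ?_ hbig.le
      calc 400 * K ^ 2 * (K' ^ C) ^ 2 ≤ K ^ 9 * K ^ 2 * (K ^ (5 * C)) ^ 2 := by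
            gcongr; calc (400:ℝ) ≤ 2 ^ 9 := by norm_num
              _ ≤ _ := by gcongr
        _ = _ := by ring
    have hcard : (M:ℝ) / (4 * K ^ 2) ≤ H.card := by
      have e1 : (M / K) ^ 2 ≤ M + 2 * (H.card * M + M * (M / K')) := by
        refine le_trans (by gcongr) (hvdc.trans (by gcongr))
      have e2 : (M:ℝ) ≤ M * (M / (4 * K ^ 2)) := by
        apply le_mul_of_one_le_right hMr.le
        rw [one_le_div (by positivity)]
        have := one_le_pow₀ (n := 2) hK'1
        nlinarith [sq_nonneg K]
      have e3 : (M:ℝ) * (M / (4 * K ^ 2)) ≤ M * H.card := by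
        have : (M / K) ^ 2 = 4 * (M * (M / (4 * K ^ 2))) := by field_simp
        have : 2 * (M * (M / K')) = M * (M / (4 * K ^ 2)) := by rw [hK']; field_simp; norm_num
        linarith
      exact le_of_mul_le_mul_left e3 hMr
    have hI : ∀ h ∈ H, ∃ q : ℕ, q ∈ Icc 1 ⌊K' ^ C⌋₊ ∧ ∃ b : ℤ,
        |q * ((h + 1 : ℝ) * θ) - b| ≤ K' ^ C / M ^ (k + 1) := by
      intro h hh
      obtain ⟨q, q1, q2, b, hb⟩ := IH K' (by nlinarith) M hM _ _ (hu (h + 1)) (L - 1 - h) (by omega)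
        (mem_filter.1 hh).2
      exact ⟨q, mem_Icc.2 ⟨q1, Nat.le_floor q2⟩, b, by push_cast at hb; exact hb⟩
    choose! qq hq1 hq2 using hI
    set δ := 1 / (4 * K ^ 2 * K' ^ C) with hδ
    have hδ0 : 0 < δ := by positivity
    obtain ⟨q0, hq0, hq0c⟩ := Finset.exists_le_card_fiber_of_nsmul_le_card_of_maps_to
      (s := H) (t := Icc 1 ⌊K' ^ C⌋₊) (f := qq) (b := δ * M) hq1
      (Finset.nonempty_Icc.2 (Nat.le_floor (by simpa using hK'1))) (by
        rw [Nat.card_Icc, Nat.add_sub_cancel, nsmul_eq_mul]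
        refine le_trans ?_ hcard
        calc (⌊K' ^ C⌋₊:ℝ) * (δ * M) ≤ K' ^ C * (δ * M) := by
              gcongr; exact Nat.floor_le (by positivity)
          _ = _ := by rw [hδ]; field_simp)
    rw [mem_Icc] at hq0
    obtain ⟨q, hq, hqd, b, hb⟩ := vino (q0 * θ) (K' ^ C / M ^ (k + 1)) δ M hδ0 (by positivity)
      (by
        rw [hδ, ← mul_div_assoc, div_le_div_iff₀ (by positivity) (by positivity)]
        calc 100 * K' ^ C * (4 * K ^ 2 * K' ^ C) = 400 * K ^ 2 * (K' ^ C) ^ 2 := by ring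
          _ ≤ (M:ℝ) := hM4
          _ ≤ _ := by rw [one_mul]; exact le_self_pow₀ (by exact_mod_cast hM) (by omega))
      (by
        rw [hδ, div_mul_eq_mul_div, le_div_iff₀ (by positivity)]
        have : K' ^ C ≤ (K' ^ C) ^ 2 := le_self_pow₀ hK'1 (by norm_num)
        nlinarith [sq_nonneg K])
      ((H.filter fun h => qq h = q0).image (· + 1)) (by
        intro h hh
        obtain ⟨h', hh', rfl⟩ := mem_image.1 hh
        obtain ⟨m1, m2⟩ := mem_filter.1 hh'
        have m3 := mem_range.1 (mem_filter.1 m1).1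
        obtain ⟨b, hb⟩ := hq2 h' m1
        refine ⟨by omega, by omega, b, le_trans (le_of_eq ?_) hb⟩
        rw [m2]; congr 1; push_cast; ring)
      (by rw [Finset.card_image_of_injective _ (add_left_injective 1)]; exact hq0c)
    have hfin : 16 * K ^ 2 * (K' ^ C) ^ 2 ≤ K ^ ((11 + 10 * C) * (k + 2)) := by
      calc 16 * K ^ 2 * (K' ^ C) ^ 2 ≤ K ^ 4 * K ^ 2 * (K ^ (5 * C)) ^ 2 := by
            gcongr; calc (16:ℝ) = 2 ^ 4 := by norm_num
              _ ≤ _ := by gcongr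
        _ = K ^ (6 + 10 * C) := by ring
        _ ≤ _ := pow_le_pow_right₀ hK1 (by nlinarith)
    refine ⟨q * q0, Nat.mul_pos hq hq0.1, ?_, b, ?_⟩
    · refine le_trans ?_ hfin
      have : (q0:ℝ) ≤ K' ^ C := (Nat.cast_le.2 hq0.2).trans (Nat.floor_le (by positivity))
      push_cast
      calc (q:ℝ) * q0 ≤ 4 / δ * K' ^ C := by gcongr
        _ = _ := by rw [hδ]; field_simp; norm_num
    · calc |((q * q0 : ℕ):ℝ) * θ - b| = |q * (q0 * θ) - b| := by push_cast; ring_nf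
        _ ≤ _ := hb
        _ = 4 * K ^ 2 * (K' ^ C) ^ 2 / M ^ (k + 1 + 1) := by rw [hδ, pow_succ (M:ℝ) (k + 1)]; field_simp
        _ ≤ _ := by
          gcongr
          refine le_trans ?_ hfin
          gcongr; norm_num

lemma DD_poly (α : ℝ) (k : ℕ) : ∀ g : Polynomial ℤ, g.natDegree ≤ k + 1 →
    DD k (((k + 1).factorial * g.coeff (k + 1) : ℤ) * α) (fun n => α * (g.eval n : ℤ)) := by
  induction k with
  | zero =>
    intro g hg n
    have e : ∀ x : ℤ, g.eval x = g.coeff 1 * x + g.coeff 0 := by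
      intro x; conv_lhs => rw [Polynomial.eq_X_add_C_of_natDegree_le_one hg]
      simp
    simp [e]; ring
  | succ k ih =>
    intro g hg h
    have c1 : (Polynomial.taylor h g).coeff (k + 1 + 1) = g.coeff (k + 1 + 1) := by
      have h1 := (Polynomial.natDegree_hasseDeriv_le g (k + 1 + 1)).trans
        (by omega : g.natDegree - (k + 1 + 1) ≤ 0)
      rw [Polynomial.taylor_coeff, Polynomial.eq_C_of_natDegree_le_zero h1, Polynomial.eval_C,
        Polynomial.hasseDeriv_coeff]; simp
    have c2 : (Polynomial.taylor h g).coeff (k + 1) = g.coeff (k + 1) +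
        (k + 2) * g.coeff (k + 1 + 1) * h := by
      have h1 := (Polynomial.natDegree_hasseDeriv_le g (k + 1)).trans
        (by omega : g.natDegree - (k + 1) ≤ 1)
      rw [Polynomial.taylor_coeff, Polynomial.eq_X_add_C_of_natDegree_le_one h1]
      simp only [Polynomial.hasseDeriv_coeff, Polynomial.eval_add, Polynomial.eval_mul,
        Polynomial.eval_C, Polynomial.eval_X]
      rw [add_comm 1 (k + 1), Nat.choose_succ_self_right]; simp; ring
    have hd : (Polynomial.taylor h g - g).natDegree ≤ k + 1 := by
      rw [Polynomial.natDegree_le_iff_coeff_eq_zero]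
      intro N hN
      rcases (show k + 1 + 1 ≤ N from hN).eq_or_lt with rfl | h2
      · rw [Polynomial.coeff_sub, c1, sub_self]
      · rw [Polynomial.coeff_sub, Polynomial.coeff_eq_zero_of_natDegree_lt (by
          rw [Polynomial.natDegree_taylor]; omega), Polynomial.coeff_eq_zero_of_natDegree_lt
          (p := g) (by omega), sub_self]
    convert ih _ hd using 1
    · rw [Polynomial.coeff_sub, c2, Nat.factorial_succ (k + 1)]; push_cast; ring
    · funext n; simp [Polynomial.taylor_eval, add_comm]; ring

/-- Weyl for polynomials. -/
lemma weyl_poly (f : Polynomial ℤ) (k : ℕ) (hk : 1 ≤ k) (hdeg : f.natDegree = k) :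
    ∃ C : ℕ, ∀ K : ℝ, 2 ≤ K → ∀ M : ℕ, 1 ≤ M → ∀ α : ℝ, ∀ L ≤ M,
    M / K ≤ ‖∑ n ∈ range L, ee (α * (f.eval (n:ℤ) : ℤ))‖ →
    ∃ q : ℕ, 1 ≤ q ∧ (q : ℝ) ≤ K ^ C ∧ ∃ b : ℤ,
      |q * ((k.factorial * f.leadingCoeff : ℤ) * α) - b| ≤ K ^ C / M ^ k := by
  obtain ⟨k, rfl⟩ := Nat.exists_eq_add_of_le' hk
  obtain ⟨C, hC⟩ := weyl k
  refine ⟨C, fun K hK M hM α L hL h => ?_⟩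
  have h1 := DD_poly α k f hdeg.le
  have h2 : f.leadingCoeff = f.coeff (k + 1) := by rw [Polynomial.leadingCoeff, hdeg]
  rw [← h2] at h1
  exact hC K hK M hM (fun n => α * (f.eval n : ℤ)) _ h1 L hL h

lemma Saq_eq (f : Polynomial ℤ) (a : ℤ) (q : ℕ) :
    Saq f a q = ∑ r ∈ range q, ee ((a / q : ℝ) * (f.eval (r:ℤ) : ℤ)) := by
  refine sum_congr rfl fun r _ => ?_
  rw [ee]; congr 1; push_cast; ring

lemma ee_per (f : Polynomial ℤ) (a : ℤ) (q : ℕ) (hq : 1 ≤ q) (n j : ℕ) :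
    ee ((a / q : ℝ) * (f.eval ((q * j + n : ℕ):ℤ) : ℤ)) = ee ((a / q : ℝ) * (f.eval (n:ℤ) : ℤ)) := by
  obtain ⟨t, ht⟩ := Polynomial.sub_dvd_eval_sub ((q * j + n : ℕ):ℤ) n f
  have h1 : f.eval ((q * j + n : ℕ):ℤ) = f.eval (n:ℤ) + q * (j * t) := by
    push_cast at ht ⊢; linear_combination ht
  have hq0 : (q:ℝ) ≠ 0 := by positivity
  rw [h1, ← ee_add_int (_ * ((f.eval (n:ℤ) : ℤ):ℝ)) (a * j * t)]; congr 1; push_cast; field_simp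

lemma sum_per {g : ℕ → ℂ} {q : ℕ} (hg : ∀ n j, g (q * j + n) = g n) (m : ℕ) :
    ∑ n ∈ range (q * m), g n = m * ∑ n ∈ range q, g n := by
  induction m with
  | zero => simp
  | succ m ih => rw [mul_add, mul_one, sum_range_add, ih]; simp only [hg]; push_cast; ring

lemma Saq_bound (f : Polynomial ℤ) (k : ℕ) (hk : 1 ≤ k) (hdeg : f.natDegree = k)
    (hlead : 0 < f.leadingCoeff) :
    ∃ C : ℝ, 0 < C ∧ ∃ c : ℝ, 0 < c ∧ ∀ q : ℕ, 1 ≤ q → ∀ a : ℤ, IsCoprime a (q:ℤ) →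
      ‖Saq f a q‖ ≤ C * (q:ℝ) ^ (1 - c) := by
  obtain ⟨C, hC⟩ := weyl_poly f k hk hdeg
  obtain ⟨D, hD⟩ : ∃ D : ℕ, (D:ℤ) = k.factorial * f.leadingCoeff :=
    Int.eq_ofNat_of_zero_le (by positivity) |>.imp fun _ h => h.symm
  have hD1 : 1 ≤ D := by
    have : (0:ℤ) < D := by rw [hD]; positivity
    omega
  have hDr : (1:ℝ) ≤ D := by exact_mod_cast hD1
  have key : ∀ q : ℕ, 1 ≤ q → ∀ a : ℤ, IsCoprime a (q:ℤ) → ∀ K : ℝ, 2 ≤ K → K ^ C * D < q →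
      ‖Saq f a q‖ ≤ q / K := by
    intro q hq a ha K hK hKq
    by_contra! hcon
    have hqr : (1:ℝ) ≤ q := by exact_mod_cast hq
    obtain ⟨q', h1, h2, b, hb⟩ := hC K hK (q * q) (Nat.mul_pos hq hq) (a / q) (q * q) le_rfl (by
      rw [sum_per (fun n j => ee_per f a q hq n j), ← Saq_eq, norm_mul, Complex.norm_natCast]
      push_cast; rw [mul_div_assoc]; gcongr)
    rw [← hD] at hb
    have hKC : 0 < K ^ C := by positivity
    have e1 : |((q' * D * a - b * q : ℤ):ℝ)| < 1 := by
      have : ((q' * D * a - b * q : ℤ):ℝ) = q * (q' * ((D:ℤ) * (a / q)) - b) := by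
        push_cast; field_simp
      rw [this, abs_mul, abs_of_pos (by linarith)]
      calc (q:ℝ) * |(q':ℝ) * (((D:ℤ):ℝ) * ((a:ℝ) / q)) - b| ≤ q * (K ^ C / (q * q : ℕ) ^ k) := by gcongr
        _ ≤ q * (K ^ C / (q * q : ℕ)) := by
          gcongr; exact le_self_pow₀ (by exact_mod_cast Nat.mul_pos hq hq) (by omega)
        _ = K ^ C / q := by push_cast; field_simp
        _ < 1 := by rw [div_lt_one (by linarith)]; nlinarith
    have e2 : q' * D * a - b * q = 0 := by
      rw [← Int.abs_lt_one_iff]; exact_mod_cast e1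
    have e3 : (q:ℤ) ∣ (q' * D : ℕ) := ha.symm.dvd_of_dvd_mul_right ⟨b, by push_cast; linarith⟩
    have e4 : q ≤ q' * D := Nat.le_of_dvd (Nat.mul_pos h1 hD1) (Int.natCast_dvd_natCast.1 e3)
    have e5 : (q:ℝ) ≤ q' * D := by exact_mod_cast e4
    have : (q':ℝ) * D ≤ K ^ C * D := by gcongr
    linarith
  set c : ℝ := 1 / ((C:ℝ) + 1) with hc
  have hc0 : 0 < c := by positivity
  refine ⟨2 * (2 * D) ^ c, by positivity, c, hc0, fun q hq a ha => ?_⟩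
  have hqr : (1:ℝ) ≤ q := by exact_mod_cast hq
  have hq0 : (0:ℝ) < q := by linarith
  set K : ℝ := ((q:ℝ) / (2 * D)) ^ c with hK
  have hKp : 0 < K := by positivity
  have hKe : 2 * (2 * (D:ℝ)) ^ c * (q:ℝ) ^ (1 - c) = 2 * (q / K) := by
    rw [hK, Real.div_rpow hq0.le (by positivity), rpow_sub hq0, rpow_one]; field_simp
  rw [hKe]
  by_cases h2 : 2 ≤ K
  · refine (key q hq a ha K h2 ?_).trans (by have : 0 < q / K := by positivity
                                             linarith)
    have h3 : K ^ (C + 1) = q / (2 * D) := by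
      rw [hK, ← rpow_natCast, ← rpow_mul (by positivity), hc]
      push_cast; rw [one_div_mul_cancel (by positivity), rpow_one]
    have h4 : K ^ C ≤ K ^ (C + 1) := pow_le_pow_right₀ (by linarith) (by omega)
    rw [h3] at h4
    calc K ^ C * D ≤ q / (2 * D) * D := by gcongr
      _ = q / 2 := by field_simp
      _ < q := by linarith
  · rw [Saq_eq]
    refine (norm_sum_le _ _).trans ?_
    simp only [norm_ee, sum_const, Finset.card_range, nsmul_eq_mul, mul_one]
    rw [← mul_div_assoc, le_div_iff₀ hKp]; nlinarith

lemma prod_ge (S : Finset ℕ) : (∀ p ∈ S, 2 ≤ p) →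
    (1:ℚ) / (S.card + 1) ≤ ∏ p ∈ S, (1 - (p:ℚ)⁻¹) := by
  induction S using Finset.induction_on_max with
  | empty => simp
  | insert a s hs ih =>
    intro h
    have ha : a ∉ s := fun h => lt_irrefl _ (hs a h)
    have h1 : s.card + 2 ≤ a := by
      have : insert a s ⊆ Icc 2 a := by
        intro x hx
        refine mem_Icc.2 ⟨h x hx, ?_⟩
        rcases mem_insert.1 hx with rfl | h'
        · exact le_rfl
        · exact (hs x h').le
      have := Finset.card_le_card this
      rw [Finset.card_insert_of_notMem ha, Nat.card_Icc] at this
      have := h a (mem_insert_self _ _)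
      omega
    rw [Finset.prod_insert ha, Finset.card_insert_of_notMem ha]
    have h2 : ((s.card:ℚ) + 1) / (s.card + 2) ≤ 1 - (a:ℚ)⁻¹ := by
      have h3 : (s.card:ℚ) + 2 ≤ a := by exact_mod_cast h1
      have h4 : (a:ℚ)⁻¹ ≤ ((s.card:ℚ) + 2)⁻¹ := by gcongr
      have : ((s.card:ℚ) + 1) / (s.card + 2) = 1 - ((s.card:ℚ) + 2)⁻¹ := by field_simp; ring
      linarith
    have h3 := ih fun p hp => h p (mem_insert_of_mem hp)
    calc (1:ℚ) / ((s.card + 1 : ℕ) + 1) = ((s.card:ℚ) + 1) / (s.card + 2) * (1 / (s.card + 1)) := by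
          push_cast; field_simp; ring
      _ ≤ _ := by gcongr; exact le_trans (by positivity) h2

lemma totient_ge {ε : ℝ} (hε : 0 < ε) : ∃ C : ℝ, 0 < C ∧ ∀ q : ℕ, 1 ≤ q →
    (q:ℝ) ^ (1 - ε) ≤ C * q.totient := by
  refine ⟨1 / (ε * log 2) + 1, by positivity, fun q hq => ?_⟩
  have hqr : (1:ℝ) ≤ q := by exact_mod_cast hq
  have hq0 : (0:ℝ) < q := by linarith
  have h1 := prod_ge q.primeFactors fun p hp => (Nat.prime_of_mem_primeFactors hp).two_le
  have h2 : (q:ℝ) ≤ q.totient * (q.primeFactors.card + 1) := by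
    have e : (q:ℚ) * (1 / (q.primeFactors.card + 1)) ≤ q.totient := by
      rw [Nat.totient_eq_mul_prod_factors]; gcongr
    rw [mul_one_div, div_le_iff₀ (by positivity)] at e
    exact_mod_cast e
  have h3 : 2 ^ q.primeFactors.card ≤ q :=
    (Finset.pow_card_le_prod _ _ _ fun p hp => (Nat.prime_of_mem_primeFactors hp).two_le).trans
      (Nat.le_of_dvd hq (Nat.prod_primeFactors_dvd q))
  have h4 : (q.primeFactors.card:ℝ) * log 2 ≤ log q := by
    rw [← log_pow]; apply log_le_log (by positivity); exact_mod_cast h3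
  have h5 := log_le_rpow_div hq0.le hε
  have h6 : (q.primeFactors.card:ℝ) + 1 ≤ (1 / (ε * log 2) + 1) * (q:ℝ) ^ ε := by
    have e1 : (q.primeFactors.card:ℝ) ≤ (q:ℝ) ^ ε / ε / log 2 := by
      rw [le_div_iff₀ (by positivity)]; linarith
    have e2 := Real.one_le_rpow hqr hε.le
    calc _ ≤ (q:ℝ) ^ ε / ε / log 2 + (q:ℝ) ^ ε := by linarith
      _ = _ := by field_simp
  rw [rpow_sub hq0, rpow_one, div_le_iff₀ (by positivity)]
  refine h2.trans ?_
  nlinarith [(Nat.cast_nonneg q.totient : (0:ℝ) ≤ q.totient)]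

noncomputable def sterm (f : Polynomial ℤ) (q : ℕ) : ℂ :=
    ((((ArithmeticFunction.moebius q : ℝ) ^ 2 /
        ((q : ℝ) * (Nat.totient q : ℝ) ^ 2)) : ℝ) : ℂ) *
      ∑ a ∈ (range q).filter fun a => Nat.Coprime a q, Saq f (a : ℤ) q

lemma SS_tail (f : Polynomial ℤ) (k : ℕ) (hk : 1 ≤ k) (hdeg : f.natDegree = k)
    (hlead : 0 < f.leadingCoeff) :
    ∃ C : ℝ, 0 < C ∧ ∃ c : ℝ, 0 < c ∧ ∀ Q : ℕ, 1 ≤ Q →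
      ‖SingSeries f - ∑ q ∈ range Q, sterm f q‖ ≤ C * (Q:ℝ) ^ (-c) := by
  obtain ⟨C, hC, c, hc, hS⟩ := Saq_bound f k hk hdeg hlead
  obtain ⟨C', hC', hφ⟩ := totient_ge (ε := c / 3) (by positivity)
  have hb : ∀ q : ℕ, 1 ≤ q → ‖sterm f q‖ ≤ C * C' * (q:ℝ) ^ (-(1 + 2 * c / 3)) := by
    intro q hq
    have hqr : (0:ℝ) < q := by exact_mod_cast hq
    have hφ0 : (0:ℝ) < q.totient := by exact_mod_cast Nat.totient_pos.2 hq
    rw [sterm, norm_mul]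
    have e1 : ‖∑ a ∈ (range q).filter fun a => Nat.Coprime a q, Saq f (a : ℤ) q‖ ≤
        q.totient * (C * (q:ℝ) ^ (1 - c)) := by
      refine (norm_sum_le _ _).trans ?_
      refine (sum_le_card_nsmul _ _ (C * (q:ℝ) ^ (1 - c)) fun a ha => ?_).trans ?_
      · exact hS q hq a (Nat.isCoprime_iff_coprime.2 (mem_filter.1 ha).2)
      · rw [nsmul_eq_mul, Nat.totient]; simp only [Nat.coprime_comm]; rfl
    have e2 : ‖((((ArithmeticFunction.moebius q : ℝ) ^ 2 /
        ((q : ℝ) * (Nat.totient q : ℝ) ^ 2)) : ℝ) : ℂ)‖ ≤ 1 / (q * q.totient ^ 2) := by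
      rw [Complex.norm_real, norm_of_nonneg (by positivity)]
      gcongr
      have := ArithmeticFunction.abs_moebius_le_one (n := q)
      rw [sq_le_one_iff_abs_le_one]; exact_mod_cast this
    calc _ ≤ 1 / (q * q.totient ^ 2) * (q.totient * (C * (q:ℝ) ^ (1 - c))) := by gcongr
      _ = C * (q:ℝ) ^ (1 - c) / q * (1 / q.totient) := by field_simp
      _ ≤ C * (q:ℝ) ^ (1 - c) / q * (C' / (q:ℝ) ^ (1 - c / 3)) := by
        refine mul_le_mul_of_nonneg_left ?_ (by positivity)
        rw [div_le_div_iff₀ hφ0 (by positivity), one_mul]; exact hφ q hq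
      _ = C * C' * ((q:ℝ) ^ (1 - c) / (q ^ (1:ℝ) * (q:ℝ) ^ (1 - c / 3))) := by
        rw [rpow_one]; field_simp
      _ = _ := by rw [← rpow_add hqr, ← rpow_sub hqr]; ring_nf
  have hb0 : sterm f 0 = 0 := by simp [sterm]
  have hsum : Summable fun q : ℕ => (q:ℝ) ^ (-(1 + c / 3)) := Real.summable_nat_rpow.2 (by linarith)
  have hb' : ∀ Q : ℕ, 1 ≤ Q → ∀ q, Q ≤ q →
      ‖sterm f q‖ ≤ C * C' * (Q:ℝ) ^ (-(c / 3)) * (q:ℝ) ^ (-(1 + c / 3)) := by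
    intro Q hQ q hq
    have hQr : (0:ℝ) < Q := by exact_mod_cast hQ
    have hQq : (Q:ℝ) ≤ q := by exact_mod_cast hq
    refine (hb q (hQ.trans hq)).trans ?_
    rw [show -(1 + 2 * c / 3) = -(c / 3) + (-(1 + c / 3)) by ring,
      rpow_add (by linarith), ← mul_assoc]
    refine mul_le_mul_of_nonneg_right (mul_le_mul_of_nonneg_left ?_ (by positivity)) (by positivity)
    exact rpow_le_rpow_of_nonpos hQr hQq (by linarith)
  have hsm : Summable (sterm f) := by
    rw [← summable_nat_add_iff 1]
    refine Summable.of_norm_bounded (((summable_nat_add_iff 1).2 hsum).mul_left _)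
      (fun q => hb' 1 le_rfl (q + 1) (by omega))
  have htot : 0 ≤ ∑' q : ℕ, (q:ℝ) ^ (-(1 + c / 3)) := tsum_nonneg fun q => by positivity
  refine ⟨C * C' * (∑' q : ℕ, (q:ℝ) ^ (-(1 + c / 3)) + 1), by positivity, c / 3, by positivity,
    fun Q hQ => ?_⟩
  have e0 : SingSeries f - ∑ q ∈ range Q, sterm f q = ∑' q, sterm f (q + Q) := by
    rw [sub_eq_iff_eq_add', hsm.sum_add_tsum_nat_add Q]; rfl
  rw [e0]
  have hs2 := (summable_nat_add_iff Q).2 hsum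
  have h1 := tsum_of_norm_bounded (hs2.mul_left (C * C' * (Q:ℝ) ^ (-(c / 3)))).hasSum
    (fun q => hb' Q hQ (q + Q) (by omega))
  rw [tsum_mul_left] at h1
  refine h1.trans ?_
  have h2 : ∑' q : ℕ, ((q + Q : ℕ):ℝ) ^ (-(1 + c / 3)) ≤ ∑' q : ℕ, (q:ℝ) ^ (-(1 + c / 3)) + 1 := by
    rw [← hsum.sum_add_tsum_nat_add Q]
    have : 0 ≤ ∑ i ∈ range Q, (i:ℝ) ^ (-(1 + c / 3)) := by positivity
    linarith
  calc _ ≤ C * C' * (Q:ℝ) ^ (-(c / 3)) * (∑' q : ℕ, (q:ℝ) ^ (-(1 + c / 3)) + 1) := by gcongr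
    _ = _ := by ring

/-! ### Growth of L-functions -/

lemma cpow_diff {s : ℂ} {x y : ℝ} (hx : 0 < x) (hxy : x ≤ y) (hs : 0 < s.re) :
    ‖(y:ℂ) ^ (-s) - (x:ℂ) ^ (-s)‖ ≤ ‖s‖ * x ^ (-s.re - 1) * (y - x) := by
  have h1 : ∀ u ∈ Set.Icc x y, HasDerivWithinAt (fun u : ℝ => (u:ℂ) ^ (-s))
      (-s * (u:ℂ) ^ (-s - 1)) (Set.Icc x y) u := by
    intro u hu
    have hu0 : 0 < u := lt_of_lt_of_le hx hu.1
    have := ((hasDerivAt_id (u:ℂ)).cpow_const (c := -s)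
      (Complex.ofReal_mem_slitPlane.2 hu0)).comp_ofReal
    simpa using this.hasDerivWithinAt
  have h2 := Convex.norm_image_sub_le_of_norm_hasDerivWithin_le (C := ‖s‖ * x ^ (-s.re - 1)) h1
    (fun u hu => ?_) (convex_Icc x y) ⟨le_rfl, hxy⟩ ⟨hxy, le_rfl⟩
  · rwa [norm_of_nonneg (by linarith : 0 ≤ y - x)] at h2
  · have hu0 : 0 < u := lt_of_lt_of_le hx hu.1
    rw [norm_mul, norm_neg, Complex.norm_cpow_eq_rpow_re_of_pos hu0]
    simp only [Complex.sub_re, Complex.neg_re, Complex.one_re]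
    gcongr ?_ * ?_
    exact rpow_le_rpow_of_nonpos hx hu.1 (by linarith)

lemma cpow_diff2 {ε : ℝ} (h0 : 0 < ε) (h1 : ε ≤ 1 / 2) {s : ℂ} (hs : 1 - ε < s.re) {x y q : ℝ}
    (hx : 1 ≤ x) (hxy : x ≤ y) (hq : y - x ≤ q) :
    ‖(x:ℂ) ^ (-s) - (y:ℂ) ^ (-s)‖ ≤ 2 * (‖s‖ * q) ^ (2 * ε) * x ^ (-(1 + ε)) := by
  have hσ : 0 < s.re := by linarith
  have hx0 : 0 < x := by linarith
  have hq0 : 0 ≤ q := by linarith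
  set z := ‖s‖ * q / x with hz
  have hz0 : 0 ≤ z := by positivity
  have b1 : ‖(x:ℂ) ^ (-s) - (y:ℂ) ^ (-s)‖ ≤ z * x ^ (-s.re) := by
    rw [norm_sub_rev]
    refine (cpow_diff hx0 hxy hσ).trans ?_
    calc ‖s‖ * x ^ (-s.re - 1) * (y - x) ≤ ‖s‖ * x ^ (-s.re - 1) * q := by gcongr
      _ = _ := by rw [rpow_sub hx0, rpow_one, hz]; ring
  have b2 : ‖(x:ℂ) ^ (-s) - (y:ℂ) ^ (-s)‖ ≤ 2 * x ^ (-s.re) := by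
    refine (norm_sub_le _ _).trans ?_
    rw [Complex.norm_cpow_eq_rpow_re_of_pos hx0, Complex.norm_cpow_eq_rpow_re_of_pos (by linarith),
      Complex.neg_re, two_mul]
    have := rpow_le_rpow_of_nonpos hx0 hxy (by linarith : -s.re ≤ 0)
    linarith
  have b3 : ‖(x:ℂ) ^ (-s) - (y:ℂ) ^ (-s)‖ ≤ 2 * z ^ (2 * ε) * x ^ (-s.re) := by
    rcases le_total z 1 with h | h
    · refine b1.trans ?_
      gcongr
      have := rpow_le_rpow_of_exponent_ge_of_imp hz0 h (by linarith : 2 * ε ≤ 1)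
        (fun _ h => absurd h (by linarith))
      rw [rpow_one] at this
      have : 0 ≤ z ^ (2 * ε) := by positivity
      linarith
    · refine b2.trans ?_
      gcongr
      have := Real.one_le_rpow h (by linarith : 0 ≤ 2 * ε)
      linarith
  refine b3.trans ?_
  rw [hz, Real.div_rpow (by positivity) hx0.le, mul_div_assoc', div_mul_eq_mul_div, mul_div_assoc,
    ← rpow_sub hx0]
  gcongr
  linarith

lemma cont_bound {F : ℕ → ℂ → ℂ} {G : ℂ → ℂ} {B : ℝ → ℝ} {ε : ℝ} (h0 : 0 < ε) (h1 : ε ≤ 1 / 2)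
    (hB : ∀ x y, 0 ≤ x → x ≤ y → B x ≤ B y)
    (hF : ∀ n, ∀ s : ℂ, s ≠ 0 → DifferentiableAt ℂ (F n) s)
    (hFB : ∀ n : ℕ, ∀ s : ℂ, 1 - ε < s.re → ‖F n s‖ ≤ B ‖s‖ * (n:ℝ) ^ (-(1 + ε)))
    (hG : Differentiable ℂ G) (hGF : ∀ s : ℂ, 1 < s.re → G s = ∑' n, F n s) (s : ℂ)
    (hs : 1 - ε < s.re) : ‖G s‖ ≤ B ‖s‖ * ∑' n : ℕ, (n:ℝ) ^ (-(1 + ε)) := by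
  have hsum : Summable fun n : ℕ => (n:ℝ) ^ (-(1 + ε)) := Real.summable_nat_rpow.2 (by linarith)
  set R := ‖s‖ + 3
  set U : Set ℂ := {z | 1 - ε < z.re} ∩ Metric.ball 0 R with hU
  have hUo : IsOpen U := (isOpen_lt continuous_const Complex.continuous_re).inter Metric.isOpen_ball
  have hUc : Convex ℝ U := (convex_halfSpace_re_gt _).inter (convex_ball _ _)
  have hd : DifferentiableOn ℂ (fun z => ∑' n, F n z) U := by
    refine Complex.differentiableOn_tsum_of_summable_norm (hsum.mul_left (B R)) (fun n z hz => ?_)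
      hUo (fun n z hz => ?_)
    · refine (hF n z ?_).differentiableWithinAt
      rintro rfl; have := hz.1; simp at this; linarith
    · refine (hFB n z hz.1).trans ?_
      gcongr
      exact hB _ _ (norm_nonneg _) ((mem_ball_zero_iff.1 hz.2).le)
  have h2U : (2:ℂ) ∈ U := by
    refine ⟨by simp; linarith, ?_⟩
    simp only [Metric.mem_ball, dist_zero_right, R]; norm_num; linarith [norm_nonneg s]
  have heq : Set.EqOn G (fun z => ∑' n, F n z) U := by
    refine AnalyticOnNhd.eqOn_of_preconnected_of_eventuallyEq
      (hG.differentiableOn.analyticOnNhd hUo) (hd.analyticOnNhd hUo) hUc.isPreconnected h2U ?_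
    filter_upwards [(isOpen_lt continuous_const Complex.continuous_re).mem_nhds
      (show (1:ℝ) < (2:ℂ).re by norm_num)] with z hz using hGF z hz
  rw [heq ⟨hs, by simp [R]⟩, ← tsum_mul_left]
  exact tsum_of_norm_bounded (hsum.mul_left _).hasSum fun n => hFB n s hs

/-- the block comparison point -/
def vv (q n : ℕ) : ℕ := q * (n / q + 1)

lemma vv_bd {q : ℕ} (hq : 1 ≤ q) (n : ℕ) : n ≤ vv q n ∧ vv q n ≤ n + q := by
  have h1 := Nat.div_add_mod n q
  have h2 := Nat.mod_lt n hq
  rw [vv, mul_add, mul_one]; omega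

noncomputable def FF {q : ℕ} (χ : DirichletCharacter ℂ q) (n : ℕ) (s : ℂ) : ℂ :=
  χ n * (((n:ℝ):ℂ) ^ (-s) - ((vv q n:ℝ):ℂ) ^ (-s))

lemma FF_bd {ε : ℝ} (h0 : 0 < ε) (h1 : ε ≤ 1 / 2) {q : ℕ} (hq : 2 ≤ q)
    (χ : DirichletCharacter ℂ q) (n : ℕ) {s : ℂ} (hs : 1 - ε < s.re) :
    ‖FF χ n s‖ ≤ 2 * (‖s‖ * q) ^ (2 * ε) * (n:ℝ) ^ (-(1 + ε)) := by
  rcases Nat.eq_zero_or_pos n with rfl | hn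
  · haveI : Fact (1 < q) := ⟨hq⟩
    have : χ ((0:ℕ):ZMod q) = 0 := by
      rw [Nat.cast_zero]; exact MulChar.map_nonunit _ not_isUnit_zero
    rw [FF, this, zero_mul, norm_zero]; positivity
  · rw [FF, norm_mul]
    have e := vv_bd (by omega : 1 ≤ q) n
    refine (mul_le_of_le_one_left (norm_nonneg _) (DirichletCharacter.norm_le_one χ _)).trans ?_
    refine cpow_diff2 h0 h1 hs (by exact_mod_cast hn) (by exact_mod_cast e.1) ?_
    rw [sub_le_iff_le_add']; exact_mod_cast e.2

lemma FF_sum {q : ℕ} (hq : 2 ≤ q) [NeZero q] (χ : DirichletCharacter ℂ q) {s : ℂ} (hs : 1 < s.re) :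
    LSeries (fun n => χ n) s = ∑' n, FF χ n s + (∑ j : ZMod q, χ j) * (q:ℂ) ^ (-s) * riemannZeta s := by
  have hs0 : s ≠ 0 := by rintro rfl; simp at hs; linarith
  have hz : Summable fun m : ℕ => ((m + 1 : ℕ):ℂ) ^ (-s) := by
    rw [summable_nat_add_iff 1 (f := fun m : ℕ => (m:ℂ) ^ (-s))]
    have := Complex.summable_one_div_nat_cpow.2 hs
    simpa [Complex.cpow_neg] using this
  have hqc : (q:ℂ) ≠ 0 := by exact_mod_cast NeZero.ne q
  have hvm : ∀ (j : ZMod q) (m : ℕ), vv q (j.val + q * m) = q * (m + 1) := by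
    intro j m
    rw [vv, Nat.add_mul_div_left _ _ (by omega), Nat.div_eq_of_lt (ZMod.val_lt j), zero_add]
  have hsum1 : Summable fun n : ℕ => FF χ n s :=
    Summable.of_norm_bounded ((Real.summable_nat_rpow.2 (by norm_num : -(1 + (1/2:ℝ)) < -1)).mul_left
      _) (fun n => FF_bd (by norm_num) le_rfl hq χ n (by linarith))
  have hsum2 : Summable fun n : ℕ => χ n * ((n:ℝ):ℂ) ^ (-s) := by
    have := DirichletCharacter.LSeriesSummable_of_one_lt_re χ hs
    refine this.congr fun n => ?_
    rcases eq_or_ne n 0 with rfl | hn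
    · simp [Complex.zero_cpow (neg_ne_zero.2 hs0)]
    · rw [LSeries.term_of_ne_zero hn, Complex.cpow_neg]; simp [div_eq_mul_inv]
  have hL : LSeries (fun n => χ n) s = ∑' n : ℕ, χ n * ((n:ℝ):ℂ) ^ (-s) := by
    refine tsum_congr fun n => ?_
    rcases eq_or_ne n 0 with rfl | hn
    · simp [Complex.zero_cpow (neg_ne_zero.2 hs0)]
    · rw [LSeries.term_of_ne_zero hn, Complex.cpow_neg]; simp [div_eq_mul_inv]
  have hsum3 : Summable fun n : ℕ => χ n * ((vv q n:ℝ):ℂ) ^ (-s) := by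
    refine (hsum2.sub hsum1).congr fun n => ?_
    rw [FF]; ring
  have hv : ∑' n : ℕ, χ n * ((vv q n:ℝ):ℂ) ^ (-s) =
      (∑ j : ZMod q, χ j) * (q:ℂ) ^ (-s) * riemannZeta s := by
    rw [Nat.sumByResidueClasses hsum3 q, mul_assoc, sum_mul]
    refine sum_congr rfl fun j _ => ?_
    have : ∀ m : ℕ, χ ((j.val + q * m : ℕ) : ZMod q) * ((vv q (j.val + q * m) : ℝ):ℂ) ^ (-s) =
        χ j * ((q:ℂ) ^ (-s) * ((m + 1 : ℕ):ℂ) ^ (-s)) := by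
      intro m
      rw [hvm]; congr 1
      · simp
      · push_cast
        have := Complex.natCast_mul_natCast_cpow q (m + 1) (-s)
        push_cast at this; exact this
    simp_rw [this]
    rw [tsum_mul_left, tsum_mul_left, zeta_eq_tsum_one_div_nat_add_one_cpow hs]
    congr 2
    refine tsum_congr fun m => ?_
    rw [Complex.cpow_neg]; simp
  rw [hL, ← hv, ← hsum1.tsum_add hsum3]
  refine tsum_congr fun n => ?_
  rw [FF]; ring

noncomputable def Zc (ε : ℝ) : ℝ := 2 * ∑' n : ℕ, (n:ℝ) ^ (-(1 + ε)) + 1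

lemma Zc_pos (ε : ℝ) : 0 < Zc ε := by
  have : 0 ≤ ∑' n : ℕ, (n:ℝ) ^ (-(1 + ε)) := tsum_nonneg fun n => by positivity
  rw [Zc]; linarith

lemma two_le_of_ne_one {q : ℕ} [NeZero q] {χ : DirichletCharacter ℂ q} (hχ : χ ≠ 1) : 2 ≤ q := by
  rcases q with _ | _ | q
  · exact absurd rfl (NeZero.ne 0)
  · exact absurd (DirichletCharacter.level_one χ) hχ
  · omega

lemma L_bound {ε : ℝ} (h0 : 0 < ε) (h1 : ε ≤ 1 / 2) {q : ℕ} [NeZero q]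
    {χ : DirichletCharacter ℂ q} (hχ : χ ≠ 1) {s : ℂ} (hs : 1 - ε < s.re) :
    ‖DirichletCharacter.LFunction χ s‖ ≤ Zc ε * (‖s‖ * q) ^ (2 * ε) := by
  have hq := two_le_of_ne_one hχ
  have := cont_bound (F := FF χ) (G := DirichletCharacter.LFunction χ)
    (B := fun r => 2 * (r * q) ^ (2 * ε)) h0 h1
    (fun x y hx hxy => by gcongr) (fun n s hs => ?_) (fun n s hs => FF_bd h0 h1 hq χ n hs)
    (DirichletCharacter.differentiable_LFunction hχ) (fun s hs => ?_) s hs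
  · refine this.trans ?_
    have h2 : 0 ≤ (‖s‖ * q) ^ (2 * ε) := by positivity
    rw [Zc]; nlinarith
  · have hs' : -s ≠ 0 := neg_ne_zero.2 hs
    exact ((differentiableAt_id.neg.const_cpow (Or.inr hs')).sub
      (differentiableAt_id.neg.const_cpow (Or.inr hs'))).const_mul _
  · rw [DirichletCharacter.LFunction_eq_LSeries χ hs, FF_sum hq χ hs,
      MulChar.sum_eq_zero_of_ne_one hχ]; simp

lemma triv_bound {ε : ℝ} (h0 : 0 < ε) (h1 : ε ≤ 1 / 2) {q : ℕ} [NeZero q]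
    {s : ℂ} (hs : 1 < s.re) :
    ‖LSeries (fun n => (1 : DirichletCharacter ℂ q) n) s‖ ≤
      Zc ε * (‖s‖ * q) ^ (2 * ε) + ‖riemannZeta s‖ := by
  have h2 : 0 ≤ Zc ε * (‖s‖ * q) ^ (2 * ε) := mul_nonneg (Zc_pos _).le (by positivity)
  by_cases hq : 2 ≤ q
  · rw [FF_sum hq _ hs]
    refine (norm_add_le _ _).trans (add_le_add ?_ ?_)
    · refine (tsum_of_norm_bounded ((Real.summable_nat_rpow.2
        (by linarith : -(1 + ε) < -1)).mul_left _).hasSum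
        (fun n => FF_bd h0 h1 hq _ n (by linarith))).trans ?_
      have h2 : 0 ≤ (‖s‖ * q) ^ (2 * ε) := by positivity
      rw [Zc, tsum_mul_left]; nlinarith
    · rw [norm_mul]
      refine mul_le_of_le_one_left (norm_nonneg _) ?_
      have hq0 : (0:ℝ) < q := by positivity
      rw [norm_mul, ← Complex.ofReal_natCast q, Complex.norm_cpow_eq_rpow_re_of_pos hq0]
      have e1 : ‖∑ j : ZMod q, (1 : DirichletCharacter ℂ q) j‖ ≤ q := by
        refine (norm_sum_le _ _).trans ?_
        refine (sum_le_card_nsmul _ _ 1 fun a _ =>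
          DirichletCharacter.norm_le_one _ _).trans ?_
        simp [ZMod.card]
      calc _ ≤ (q:ℝ) * (q:ℝ) ^ (-(1:ℝ)) := by
            gcongr
            · exact_mod_cast (by omega : 1 ≤ q)
            · simp; linarith
        _ = 1 := by rw [rpow_neg_one]; field_simp
  · have hq1 : q = 1 := by have := NeZero.pos q; omega
    subst hq1
    rw [← DirichletCharacter.LFunction_eq_LSeries _ hs]
    simp only [DirichletCharacter.LFunction_modOne_eq]
    linarith

lemma zeta₁_eq {s : ℂ} (hs : s ≠ 1) : riemannZeta₁ s = (s - 1) * riemannZeta s := by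
  rw [riemannZeta_eq_inv_sub_mul hs, mul_inv_cancel_left₀ (sub_ne_zero.2 hs)]

lemma zeta_term {ε : ℝ} (h0 : 0 < ε) (h1 : ε ≤ 1 / 2) {s : ℂ} (hs : 1 - ε < s.re) {x : ℝ}
    (hx : 1 ≤ x) :
    ‖(s - 1) * (x:ℂ) ^ (-s) - (x:ℂ) ^ (1 - s) + ((x + 1 : ℝ):ℂ) ^ (1 - s)‖ ≤
      ‖s - 1‖ * (2 * ‖s‖ ^ (2 * ε) * x ^ (-(1 + ε))) := by
  have h1 : ∀ u ∈ Set.Icc x (x + 1), HasDerivWithinAt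
      (fun u : ℝ => (s - 1) * (x:ℂ) ^ (-s) * u + (u:ℂ) ^ (1 - s))
      ((s - 1) * ((x:ℂ) ^ (-s) - (u:ℂ) ^ (-s))) (Set.Icc x (x + 1)) u := by
    intro u hu
    have hu0 : 0 < u := lt_of_lt_of_le (by linarith) hu.1
    have := (((hasDerivAt_id (u:ℂ)).const_mul ((s - 1) * (x:ℂ) ^ (-s))).add
      ((hasDerivAt_id (u:ℂ)).cpow_const (c := 1 - s)
      (Complex.ofReal_mem_slitPlane.2 hu0))).comp_ofReal
    refine (this.hasDerivWithinAt).congr_deriv ?_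
    simp only [id, mul_one, show 1 - s - 1 = -s by ring]; ring
  have h2 := Convex.norm_image_sub_le_of_norm_hasDerivWithin_le
    (C := ‖s - 1‖ * (2 * ‖s‖ ^ (2 * ε) * x ^ (-(1 + ε)))) h1
    (fun u hu => ?_) (convex_Icc x (x + 1)) ⟨le_rfl, by linarith⟩ ⟨by linarith, le_rfl⟩
  · refine le_trans (le_of_eq ?_) (h2.trans (le_of_eq ?_))
    · congr 1; push_cast; ring
    · simp
  · rw [norm_mul]
    have := cpow_diff2 h0 (by assumption) hs hx hu.1 (q := 1) (by linarith [hu.2])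
    rw [mul_one] at this; gcongr

lemma zeta_bound {ε : ℝ} (h0 : 0 < ε) (h1 : ε ≤ 1 / 2) {s : ℂ} (hs : 1 - ε < s.re) :
    ‖riemannZeta₁ s - 1‖ ≤ Zc ε * ((‖s‖ + 1) * ‖s‖ ^ (2 * ε)) := by
  set F : ℕ → ℂ → ℂ := fun n s => if n = 0 then 0 else
    (s - 1) * ((n:ℝ):ℂ) ^ (-s) - ((n:ℝ):ℂ) ^ (1 - s) + (((n:ℝ) + 1 : ℝ):ℂ) ^ (1 - s) with hF
  have hFb : ∀ n : ℕ, ∀ s : ℂ, 1 - ε < s.re → ‖F n s‖ ≤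
      (2 * ((‖s‖ + 1) * ‖s‖ ^ (2 * ε))) * (n:ℝ) ^ (-(1 + ε)) := by
    intro n s hs
    by_cases hn : n = 0
    · simp only [hF, hn, if_true, norm_zero]; positivity
    · simp only [hF, hn, if_false]
      refine (zeta_term h0 h1 hs (by exact_mod_cast Nat.pos_of_ne_zero hn)).trans ?_
      have : ‖s - 1‖ ≤ ‖s‖ + 1 := (norm_sub_le _ _).trans (by simp)
      calc _ ≤ (‖s‖ + 1) * (2 * ‖s‖ ^ (2 * ε) * (n:ℝ) ^ (-(1 + ε))) := by gcongr
        _ = _ := by ring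
  have := cont_bound (F := F) (G := fun s => riemannZeta₁ s - 1)
    (B := fun r => 2 * ((r + 1) * r ^ (2 * ε))) h0 h1
    (fun x y hx hxy => by have : 0 ≤ y + 1 := by linarith
                          gcongr) (fun n s hs => ?_)
    hFb (differentiable_riemannZeta₁.sub_const 1) (fun s hs => ?_) s hs
  · refine this.trans ?_
    have h2 : 0 ≤ (‖s‖ + 1) * ‖s‖ ^ (2 * ε) := by positivity
    rw [Zc]; nlinarith
  · by_cases hn : n = 0
    · simp only [hF, hn, if_true]; exact differentiableAt_const _
    · simp only [hF, hn, if_false]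
      have e1 : ((n:ℝ):ℂ) ≠ 0 := by exact_mod_cast hn
      have e2 : (((n:ℝ) + 1 : ℝ):ℂ) ≠ 0 := by exact_mod_cast Nat.succ_ne_zero n
      fun_prop (disch := first | exact Or.inl e1 | exact Or.inl e2)
  · have hs1 : s ≠ 1 := by rintro rfl; simp at hs
    have hsum : Summable fun n => F n s := Summable.of_norm_bounded
      ((Real.summable_nat_rpow.2 (by linarith : -(1 + ε) < -1)).mul_left _)
      (fun n => hFb n s (by linarith))
    have e0 : ∑' n, F n s = ∑' n, F (n + 1) s := by
      rw [hsum.tsum_eq_zero_add]; simp [hF]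
    have e1 := ((summable_nat_add_iff 1).2 hsum).hasSum.tendsto_sum_nat
    have hz : Summable fun m : ℕ => ((m + 1 : ℕ):ℂ) ^ (-s) := by
      rw [summable_nat_add_iff 1 (f := fun m : ℕ => (m:ℂ) ^ (-s))]
      have := Complex.summable_one_div_nat_cpow.2 hs
      simpa [Complex.cpow_neg] using this
    have e2 : ∀ N : ℕ, ∑ n ∈ range N, F (n + 1) s =
        (s - 1) * ∑ n ∈ range N, ((n + 1 : ℕ):ℂ) ^ (-s) + ((N:ℂ) + 1) ^ (1 - s) - 1 := by
      intro N
      induction N with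
      | zero => simp
      | succ N ih =>
        rw [sum_range_succ, ih, sum_range_succ]
        simp only [hF]; push_cast; ring
    have e3 : Tendsto (fun N : ℕ => ((N:ℂ) + 1) ^ (1 - s)) atTop (nhds 0) := by
      rw [tendsto_zero_iff_norm_tendsto_zero]
      have e4 : ∀ N : ℕ, ‖((N:ℂ) + 1) ^ (1 - s)‖ = ((N + 1 : ℕ):ℝ) ^ (-(s.re - 1)) := by
        intro N
        have := Complex.norm_cpow_eq_rpow_re_of_pos (x := (N:ℝ) + 1) (by positivity) (1 - s)
        push_cast at this ⊢; rw [this]; simp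
      simp_rw [e4]
      exact ((tendsto_rpow_neg_atTop (by linarith)).comp tendsto_natCast_atTop_atTop).comp
        (tendsto_add_atTop_nat 1)
    simp_rw [e2] at e1
    have e5 := (((hz.hasSum.tendsto_sum_nat).const_mul (s - 1)).add e3).sub_const 1
    rw [e0, tendsto_nhds_unique e1 e5, zeta₁_eq hs1, zeta_eq_tsum_one_div_nat_add_one_cpow hs]
    simp only [add_zero]
    congr 3; funext m; rw [Complex.cpow_neg]; simp

/-! ### Siegel's theorem -/

open scoped ComplexOrder in
lemma estermann {Φ : ℂ → ℂ} (hΦ : Differentiable ℂ Φ) {a : ℕ → ℂ} (ha : 0 ≤ a) (ha1 : a 1 = 1)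
    (hab : LSeries.abscissaOfAbsConv a ≤ 1)
    (hL : ∀ s : ℂ, 1 < s.re → Φ s = (s - 1) * LSeries a s) {B : ℝ}
    (hB : ∀ s : ℂ, ‖s - 2‖ ≤ 4 / 3 → ‖Φ s‖ ≤ B) :
    (∀ β : ℝ, 3 / 4 ≤ β → β ≤ 2 → (Φ β).im = 0) ∧
    ∀ β : ℝ, 3 / 4 ≤ β → β < 1 → 0 ≤ (Φ β).re → ∀ M : ℕ, 192 * B * (15 / 16) ^ M ≤ 1 →
      (1 - β) / 2 ≤ ‖Φ 1‖ * (2 - β) ^ M := by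
  set H := dslope Φ 1 with hHd
  have hH : Differentiable ℂ H := by
    intro s
    exact ((Complex.differentiableOn_dslope (s := Set.univ) Filter.univ_mem).2
      hΦ.differentiableOn).differentiableAt Filter.univ_mem
  have hHe : ∀ s : ℂ, s ≠ 1 → H s = (Φ s - Φ 1) * (s - 1)⁻¹ := by
    intro s hs
    rw [hHd, dslope_of_ne _ hs, slope_def_field, div_eq_mul_inv]
  have hB0 : 0 ≤ B := (norm_nonneg _).trans (hB 2 (by norm_num))
  have hC : ∀ m : ℕ, ‖iteratedDeriv m H 2‖ ≤ m.factorial * (6 * B) / (4 / 3) ^ m := by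
    intro m
    refine Complex.norm_iteratedDeriv_le_of_forall_mem_sphere_norm_le m (by norm_num)
      hH.diffContOnCl fun z hz => ?_
    rw [mem_sphere_iff_norm] at hz
    have h1 : 1 / 3 ≤ ‖z - 1‖ := by
      have := norm_sub_norm_le (z - 2) (-1)
      rw [hz, show z - 2 - -1 = z - 1 by ring] at this
      norm_num at this; linarith
    have hz1 : z ≠ 1 := by rintro rfl; norm_num at h1
    rw [hHe z hz1, norm_mul, norm_inv]
    have h2 : ‖Φ z - Φ 1‖ ≤ 2 * B := by
      have := norm_sub_le (Φ z) (Φ 1)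
      have := hB z hz.le
      have := hB 1 (by norm_num)
      linarith
    have h3 : ‖z - 1‖⁻¹ ≤ 3 := by
      rw [inv_le_comm₀ (by linarith) (by norm_num)]; linarith
    calc _ ≤ (2 * B) * 3 := by gcongr
      _ = _ := by ring
  have hd : ∀ m : ℕ, ∃ b : ℝ, 0 ≤ b ∧ (m = 0 → 1 ≤ b) ∧
      (-1) ^ m * iteratedDeriv m H 2 = m.factorial * (b - Φ 1) := by
    intro m
    have hab2 : LSeries.abscissaOfAbsConv a < ((2:ℝ) : EReal) :=
      hab.trans_lt (by exact_mod_cast one_lt_two)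
    have e1 : H =ᶠ[nhds 2] (LSeries a - fun s => Φ 1 * (1 * s - 1)⁻¹) := by
      have : {s : ℂ | 1 < s.re} ∈ nhds (2:ℂ) :=
        (Complex.continuous_re.isOpen_preimage _ isOpen_Ioi).mem_nhds (by simp)
      filter_upwards [this] with s hs
      have hs1 : s ≠ 1 := by rintro rfl; simp at hs
      have : s - 1 ≠ 0 := sub_ne_zero.2 hs1
      rw [hHe s hs1, hL s hs, Pi.sub_apply]
      field_simp
    have e2 : iteratedDeriv m H 2 = iteratedDeriv m (LSeries a) 2 - Φ 1 * ((-1) ^ m * m.factorial) := by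
      rw [e1.iteratedDeriv_eq, iteratedDeriv_sub, iteratedDeriv_const_mul_field,
        iteratedDeriv_eq_iterate (f := fun s : ℂ => (1 * s - 1)⁻¹), iter_deriv_inv_linear_sub]
      · norm_num
      · exact ((LSeries_analyticOnNhd a) 2 (by simpa using hab2)).contDiffAt
      · refine contDiffAt_const.mul (ContDiffAt.inv (by fun_prop) (by norm_num))
    have h0 := LSeries.iteratedDeriv_alternating ha hab2 m
    obtain ⟨hr, hi⟩ := Complex.nonneg_iff.1 h0
    set w := (-1) ^ m * iteratedDeriv m (LSeries a) ((2:ℝ):ℂ) with hw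
    have hwr : w = (w.re : ℂ) := Complex.ext (by simp) (by simp [← hi])
    have hf : (m.factorial : ℝ) ≠ 0 := by positivity
    have hf' : (m.factorial : ℂ) ≠ 0 := by exact_mod_cast m.factorial_ne_zero
    refine ⟨w.re / m.factorial, by positivity, ?_, ?_⟩
    · rintro rfl
      have hs : LSeriesSummable a 2 :=
        LSeriesSummable_of_abscissaOfAbsConv_lt_re (by simpa using hab2)
      have h1 : 1 ≤ LSeries a 2 := by
        have := (hs.sum_le_tsum {1} (fun n _ => ?_))
        · simpa [LSeries.term, ha1, LSeries] using this
        · rw [show (2:ℂ) = ((2:ℝ):ℂ) by norm_num]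
          exact LSeries.term_nonneg (ha n) 2
      have : w = LSeries a 2 := by rw [hw]; simp
      rw [this]
      have := (Complex.le_def.1 h1).1
      simpa using this
    · have h2 : ((2:ℝ):ℂ) = 2 := by norm_num
      rw [h2] at hw
      rw [e2, mul_sub, ← hw, hwr]
      push_cast
      have h3 : ((-1:ℂ) ^ m) * (-1) ^ m = 1 := by rw [← mul_pow]; norm_num
      field_simp
      linear_combination -(Φ 1 * m.factorial) * h3
  choose b hb0 hb1 hb using hd
  have hbd : ∀ m : ℕ, ‖(b m : ℂ) - Φ 1‖ ≤ 6 * B * (3 / 4) ^ m := by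
    intro m
    have h1 := congrArg norm (hb m)
    rw [norm_mul, norm_mul, norm_pow, norm_neg, norm_one, one_pow, one_mul, Complex.norm_natCast] at h1
    have h2 := hC m
    rw [h1] at h2
    have hf : (0:ℝ) < m.factorial := by positivity
    rw [mul_div_assoc] at h2
    have h3 := le_of_mul_le_mul_left h2 hf
    refine h3.trans (le_of_eq ?_)
    rw [div_eq_mul_inv, ← inv_pow]; norm_num
  have him : (Φ 1).im = 0 := by
    have ht : Tendsto (fun m : ℕ => 6 * B * (3 / 4 : ℝ) ^ m) atTop (nhds 0) := by
      simpa using (tendsto_pow_atTop_nhds_zero_of_lt_one (r := (3/4:ℝ)) (by norm_num)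
        (by norm_num)).const_mul (6 * B)
    have : |(Φ 1).im| ≤ 0 := by
      refine ge_of_tendsto' ht fun m => ?_
      have := (Complex.abs_im_le_norm ((b m : ℂ) - Φ 1)).trans (hbd m)
      simpa using this
    exact abs_eq_zero.1 (le_antisymm this (abs_nonneg _))
  set l := (Φ 1).re with hl
  have hΦ1 : Φ 1 = (l : ℂ) := Complex.ext (by simp [hl]) (by simp [him])
  have hser : ∀ β : ℝ, HasSum (fun m : ℕ => (((b m - l) * (2 - β) ^ m : ℝ) : ℂ)) (H β) := by
    intro β
    convert! Complex.hasSum_taylorSeries_of_entire hH 2 β using 2 with m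
    have hf' : (m.factorial : ℂ) ≠ 0 := by exact_mod_cast m.factorial_ne_zero
    have h3 : ((-1:ℂ) ^ m) * (-1) ^ m = 1 := by rw [← mul_pow]; norm_num
    have h4 : iteratedDeriv m H 2 = (-1) ^ m * (m.factorial * (b m - l)) := by
      rw [← hΦ1, ← hb m]; linear_combination -(iteratedDeriv m H 2) * h3
    rw [h4, smul_eq_mul, show ((β:ℂ) - 2) = (-1) * (2 - β) by ring, mul_pow, smul_eq_mul]
    push_cast
    field_simp
    linear_combination -((b m - l) * (2 - (β:ℂ)) ^ m) * h3
  have hser2 : ∀ β : ℝ, HasSum (fun m : ℕ => (b m - l) * (2 - β) ^ m) (H β).re ∧ (H β).im = 0 := by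
    intro β
    refine ⟨by have := Complex.hasSum_re (hser β); simpa only [Complex.ofReal_re] using this, ?_⟩
    have := Complex.hasSum_im (hser β)
    simp only [Complex.ofReal_im] at this
    exact this.unique hasSum_zero
  have hΦb : ∀ β : ℝ, Φ β = l + (β - 1) * H β := by
    intro β
    by_cases h : (β:ℂ) = 1
    · rw [h, hΦ1]; simp
    · have : (β:ℂ) - 1 ≠ 0 := sub_ne_zero.2 h
      rw [hHe _ h, hΦ1]; field_simp; ring
  refine ⟨fun β _ _ => ?_, fun β h34 h1 hpos M hM => ?_⟩
  · rw [hΦb β]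
    simp [(hser2 β).2]
  have hlb := (hser2 β).1
  set t := 2 - β with ht
  have hre : (Φ β).re = l + (β - 1) * (H β).re := by
    rw [hΦb β]; simp [(hser2 β).2]
  have ht0 : 0 ≤ t := by linarith
  have h5 : 1 / 2 - l * ∑ m ∈ range M, t ^ m ≤ (H β).re := by
    rw [← hlb.tsum_eq, ← hlb.summable.sum_add_tsum_nat_add M]
    have h6 : -(1/2 : ℝ) ≤ ∑' m, (b (m + M) - l) * t ^ (m + M) := by
      have hg : HasSum (fun m : ℕ => 6 * B * (15/16:ℝ) ^ M * (15 / 16 : ℝ) ^ m)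
          (6 * B * (15/16:ℝ) ^ M * (1 - 15 / 16)⁻¹) :=
        (hasSum_geometric_of_lt_one (by norm_num) (by norm_num)).mul_left _
      have := tsum_of_norm_bounded (f := fun m => (b (m + M) - l) * t ^ (m + M)) hg (fun m => ?_)
      · rw [norm_eq_abs] at this
        have := neg_abs_le (∑' m, (b (m + M) - l) * t ^ (m + M))
        norm_num at *
        linarith
      · have h7 := hbd (m + M)
        rw [hΦ1, ← Complex.ofReal_sub, Complex.norm_real] at h7
        rw [norm_mul, norm_pow, norm_of_nonneg ht0]
        calc _ ≤ 6 * B * (3 / 4) ^ (m + M) * (5 / 4) ^ (m + M) := by gcongr; linarith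
          _ = 6 * B * (15 / 16) ^ (m + M) := by rw [mul_assoc, ← mul_pow]; norm_num
          _ = _ := by ring
    have h8 : 1 - l * ∑ m ∈ range M, t ^ m ≤ ∑ m ∈ range M, (b m - l) * t ^ m := by
      simp_rw [sub_mul, sum_sub_distrib, ← Finset.mul_sum]
      gcongr
      rcases M.eq_zero_or_pos with rfl | hM0
      · exfalso
        have h8 : ‖Φ 1‖ ≤ B := hB 1 (by norm_num)
        have h9 := hbd 0
        have h10 : (1:ℝ) ≤ ‖(b 0 : ℂ)‖ := by
          rw [Complex.norm_real]; exact (hb1 0 rfl).trans (le_abs_self _)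
        have := norm_sub_norm_le (b 0 : ℂ) (Φ 1)
        norm_num at h9 hM
        linarith
      · have := Finset.single_le_sum (f := fun m => b m * t ^ m) (s := range M)
          (fun m _ => mul_nonneg (hb0 m) (by positivity)) (mem_range.2 hM0)
        simp only [pow_zero, mul_one] at this
        exact (hb1 0 rfl).trans this
    linarith
  have h9 : (∑ m ∈ range M, t ^ m) * (1 - β) = t ^ M - 1 := by
    have := geom_sum_mul t M
    rwa [show t - 1 = 1 - β by rw [ht]; ring] at this
  have h10 := mul_le_mul_of_nonneg_right h5 (by linarith : 0 ≤ 1 - β)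
  have h11 : (1 - β) / 2 ≤ l * t ^ M := by
    have : (1 / 2 - l * ∑ m ∈ range M, t ^ m) * (1 - β) = (1-β)/2 - l * (t ^ M - 1) := by
      rw [← h9]; ring
    nlinarith
  refine h11.trans ?_
  gcongr
  exact (le_abs_self _).trans (Complex.abs_re_le_norm _)
noncomputable def aT {q : ℕ} (χ : DirichletCharacter ℂ q) : ArithmeticFunction ℂ :=
  toArithmeticFunction (fun n => χ n)

lemma aT_apply {q : ℕ} (χ : DirichletCharacter ℂ q) {n : ℕ} (hn : n ≠ 0) : aT χ n = χ n := by
  simp [aT, toArithmeticFunction, hn]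

noncomputable def aLog : ArithmeticFunction ℂ := ⟨fun n => (log n : ℂ), by simp⟩

noncomputable def aV {q : ℕ} (χ : DirichletCharacter ℂ q) : ArithmeticFunction ℂ :=
  ⟨fun n => χ n * (ArithmeticFunction.vonMangoldt n : ℝ), by simp⟩

lemma aV_apply {q : ℕ} (χ : DirichletCharacter ℂ q) (n : ℕ) :
    aV χ n = χ n * (ArithmeticFunction.vonMangoldt n : ℝ) := rfl

lemma one_one (n : ZMod 1) : (1 : DirichletCharacter ℂ 1) n = 1 :=
  MulChar.one_apply (isUnit_of_subsingleton n)

lemma aLog_aT {q : ℕ} (χ : DirichletCharacter ℂ q) :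
    ArithmeticFunction.pmul aLog (aT χ) = aT χ * aV χ := by
  ext n
  rcases eq_or_ne n 0 with rfl | hn
  · simp
  rw [ArithmeticFunction.mul_apply, ArithmeticFunction.pmul_apply, aT_apply χ hn]
  have : ∀ x ∈ n.divisorsAntidiagonal, aT χ x.1 * aV χ x.2 =
      χ n * ((ArithmeticFunction.vonMangoldt x.2 : ℝ) : ℂ) := by
    intro x hx
    have h := (Nat.mem_divisorsAntidiagonal.1 hx).1
    have h1 : x.1 ≠ 0 := by rintro h'; simp [h'] at h; omega
    rw [aT_apply χ h1, ← h]; simp [aV]; ring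
  rw [sum_congr rfl this, ← Finset.mul_sum,
    Nat.sum_divisorsAntidiagonal' (f := fun i j => ((ArithmeticFunction.vonMangoldt j : ℝ) : ℂ)),
    ← Complex.ofReal_sum, ArithmeticFunction.vonMangoldt_sum]
  simp [aLog]; ring

lemma aLog_mul (f g : ArithmeticFunction ℂ) : ArithmeticFunction.pmul aLog (f * g) =
    ArithmeticFunction.pmul aLog f * g + f * ArithmeticFunction.pmul aLog g := by
  ext n
  simp only [ArithmeticFunction.pmul_apply, ArithmeticFunction.mul_apply,
    ArithmeticFunction.add_apply, Finset.mul_sum, ← sum_add_distrib]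
  refine sum_congr rfl fun x hx => ?_
  obtain ⟨h, hn⟩ := Nat.mem_divisorsAntidiagonal.1 hx
  have h1 : x.1 ≠ 0 := by rintro h'; simp [h'] at h; omega
  have h2 : x.2 ≠ 0 := by rintro h'; simp [h'] at h; omega
  have : aLog n = aLog x.1 + aLog x.2 := by
    simp only [aLog, ArithmeticFunction.coe_mk, ← h]
    push_cast
    rw [log_mul (by exact_mod_cast h1) (by exact_mod_cast h2)]; push_cast; rfl
  rw [this]; ring

noncomputable def aS {q : ℕ} (ψ₁ ψ₂ : DirichletCharacter ℂ q) : ArithmeticFunction ℂ :=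
  aT (1 : DirichletCharacter ℂ 1) * aT ψ₁ * (aT ψ₂ * aT (ψ₁ * ψ₂))

open scoped ComplexOrder in
lemma aS_nonneg {q : ℕ} {ψ₁ ψ₂ : DirichletCharacter ℂ q} (h1 : ψ₁ ^ 2 = 1) (h2 : ψ₂ ^ 2 = 1) :
    aS ψ₁ ψ₂ 1 = 1 ∧ ∀ n, 0 ≤ aS ψ₁ ψ₂ n := by
  have ha1 : aS ψ₁ ψ₂ 1 = 1 := by
    simp [aS, ArithmeticFunction.mul_apply, aT_apply, one_one]
  refine ⟨ha1, ?_⟩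
  set g := aV (1 : DirichletCharacter ℂ 1) + aV ψ₁ + aV ψ₂ + aV (ψ₁ * ψ₂) with hg
  have hlog : ArithmeticFunction.pmul aLog (aS ψ₁ ψ₂) = aS ψ₁ ψ₂ * g := by
    simp only [aS, aLog_mul, aLog_aT, hg]; ring
  have hg0 : ∀ n, 0 ≤ g n := by
    intro n
    have : g n = (1 + ψ₁ n) * (1 + ψ₂ n) * (ArithmeticFunction.vonMangoldt n : ℝ)
        := by
      simp only [hg, ArithmeticFunction.add_apply, aV_apply, one_one, MulChar.mul_apply]; ring
    rw [this]
    refine mul_nonneg (mul_nonneg ?_ ?_) ?_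
    · rcases MulChar.isQuadratic_iff_sq_eq_one.mpr h1 n with h | h | h <;> rw [h] <;> norm_num
    · rcases MulChar.isQuadratic_iff_sq_eq_one.mpr h2 n with h | h | h <;> rw [h] <;> norm_num
    · exact_mod_cast ArithmeticFunction.vonMangoldt_nonneg
  intro n
  induction n using Nat.strong_induction_on with
  | _ n ih =>
    rcases Nat.lt_or_ge n 2 with h | h
    · interval_cases n <;> simp [ha1]
    have hl : 0 < log n := log_pos (by exact_mod_cast h)
    have h3 := congrArg (fun F : ArithmeticFunction ℂ => F n) hlog
    simp only [ArithmeticFunction.pmul_apply] at h3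
    rw [ArithmeticFunction.mul_apply] at h3
    have h4 : 0 ≤ aLog n * aS ψ₁ ψ₂ n := by
      rw [h3]
      refine sum_nonneg fun x hx => ?_
      obtain ⟨h, hn⟩ := Nat.mem_divisorsAntidiagonal.1 hx
      have h1 : x.1 ≠ 0 := by rintro h'; simp [h'] at h; omega
      rcases Nat.lt_or_ge x.2 2 with h5 | h5
      · have : g x.2 = 0 := by
          interval_cases x.2 <;> simp [hg, ArithmeticFunction.add_apply, aV_apply]
        rw [this, mul_zero]
      · refine mul_nonneg (ih _ ?_) (hg0 _)
        nlinarith [Nat.pos_of_ne_zero h1]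
    have h5 : aS ψ₁ ψ₂ n = ((log n)⁻¹ : ℝ) * (aLog n * aS ψ₁ ψ₂ n) := by
      have : (log n : ℂ) ≠ 0 := by exact_mod_cast hl.ne'
      simp only [aLog, ArithmeticFunction.coe_mk]
      rw [← mul_assoc, ← Complex.ofReal_mul, inv_mul_cancel₀ hl.ne']; simp
    rw [h5]
    exact mul_nonneg (by exact_mod_cast (inv_pos.2 hl).le) h4

lemma aT_sum {q : ℕ} (χ : DirichletCharacter ℂ q) {s : ℂ} (hs : 1 < s.re) :
    LSeriesSummable (aT χ) s ∧ LSeries (aT χ) s = LSeries (fun n => χ n) s :=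
  ⟨(LSeriesSummable_congr _ fun h => aT_apply χ h).2 (χ.LSeriesSummable_of_one_lt_re hs),
    LSeries_congr (fun h => aT_apply χ h) s⟩

noncomputable def PhiS {q : ℕ} [NeZero q] (ψ₁ ψ₂ : DirichletCharacter ℂ q) (s : ℂ) : ℂ :=
  riemannZeta₁ s * ψ₁.LFunction s * (ψ₂.LFunction s * (ψ₁ * ψ₂).LFunction s)

lemma aS_sum {q : ℕ} [NeZero q] (ψ₁ ψ₂ : DirichletCharacter ℂ q) {s : ℂ} (hs : 1 < s.re) :
    LSeriesSummable (aS ψ₁ ψ₂) s ∧ PhiS ψ₁ ψ₂ s = (s - 1) * LSeries (aS ψ₁ ψ₂) s := by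
  have h0 := aT_sum (1 : DirichletCharacter ℂ 1) hs
  have h1 := aT_sum ψ₁ hs
  have h2 := aT_sum ψ₂ hs
  have h3 := aT_sum (ψ₁ * ψ₂) hs
  have hs1 : s ≠ 1 := by rintro rfl; simp at hs
  refine ⟨ArithmeticFunction.LSeriesSummable_mul (ArithmeticFunction.LSeriesSummable_mul h0.1 h1.1)
    (ArithmeticFunction.LSeriesSummable_mul h2.1 h3.1), ?_⟩
  rw [aS, ArithmeticFunction.LSeries_mul' (ArithmeticFunction.LSeriesSummable_mul h0.1 h1.1)
    (ArithmeticFunction.LSeriesSummable_mul h2.1 h3.1), ArithmeticFunction.LSeries_mul' h0.1 h1.1,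
    ArithmeticFunction.LSeries_mul' h2.1 h3.1, h0.2, h1.2, h2.2, h3.2,
    DirichletCharacter.LSeries_modOne_eq, LSeries_one_eq_riemannZeta hs, PhiS, zeta₁_eq hs1,
    DirichletCharacter.LFunction_eq_LSeries _ hs, DirichletCharacter.LFunction_eq_LSeries _ hs,
    DirichletCharacter.LFunction_eq_LSeries _ hs]
  ring

lemma PhiS_bd : ∃ C : ℝ, 1 ≤ C ∧ ∀ {q : ℕ} [NeZero q] {ψ₁ ψ₂ : DirichletCharacter ℂ q},
    ψ₁ ≠ 1 → ψ₂ ≠ 1 → ψ₁ * ψ₂ ≠ 1 → ∀ s : ℂ, ‖s - 2‖ ≤ 4 / 3 → ‖PhiS ψ₁ ψ₂ s‖ ≤ C * q ^ 3 := by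
  have hZ := Zc_pos (1/2)
  refine ⟨(1 + Zc (1/2) * 20) * (Zc (1/2) * 4) * ((Zc (1/2) * 4) * (Zc (1/2) * 4)) + 1, by nlinarith [hZ, mul_pos hZ hZ, mul_pos hZ (mul_pos hZ hZ), mul_pos (mul_pos hZ hZ) (mul_pos hZ hZ)], ?_⟩
  intro q _ ψ₁ ψ₂ h1 h2 h12 s hs
  have hre : 1 - 1/2 < s.re := by
    have := (Complex.abs_re_le_norm (s - 2)).trans hs
    rw [abs_le] at this; simp at this; linarith
  have hn : ‖s‖ ≤ 4 := by
    have := norm_add_le (s - 2) 2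
    rw [sub_add_cancel] at this; norm_num at this; linarith
  have hL : ∀ ψ : DirichletCharacter ℂ q, ψ ≠ 1 → ‖ψ.LFunction s‖ ≤ Zc (1/2) * 4 * q := by
    intro ψ hψ
    have := L_bound (ε := 1/2) (by norm_num) le_rfl hψ hre
    norm_num at this
    nlinarith [mul_le_mul_of_nonneg_right hn (Nat.cast_nonneg (α := ℝ) q)]
  have hz : ‖riemannZeta₁ s‖ ≤ 1 + Zc (1/2) * 20 := by
    have h5 := zeta_bound (ε := 1/2) (by norm_num) le_rfl hre
    norm_num at h5
    have h6 := norm_add_le (riemannZeta₁ s - 1) 1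
    rw [sub_add_cancel] at h6; norm_num at h6
    have h7 : (‖s‖ + 1) * ‖s‖ ≤ 20 := by nlinarith [norm_nonneg s]
    nlinarith [mul_le_mul_of_nonneg_left h7 hZ.le]
  rw [PhiS, norm_mul, norm_mul, norm_mul]
  calc _ ≤ (1 + Zc (1/2) * 20) * (Zc (1/2) * 4 * q) * ((Zc (1/2) * 4 * q) * (Zc (1/2) * 4 * q)) := by
        have := hL _ h1
        have := hL _ h2
        have := hL _ h12
        gcongr
    _ ≤ _ := by
      have : (0:ℝ) ≤ (q:ℝ) ^ 3 := by positivity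
      nlinarith

lemma ester_app {q : ℕ} [NeZero q] {ψ₁ ψ₂ : DirichletCharacter ℂ q} (h1 : ψ₁ ^ 2 = 1)
    (h2 : ψ₂ ^ 2 = 1) (n1 : ψ₁ ≠ 1) (n2 : ψ₂ ≠ 1) (n12 : ψ₁ * ψ₂ ≠ 1) {C : ℝ}
    (hC : ∀ s : ℂ, ‖s - 2‖ ≤ 4 / 3 → ‖PhiS ψ₁ ψ₂ s‖ ≤ C) :
    (∀ β : ℝ, 3 / 4 ≤ β → β ≤ 2 → (PhiS ψ₁ ψ₂ β).im = 0) ∧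
    ∀ β : ℝ, 3 / 4 ≤ β → β < 1 → 0 ≤ (PhiS ψ₁ ψ₂ β).re → ∀ M : ℕ, 192 * C * (15 / 16) ^ M ≤ 1 →
      (1 - β) / 2 ≤ ‖PhiS ψ₁ ψ₂ 1‖ * (2 - β) ^ M := by
  refine estermann (a := aS ψ₁ ψ₂) ?_ (aS_nonneg h1 h2).2 (aS_nonneg h1 h2).1 ?_
    (fun s hs => (aS_sum ψ₁ ψ₂ hs).2) hC
  · exact (differentiable_riemannZeta₁.mul (DirichletCharacter.differentiable_LFunction n1)).mul
      ((DirichletCharacter.differentiable_LFunction n2).mul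
        (DirichletCharacter.differentiable_LFunction n12))
  · exact LSeries.abscissaOfAbsConv_le_of_forall_lt_LSeriesSummable
      fun y hy => (aS_sum ψ₁ ψ₂ (s := y) (by simpa using hy)).1

lemma PhiS_one {q : ℕ} [NeZero q] (ψ₁ ψ₂ : DirichletCharacter ℂ q) :
    ‖PhiS ψ₁ ψ₂ 1‖ = ‖ψ₁.LFunction 1‖ * ‖ψ₂.LFunction 1‖ * ‖(ψ₁ * ψ₂).LFunction 1‖ := by
  rw [PhiS, riemannZeta₁_one, one_mul, norm_mul, norm_mul]; ring

lemma sieg_core {ε : ℝ} (h0 : 0 < ε) (h1 : ε ≤ 1 / 2) : ∃ c : ℝ, 0 < c ∧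
    ∀ {q : ℕ} [NeZero q] {ψ₁ ψ₂ : DirichletCharacter ℂ q}, ψ₁ ^ 2 = 1 → ψ₂ ^ 2 = 1 →
    ψ₁ ≠ 1 → ψ₂ ≠ 1 → ψ₁ * ψ₂ ≠ 1 → ∀ δ : ℝ, 0 < δ → δ ≤ 1 / 4 →
    0 ≤ (PhiS ψ₁ ψ₂ (1 - δ : ℝ)).re →
    δ ≤ c * (q:ℝ) ^ (48 * δ + 2 * ε) * (‖ψ₁.LFunction 1‖ * ‖ψ₂.LFunction 1‖) := by
  obtain ⟨C, hC1, hC⟩ := PhiS_bd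
  have hZ := Zc_pos ε
  refine ⟨2 * (Real.exp 1 * (192 * C) ^ (4:ℝ)) * Zc ε, by positivity, ?_⟩
  intro q _ ψ₁ ψ₂ s1 s2 n1 n2 n12 δ hδ hδ4 hpos
  have hq : (1:ℝ) ≤ q := by exact_mod_cast (NeZero.one_le : 1 ≤ q)
  set X : ℝ := 192 * (C * q ^ 3) with hX
  have hX1 : 1 ≤ X := by
    have : (1:ℝ) ≤ (q:ℝ)^3 := one_le_pow₀ hq
    nlinarith
  have hlX : 0 ≤ log X := log_nonneg hX1
  set M := ⌈16 * log X⌉₊ with hM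
  have hM1 : 16 * log X ≤ M := Nat.le_ceil _
  have hM2 : (M:ℝ) ≤ 16 * log X + 1 := (Nat.ceil_lt_add_one (by positivity)).le
  have hXM : X * (15 / 16) ^ M ≤ 1 := by
    have h5 : log (15/16) ≤ -(1/16) := by
      have := log_le_sub_one_of_pos (show (0:ℝ) < 15/16 by norm_num); linarith
    have h6 : log (X * (15/16)^M) ≤ 0 := by
      rw [log_mul (by positivity) (by positivity), log_pow]
      nlinarith [Nat.cast_nonneg (α := ℝ) M]
    have : 0 < X * (15/16)^M := by positivity
    exact (log_nonpos_iff this.le).1 h6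
  have key := (ester_app s1 s2 n1 n2 n12 (hC n1 n2 n12)).2 (1 - δ) (by linarith) (by linarith) hpos M
    (by rwa [hX] at hXM)
  rw [PhiS_one] at key
  have hL := L_bound h0 h1 n12 (s := 1) (by simp; linarith)
  rw [norm_one, one_mul] at hL
  have hP : (2 - (1 - δ)) ^ M ≤ Real.exp 1 * (192 * C) ^ (4:ℝ) * (q:ℝ) ^ (48 * δ) := by
    have a1 : (2 - (1 - δ)) ^ M ≤ Real.exp (δ * M) := by
      rw [mul_comm, exp_nat_mul]
      gcongr
      · linarith
      · have := Real.add_one_le_exp δ; linarith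
    have a2 : δ * M ≤ 1 + 16 * δ * log X := by nlinarith
    have a3 : log X = log (192 * C) + 3 * log q := by
      rw [hX, ← mul_assoc, log_mul (by positivity) (by positivity), log_pow]; norm_num
    have a4 : 0 ≤ log (192 * C) := log_nonneg (by linarith)
    calc _ ≤ Real.exp (1 + 4 * log (192 * C) + 48 * δ * log q) := by
          refine a1.trans (exp_le_exp.2 (a2.trans ?_)); rw [a3]; nlinarith
      _ = _ := by
        rw [exp_add, exp_add, rpow_def_of_pos (by positivity),
          rpow_def_of_pos (by positivity)]; ring_nf
  have hq0 : (0:ℝ) < q := by linarith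
  rw [rpow_add hq0]
  calc δ = 2 * ((1 - (1 - δ)) / 2) := by ring
    _ ≤ 2 * (‖ψ₁.LFunction 1‖ * ‖ψ₂.LFunction 1‖ * (Zc ε * (q:ℝ) ^ (2 * ε)) *
        (Real.exp 1 * (192 * C) ^ (4:ℝ) * (q:ℝ) ^ (48 * δ))) := by
        refine mul_le_mul_of_nonneg_left (key.trans ?_) (by norm_num)
        have : 0 ≤ (2 - (1 - δ)) := by linarith
        gcongr
    _ = _ := by ring

lemma euler_bd {q Q : ℕ} [NeZero q] [NeZero Q] (hd : q ∣ Q) {χ : DirichletCharacter ℂ q} (hχ : χ ≠ 1) :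
    ‖(DirichletCharacter.changeLevel hd χ).LFunction 1‖ * (Nat.totient Q / Q) ≤ ‖χ.LFunction 1‖ ∧
    ‖χ.LFunction 1‖ * (Nat.totient Q / Q) ≤ ‖(DirichletCharacter.changeLevel hd χ).LFunction 1‖ := by
  have hQ : (0:ℝ) < Q := by exact_mod_cast NeZero.pos Q
  have ht : (Nat.totient Q / Q : ℝ) = ∏ p ∈ Q.primeFactors, (1 - (p:ℝ)⁻¹) := by
    have := Nat.totient_eq_mul_prod_factors Q
    have h2 : ((Nat.totient Q : ℚ) : ℝ) = ((Q * ∏ p ∈ Q.primeFactors, (1 - (p:ℚ)⁻¹) : ℚ) : ℝ) := by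
      rw [this]
    push_cast at h2
    rw [h2]; field_simp
  have hp : ∀ p ∈ Q.primeFactors, 0 ≤ 1 - (p:ℝ)⁻¹ ∧ 1 - (p:ℝ)⁻¹ ≤ ‖1 - χ p * (p:ℂ) ^ (-(1:ℂ))‖ ∧
      ‖1 - χ p * (p:ℂ) ^ (-(1:ℂ))‖ * (1 - (p:ℝ)⁻¹) ≤ 1 := by
    intro p hp
    have hp1 : (1:ℝ) < p := by exact_mod_cast (Nat.prime_of_mem_primeFactors hp).one_lt
    have hi : (p:ℝ)⁻¹ ≤ 1 := inv_le_one_of_one_le₀ hp1.le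
    have hi0 : 0 < (p:ℝ)⁻¹ := by positivity
    have hn : ‖χ p * (p:ℂ) ^ (-(1:ℂ))‖ ≤ (p:ℝ)⁻¹ := by
      rw [norm_mul, Complex.cpow_neg_one, norm_inv, Complex.norm_natCast]
      exact mul_le_of_le_one_left hi0.le (χ.norm_le_one _)
    have t1 := norm_sub_norm_le (1:ℂ) (χ p * (p:ℂ) ^ (-(1:ℂ)))
    have t2 := norm_sub_le (1:ℂ) (χ p * (p:ℂ) ^ (-(1:ℂ)))
    rw [norm_one] at t1 t2
    refine ⟨by linarith, by linarith, ?_⟩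
    nlinarith
  rw [DirichletCharacter.LFunction_changeLevel hd χ (Or.inl hχ), norm_mul, norm_prod, ht]
  constructor
  · rw [mul_assoc, ← Finset.prod_mul_distrib]
    refine mul_le_of_le_one_right (norm_nonneg _) (Finset.prod_le_one (fun p h => ?_) fun p h => (hp p h).2.2)
    exact mul_nonneg (norm_nonneg _) (hp p h).1
  · gcongr with p h
    · exact fun p h => (hp p h).1
    · exact (hp p h).2.1

lemma changeLevel_ne {q Q : ℕ} (hd : q ∣ Q) [NeZero Q] {χ : DirichletCharacter ℂ q} (hχ : χ ≠ 1) :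
    DirichletCharacter.changeLevel hd χ ≠ 1 := by
  rwa [Ne, DirichletCharacter.changeLevel_eq_one_iff]

open scoped ComplexOrder in
/-- choice of the auxiliary character -/
lemma sieg_aux {ε : ℝ} (h0 : 0 < ε) (h1 : ε ≤ 1 / 4)
    (hex : ∃ q : ℕ, ∃ _ : NeZero q, ∃ χ : DirichletCharacter ℂ q, χ ^ 2 = 1 ∧ χ ≠ 1) :
    ∃ q₁ : ℕ, ∃ _ : NeZero q₁, ∃ χ₁ : DirichletCharacter ℂ q₁, χ₁ ^ 2 = 1 ∧ χ₁ ≠ 1 ∧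
    ∃ δ : ℝ, 0 < δ ∧ δ ≤ ε ∧ ∀ {Q : ℕ} [NeZero Q] (hd : q₁ ∣ Q) (ψ₂ : DirichletCharacter ℂ Q),
      ψ₂ ^ 2 = 1 → ψ₂ ≠ 1 → DirichletCharacter.changeLevel hd χ₁ * ψ₂ ≠ 1 →
      0 ≤ (PhiS (DirichletCharacter.changeLevel hd χ₁) ψ₂ (1 - δ : ℝ)).re := by
  by_cases hA : ∃ q : ℕ, ∃ _ : NeZero q, ∃ χ : DirichletCharacter ℂ q, χ ^ 2 = 1 ∧ χ ≠ 1 ∧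
      ∃ δ : ℝ, 0 < δ ∧ δ ≤ ε ∧ riemannZeta₁ (1 - δ : ℝ) * χ.LFunction (1 - δ : ℝ) = 0
  · obtain ⟨q₁, hq₁, χ₁, c1, c2, δ, d1, d2, h⟩ := hA
    refine ⟨q₁, hq₁, χ₁, c1, c2, δ, d1, d2, ?_⟩
    intro Q _ hd ψ₂ _ _ _
    have : PhiS (DirichletCharacter.changeLevel hd χ₁) ψ₂ (1 - δ : ℝ) = 0 := by
      rw [PhiS, DirichletCharacter.LFunction_changeLevel hd χ₁ (Or.inl c2), ← mul_assoc (riemannZeta₁ _), h]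
      simp
    rw [this]; simp
  · push Not at hA
    obtain ⟨q₁, hq₁, χ₁, c1, c2⟩ := hex
    refine ⟨q₁, hq₁, χ₁, c1, c2, ε, h0, le_rfl, ?_⟩
    intro Q _ hd ψ₂ s2 n2 n12
    set ψ₁ := DirichletCharacter.changeLevel hd χ₁ with hψ
    have s1 : ψ₁ ^ 2 = 1 := by rw [hψ, ← map_pow, c1, map_one]
    have n1 : ψ₁ ≠ 1 := changeLevel_ne hd c2
    have hnz : ∀ β : ℝ, 1 - ε ≤ β → PhiS ψ₁ ψ₂ β ≠ 0 := by
      intro β hβ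
      have s12 : (ψ₁ * ψ₂) ^ 2 = 1 := by rw [mul_pow, s1, s2, one_mul]
      have hz : ∀ ψ : DirichletCharacter ℂ Q, ψ ^ 2 = 1 → ψ ≠ 1 →
          riemannZeta₁ β * ψ.LFunction β ≠ 0 := by
        intro ψ p1 p2
        rcases lt_or_ge β 1 with hb | hb
        · have := hA Q inferInstance ψ p1 p2 (1 - β) (by linarith) (by linarith)
          simpa using this
        · refine mul_ne_zero ?_ (DirichletCharacter.LFunction_ne_zero_of_one_le_re _ (Or.inl p2)
            (by simpa using hb))
          rcases hb.eq_or_lt with rfl | hb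
          · simp [riemannZeta₁_one]
          · have : (β:ℂ) ≠ 1 := by exact_mod_cast hb.ne'
            rw [zeta₁_eq this]
            exact mul_ne_zero (sub_ne_zero.2 this) (riemannZeta_ne_zero_of_one_le_re (by simpa using hb.le))
      rw [PhiS]
      exact mul_ne_zero (hz _ s1 n1) (mul_ne_zero (right_ne_zero_of_mul (hz _ s2 n2))
        (right_ne_zero_of_mul (hz _ s12 n12)))
    obtain ⟨C, hC1, hC⟩ := PhiS_bd
    have him := (ester_app s1 s2 n1 n2 n12 (hC n1 n2 n12)).1
    have hre : ∀ β ∈ Set.Icc (1 - ε) 2, (PhiS ψ₁ ψ₂ (β:ℝ)).re ≠ 0 := by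
      intro β hβ h
      exact hnz β hβ.1 (Complex.ext h (him β (by linarith [hβ.1]) hβ.2))
    have hcont : ContinuousOn (fun β : ℝ => (PhiS ψ₁ ψ₂ (β:ℝ)).re) (Set.Icc (1 - ε) 2) := by
      have : Differentiable ℂ (PhiS ψ₁ ψ₂) :=
        (differentiable_riemannZeta₁.mul (DirichletCharacter.differentiable_LFunction n1)).mul
        ((DirichletCharacter.differentiable_LFunction n2).mul
        (DirichletCharacter.differentiable_LFunction n12))
      exact (Complex.continuous_re.comp (this.continuous.comp Complex.continuous_ofReal)).continuousOn
    have h2 : 0 < (PhiS ψ₁ ψ₂ ((2:ℝ):ℂ)).re := by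
      rw [(aS_sum ψ₁ ψ₂ (s := ((2:ℝ):ℂ)) (by simp)).2]
      have := LSeries.positive (a := aS ψ₁ ψ₂) (aS_nonneg s1 s2).2
        (by rw [(aS_nonneg s1 s2).1]; exact zero_lt_one) (x := 2) (lt_of_le_of_lt
          (LSeries.abscissaOfAbsConv_le_of_forall_lt_LSeriesSummable (x := 1)
            fun y hy => (aS_sum ψ₁ ψ₂ (s := y) (by simpa using hy)).1) (by exact_mod_cast one_lt_two))
      have h3 := (Complex.pos_iff.1 this).1
      rw [show ((2:ℝ):ℂ) - 1 = 1 by norm_num, one_mul]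
      exact h3
    by_contra hneg
    push Not at hneg
    obtain ⟨β, hβ, hb0⟩ := intermediate_value_Icc (by linarith : 1 - ε ≤ 2) hcont ⟨hneg.le, h2.le⟩
    exact hre β hβ hb0

/-- Siegel's theorem. -/
lemma siegel {η : ℝ} (hη : 0 < η) : ∃ c : ℝ, 0 < c ∧ ∀ {q : ℕ} [NeZero q] {χ : DirichletCharacter ℂ q},
    χ ^ 2 = 1 → χ ≠ 1 → c * (q:ℝ) ^ (-η) ≤ ‖χ.LFunction 1‖ := by
  by_cases hex : ∃ q : ℕ, ∃ _ : NeZero q, ∃ χ : DirichletCharacter ℂ q, χ ^ 2 = 1 ∧ χ ≠ 1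
  swap
  · refine ⟨1, one_pos, fun {q} _ {χ} h1 h2 => absurd ⟨q, inferInstance, χ, h1, h2⟩ hex⟩
  set ε := min (1/4) (η / 60) with hε
  have h0 : 0 < ε := by positivity
  have h14 : ε ≤ 1 / 4 := min_le_left _ _
  have h60 : 60 * ε ≤ η := by have := min_le_right (1/4) (η/60); linarith
  obtain ⟨q₁, _, χ₁, c1, c2, δ, d1, d2, haux⟩ := sieg_aux h0 h14 hex
  obtain ⟨c, hc, hcore⟩ := sieg_core h0 (by linarith)
  obtain ⟨Ct, hCt, htot⟩ := totient_ge h0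
  have hZ := Zc_pos ε
  set l := ‖χ₁.LFunction 1‖ with hl
  have hl0 : 0 < l := norm_pos_iff.2 (DirichletCharacter.LFunction_ne_zero_of_one_le_re _ (Or.inl c2)
    (by simp))
  have hq₁ : (0:ℝ) < q₁ := by exact_mod_cast NeZero.pos q₁
  set d := min (δ / (c * Zc ε * Ct)) (l / Ct ^ 2) with hd
  have hd0 : 0 < d := by positivity
  refine ⟨d * (q₁:ℝ) ^ (-η), by positivity, ?_⟩
  intro q _ χ s2 n2
  haveI : NeZero (q₁ * q) := ⟨mul_ne_zero (NeZero.ne _) (NeZero.ne _)⟩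
  have hq : (0:ℝ) < q := by exact_mod_cast NeZero.pos q
  set Q := q₁ * q with hQ
  have hQ1 : (1:ℝ) ≤ Q := by exact_mod_cast (NeZero.one_le : 1 ≤ Q)
  have hQ0 : (0:ℝ) < Q := by linarith
  have hcast : (q₁:ℝ) ^ (-η) * (q:ℝ) ^ (-η) = (Q:ℝ) ^ (-η) := by
    rw [← Real.mul_rpow hq₁.le hq.le, hQ]; push_cast; rfl
  rw [mul_assoc, hcast]
  have ht : (Q:ℝ) ^ (-ε) / Ct ≤ (Nat.totient Q : ℝ) / Q := by
    rw [div_le_div_iff₀ hCt hQ0]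
    have := htot Q NeZero.one_le
    have e : (Q:ℝ) ^ (-ε) * Q = (Q:ℝ) ^ (1 - ε) := by
      rw [sub_eq_neg_add, rpow_add hQ0, rpow_one]
    rw [e]; linarith
  have hd1 : q₁ ∣ Q := Dvd.intro _ rfl
  have hd2 : q ∣ Q := Dvd.intro_left _ rfl
  set ψ₁ := DirichletCharacter.changeLevel hd1 χ₁ with hψ₁
  set ψ₂ := DirichletCharacter.changeLevel hd2 χ with hψ₂
  have t1 : ψ₁ ^ 2 = 1 := by rw [hψ₁, ← map_pow, c1, map_one]
  have t2 : ψ₂ ^ 2 = 1 := by rw [hψ₂, ← map_pow, s2, map_one]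
  have m1 : ψ₁ ≠ 1 := changeLevel_ne hd1 c2
  have m2 : ψ₂ ≠ 1 := changeLevel_ne hd2 n2
  have e1 := (euler_bd hd1 c2).2
  have e2 := (euler_bd hd2 n2).1
  rw [← hψ₁, ← hl] at e1
  rw [← hψ₂] at e2
  refine le_trans ?_ e2
  by_cases h12 : ψ₁ * ψ₂ = 1
  · have : ψ₂ = ψ₁ := by
      have : ψ₁ * (ψ₁ * ψ₂) = ψ₂ := by rw [← mul_assoc, ← pow_two, t1, one_mul]
      rw [← this, h12, mul_one]
    rw [this]
    calc d * (Q:ℝ) ^ (-η) ≤ l / Ct ^ 2 * (Q:ℝ) ^ (-ε + -ε) := by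
          gcongr
          · exact min_le_right _ _
          · linarith
      _ = l * ((Q:ℝ) ^ (-ε) / Ct) * ((Q:ℝ) ^ (-ε) / Ct) := by
        rw [rpow_add hQ0]; field_simp
      _ ≤ l * ((Nat.totient Q : ℝ) / Q) * ((Nat.totient Q : ℝ) / Q) := by gcongr
      _ ≤ _ := by gcongr
  · have key := hcore t1 t2 m1 m2 h12 δ d1 (by linarith) (haux hd1 ψ₂ t2 m2 h12)
    have hL := L_bound h0 (by linarith) m1 (s := 1) (by simp; linarith)
    rw [norm_one, one_mul] at hL
    have k2 : δ ≤ c * (Q:ℝ) ^ (50 * ε) * (Zc ε * (Q:ℝ) ^ (2 * ε) * ‖ψ₂.LFunction 1‖) := by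
      refine key.trans ?_
      gcongr
      · linarith
    have k3 : δ / (c * Zc ε) * (Q:ℝ) ^ (-(52 * ε)) ≤ ‖ψ₂.LFunction 1‖ := by
      rw [rpow_neg hQ0.le, ← div_eq_mul_inv, div_div, div_le_iff₀ (by positivity)]
      refine k2.trans (le_of_eq ?_)
      rw [show 52 * ε = 50 * ε + 2 * ε by ring, rpow_add hQ0]; ring
    calc d * (Q:ℝ) ^ (-η) ≤ δ / (c * Zc ε * Ct) * (Q:ℝ) ^ (-(52 * ε) + -ε) := by
          gcongr
          · exact min_le_left _ _
          · linarith
      _ = δ / (c * Zc ε) * (Q:ℝ) ^ (-(52 * ε)) * ((Q:ℝ) ^ (-ε) / Ct) := by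
        rw [rpow_add hQ0]; field_simp
      _ ≤ _ := by gcongr

/-! ### Lower bounds on the 1-line -/

lemma low_abs {G : ℝ → ℂ} {V : ℝ} (hV : 1 ≤ V)
    (h1 : ∀ x : ℝ, 0 < x → x ≤ 1 → x ^ 3 ≤ V ^ 4 * ‖G x‖ ^ 4)
    (h2 : ∀ x y : ℝ, 0 < x → x ≤ 1 → 0 < y → y ≤ 1 → ‖G x - G y‖ ≤ V * |x - y|) :
    ∀ x : ℝ, 0 < x → x ≤ 1 → 1 / (16 * V ^ 7) ≤ ‖G x‖ := by
  have hV0 : 0 < V := by linarith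
  set z := 1 / (2 * V ^ 2) with hz
  have hz0 : 0 < z := by positivity
  have hz1 : z ≤ 1 := by
    rw [hz, div_le_one (by positivity)]; nlinarith
  have hd : ∀ x : ℝ, z ^ 4 ≤ x → x ≤ 1 → 2 * V * z ^ 4 ≤ ‖G x‖ := by
    intro x hx hx1
    have h := h1 x (lt_of_lt_of_le (by positivity) hx) hx1
    have h3 : (z ^ 4) ^ 3 ≤ x ^ 3 := by gcongr
    have h4 : (z ^ 3) ^ 4 ≤ (V * ‖G x‖) ^ 4 := by rw [mul_pow]; calc _ = (z^4)^3 := by ring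
                                                     _ ≤ _ := h3.trans h
    have h5 := le_of_pow_le_pow_left₀ (by norm_num) (by positivity) h4
    have h6 : z ^ 4 * (2 * V ^ 2) = z ^ 3 := by rw [hz]; field_simp
    nlinarith
  have e : V * z ^ 4 = 1 / (16 * V ^ 7) := by rw [hz]; field_simp; norm_num
  have hz4 : z ^ 4 ≤ 1 := pow_le_one₀ hz0.le hz1
  intro x hx hx1
  rw [← e]
  rcases le_total (z ^ 4) x with h | h
  · have := hd x h hx1
    have : 0 ≤ V * z ^ 4 := by positivity
    linarith
  · have a1 := hd (z ^ 4) le_rfl hz4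
    have a2 := h2 (z ^ 4) x (by positivity) hz4 hx hx1
    rw [abs_of_nonneg (by linarith)] at a2
    have a3 := norm_sub_norm_le (G (z ^ 4)) (G x)
    nlinarith

section
variable {ε : ℝ} (h0 : 0 < ε) (h1 : ε ≤ 1 / 2)
include h0 h1

lemma pow_aux {T y : ℝ} (hy : 0 ≤ y) (hT : y ≤ 2 * T) : y ^ (2 * ε) ≤ 2 * T ^ (2 * ε) := by
  have hT0 : 0 ≤ T := by linarith
  calc y ^ (2 * ε) ≤ (2 * T) ^ (2 * ε) := by gcongr
    _ = 2 ^ (2 * ε) * T ^ (2 * ε) := Real.mul_rpow (by norm_num) hT0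
    _ ≤ _ := by
      gcongr
      calc (2:ℝ) ^ (2 * ε) ≤ 2 ^ (1:ℝ) := by gcongr <;> linarith
        _ = 2 := rpow_one 2

lemma U1 {q : ℕ} [NeZero q] {χ : DirichletCharacter ℂ q} (hχ : χ ≠ 1) {w : ℂ} {t : ℝ}
    (hw : 1 - ε < w.re) (hn : ‖w‖ ≤ 2 * (|t| + 2)) :
    ‖χ.LFunction w‖ ≤ (1 + 8 * Zc ε) * (q * (|t| + 2)) ^ (2 * ε) := by
  have hZ := Zc_pos ε
  have h := pow_aux h0 h1 (y := ‖w‖ * q) (T := q * (|t| + 2)) (by positivity)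
    (by nlinarith [mul_le_mul_of_nonneg_right hn (Nat.cast_nonneg (α := ℝ) q)])
  refine (L_bound h0 h1 hχ hw).trans ?_
  have : 0 ≤ ((q:ℝ) * (|t| + 2)) ^ (2 * ε) := by positivity
  nlinarith [mul_le_mul_of_nonneg_left h hZ.le, mul_nonneg hZ.le this]

lemma U2 {w : ℂ} {t η : ℝ} (hη : 0 < η) (hη1 : η ≤ 1) (hw : 1 - ε < w.re) (hn : ‖w‖ ≤ 2 * (|t| + 2))
    (hw1 : η ≤ ‖w - 1‖) : ‖riemannZeta w‖ ≤ (1 + 6 * Zc ε) * (|t| + 2) ^ (2 * ε) / η := by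
  have hZ := Zc_pos ε
  have hne : w ≠ 1 := by rintro rfl; simp at hw1; linarith
  have h := pow_aux h0 h1 (norm_nonneg w) hn
  set X := (|t| + 2) ^ (2 * ε) with hX
  have hX1 : 1 ≤ X := Real.one_le_rpow (by linarith [abs_nonneg t]) (by linarith)
  have hb := zeta_bound h0 h1 hw
  have h3 : ‖riemannZeta₁ w‖ ≤ 1 + Zc ε * ((‖w‖ + 1) * (2 * X)) := by
    have := norm_add_le (riemannZeta₁ w - 1) 1
    rw [sub_add_cancel, norm_one] at this
    have : Zc ε * ((‖w‖ + 1) * ‖w‖ ^ (2 * ε)) ≤ Zc ε * ((‖w‖ + 1) * (2 * X)) := by gcongr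
    linarith
  rw [zeta₁_eq hne, norm_mul] at h3
  have h4 : ‖w‖ ≤ ‖w - 1‖ + 1 := by
    have := norm_add_le (w - 1) 1
    rwa [sub_add_cancel, norm_one] at this
  set u := ‖w - 1‖
  have hu : 0 < u := by linarith
  rw [le_div_iff₀ hη]
  have h5 : u * ‖riemannZeta w‖ * η ≤ (1 + 6 * Zc ε) * X * u := by
    have e1 : (‖w‖ + 1) * η ≤ 3 * u := by nlinarith
    have e2 : η ≤ X * u := by nlinarith
    have e3 : Zc ε * ((‖w‖ + 1) * (2 * X)) * η ≤ Zc ε * (2 * X) * (3 * u) := by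
      calc _ = Zc ε * (2 * X) * ((‖w‖ + 1) * η) := by ring
        _ ≤ _ := by gcongr
    have e4 := mul_le_mul_of_nonneg_right h3 hη.le
    nlinarith
  refine le_of_mul_le_mul_left ?_ hu
  calc _ = u * ‖riemannZeta w‖ * η := by ring
    _ ≤ _ := h5
    _ = _ := by ring

lemma U3 {q : ℕ} [NeZero q] {w : ℂ} {t η : ℝ} (hη : 0 < η) (hη1 : η ≤ 1) (hw : 1 < w.re)
    (hn : ‖w‖ ≤ 2 * (|t| + 2)) (hw1 : η ≤ ‖w - 1‖) :
    ‖LSeries (fun n => (1 : DirichletCharacter ℂ q) n) w‖ ≤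
      (1 + 8 * Zc ε) * (q * (|t| + 2)) ^ (2 * ε) / η := by
  have hZ := Zc_pos ε
  have hq : (1:ℝ) ≤ q := by exact_mod_cast (NeZero.one_le : 1 ≤ q)
  have ht := abs_nonneg t
  have a := U2 h0 h1 hη hη1 (by linarith : 1 - ε < w.re) hn hw1
  have h := pow_aux h0 h1 (y := ‖w‖ * q) (T := q * (|t| + 2)) (by positivity)
    (by nlinarith [mul_le_mul_of_nonneg_right hn (Nat.cast_nonneg (α := ℝ) q)])
  have b := triv_bound (q := q) h0 h1 hw
  have c : (|t| + 2) ^ (2 * ε) ≤ ((q:ℝ) * (|t| + 2)) ^ (2 * ε) := by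
    gcongr; nlinarith
  set X := ((q:ℝ) * (|t| + 2)) ^ (2 * ε)
  have hX : 0 ≤ X := by positivity
  have d : (1 + 6 * Zc ε) * (|t| + 2) ^ (2 * ε) / η ≤ (1 + 6 * Zc ε) * X / η := by gcongr
  have e : Zc ε * (‖w‖ * q) ^ (2 * ε) ≤ 2 * Zc ε * X / η := by
    rw [le_div_iff₀ hη]
    have := mul_le_mul_of_nonneg_left h hZ.le
    have f : 0 ≤ Zc ε * (‖w‖ * q) ^ (2 * ε) := by positivity
    nlinarith
  calc _ ≤ 2 * Zc ε * X / η + (1 + 6 * Zc ε) * X / η := by linarith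
    _ = _ := by ring

omit h1 in
lemma lip_gen {G : ℂ → ℂ} {V : ℝ} {S : Set ℂ} (hS : Convex ℝ S)
    (hG : ∀ w ∈ S, ∀ z, ‖z - w‖ ≤ ε / 2 → DifferentiableAt ℂ G z ∧ ‖G z‖ ≤ V) :
    ∀ x ∈ S, ∀ y ∈ S, ‖G x - G y‖ ≤ V / (ε / 2) * ‖x - y‖ := by
  intro x hx y hy
  refine hS.norm_image_sub_le_of_norm_deriv_le (f := G) (fun w hw => (hG w hw w (by simp; linarith)).1)
    (fun w hw => ?_) hy hx
  refine Complex.norm_deriv_le_of_forall_mem_sphere_norm_le (by linarith) ?_ fun z hz =>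
    (hG w hw z (by rw [← mem_sphere_iff_norm.1 hz])).2
  refine DifferentiableOn.diffContOnCl fun z hz => ?_
  rw [closure_ball _ (by linarith)] at hz
  exact (hG w hw z (by rwa [mem_closedBall_iff_norm] at hz)).1.differentiableWithinAt

omit h0 h1 in
lemma conv_strip (a b : ℝ) : Convex ℝ {w : ℂ | 1 ≤ w.re ∧ w.re ≤ 2 ∧ a ≤ w.im ∧ w.im ≤ b} :=
  (convex_halfSpace_re_ge 1).inter ((convex_halfSpace_re_le 2).inter
    ((convex_halfSpace_im_ge a).inter (convex_halfSpace_im_le b)))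

omit h1 in
lemma lip_aux {G : ℂ → ℂ} {t V : ℝ}
    (hG : ∀ w : ℂ, 1 ≤ w.re → w.re ≤ 2 → w.im = t → ∀ z, ‖z - w‖ ≤ ε / 2 → DifferentiableAt ℂ G z ∧ ‖G z‖ ≤ V) :
    ∀ x y : ℝ, 0 < x → x ≤ 1 → 0 < y → y ≤ 1 →
      ‖G (1 + x + Complex.I * t) - G (1 + y + Complex.I * t)‖ ≤ V / (ε / 2) * |x - y| := by
  intro x y hx hx1 hy hy1
  have := lip_gen h0 (G := G) (V := V) (conv_strip t t)
    (fun w hw => hG w hw.1 hw.2.1 (le_antisymm hw.2.2.2 hw.2.2.1))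
    (1 + x + Complex.I * t) (by refine ⟨?_, ?_, ?_, ?_⟩ <;> simp <;> linarith)
    (1 + y + Complex.I * t) (by refine ⟨?_, ?_, ?_, ?_⟩ <;> simp <;> linarith)
  refine this.trans (le_of_eq ?_)
  rw [show (1 + x + Complex.I * t) - (1 + y + Complex.I * t) = ((x - y : ℝ) : ℂ) by push_cast; ring,
    Complex.norm_real, norm_eq_abs]

lemma tof {q : ℕ} [NeZero q] (χ : DirichletCharacter ℂ q) {t η x : ℝ} (hη : 0 < η)
    (hη1 : η ≤ 1) (hx : 0 < x) (hx1 : x ≤ 1) (hxt : χ ^ 2 = 1 → η ≤ x ∨ η ≤ |t|) :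
    x ^ 3 ≤ ((1 + 8 * Zc ε) * (q * (|t| + 2)) ^ (2 * ε) / η) ^ 4 *
      ‖LSeries (fun n => χ n) (1 + x + Complex.I * t)‖ ^ 4 := by
  have hZ := Zc_pos ε
  have ht := abs_nonneg t
  have hq : (1:ℝ) ≤ q := by exact_mod_cast (NeZero.one_le : 1 ≤ q)
  have key := DirichletCharacter.norm_LSeries_product_ge_one χ hx t
  rw [norm_mul, norm_mul, norm_pow, norm_pow] at key
  have hw1 : ‖(1:ℂ) + x‖ ≤ 2 * (|t| + 2) := by
    rw [← Complex.ofReal_one, ← Complex.ofReal_add, Complex.norm_real, norm_eq_abs, abs_of_pos] <;> linarith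
  have hw2 : ‖(1:ℂ) + x + 2 * Complex.I * t‖ ≤ 2 * (|t| + 2) := by
    refine (norm_add_le _ _).trans ?_
    have : ‖(1:ℂ) + x‖ ≤ 2 := by
      rw [← Complex.ofReal_one, ← Complex.ofReal_add, Complex.norm_real, norm_eq_abs, abs_of_pos] <;> linarith
    simp only [norm_mul, Complex.norm_I, Complex.norm_real, norm_eq_abs, Complex.norm_ofNat]
    linarith
  have f1 := U3 h0 h1 (q := q) hx hx1 (w := 1 + x) (by simpa using hx) hw1 (by simp [abs_of_pos hx])
  set X := (1 + 8 * Zc ε) * ((q:ℝ) * (|t| + 2)) ^ (2 * ε) with hX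
  have hX0 : 0 < X := by positivity
  have f2 : ‖LSeries (fun n => (χ ^ 2 : DirichletCharacter ℂ q) n) (1 + x + 2 * Complex.I * t)‖ ≤ X / η := by
    have hre : 1 < ((1:ℂ) + x + 2 * Complex.I * t).re := by simpa using hx
    by_cases hχ : χ ^ 2 = 1
    · rw [hχ]
      refine U3 h0 h1 hη hη1 hre hw2 ?_
      rw [show (1:ℂ) + x + 2 * Complex.I * t - 1 = x + 2 * Complex.I * t by ring]
      rcases hxt hχ with h | h
      · refine h.trans ((le_abs_self x).trans ?_)
        simpa using Complex.abs_re_le_norm ((x:ℂ) + 2 * Complex.I * t)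
      · refine h.trans ?_
        have := Complex.abs_im_le_norm ((x:ℂ) + 2 * Complex.I * t)
        simp at this; linarith
    · rw [← DirichletCharacter.LFunction_eq_LSeries _ hre]
      refine (U1 h0 h1 hχ (by linarith) hw2).trans ?_
      rw [le_div_iff₀ hη]; nlinarith
  have hη2 : X ≤ X / η := by rw [le_div_iff₀ hη]; nlinarith
  set L := ‖LSeries (fun n => χ n) (1 + x + Complex.I * t)‖
  have k2 : 1 ≤ (X / x) ^ 3 * L ^ 4 * (X / η) := by
    refine key.le.trans ?_
    gcongr
  have k3 : x ^ 3 ≤ X ^ 3 * L ^ 4 * (X / η) := by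
    have := mul_le_mul_of_nonneg_left k2 (pow_pos hx 3).le
    rw [mul_one] at this
    refine this.trans (le_of_eq ?_)
    field_simp
  calc x ^ 3 ≤ X ^ 3 * L ^ 4 * (X / η) := k3
    _ ≤ (X / η) ^ 3 * L ^ 4 * (X / η) := by gcongr
    _ = _ := by ring
end

lemma ball_aux {ε : ℝ} (h0 : 0 < ε) (h1 : ε ≤ 1 / 2) {w z : ℂ} {t : ℝ} (a : 1 ≤ w.re) (b : w.re ≤ 2)
    (c : |w.im| ≤ |t| + 1 / 2) (h : ‖z - w‖ ≤ ε / 2) : 1 - ε < z.re ∧ ‖z‖ ≤ 2 * (|t| + 2) := by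
  have h2 := (Complex.abs_re_le_norm (z - w)).trans h
  rw [abs_le, Complex.sub_re] at h2
  refine ⟨by linarith, ?_⟩
  have h3 := norm_add_le (z - w) w
  rw [sub_add_cancel] at h3
  have h4 := Complex.norm_le_abs_re_add_abs_im w
  rw [abs_of_nonneg (by linarith)] at h4
  linarith [abs_nonneg t]

set_option maxHeartbeats 800000 in
lemma low_L {κ : ℝ} (hκ : 0 < κ) : ∃ c : ℝ, 0 < c ∧ ∀ {q : ℕ} [NeZero q] {χ : DirichletCharacter ℂ q},
    χ ≠ 1 → ∀ t x : ℝ, 0 < x → x ≤ 1 →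
    c * (q * (|t| + 2)) ^ (-κ) ≤ ‖χ.LFunction (1 + x + Complex.I * t)‖ := by
  set ε := min (1/2) (κ / 35) with hε
  have h0 : 0 < ε := by positivity
  have h1 : ε ≤ 1 / 2 := min_le_left _ _
  have h35 : 35 * ε ≤ κ := by have := min_le_right (1/2) (κ/35); linarith
  have hZ := Zc_pos ε
  obtain ⟨c₁, hc₁, hs⟩ := siegel h0
  set K := 1 + 8 * Zc ε with hK
  set D := max (K / (ε / 2)) c₁ with hD
  have hDK : K / (ε / 2) ≤ D := le_max_left _ _
  have hD1 : c₁ ≤ D := le_max_right _ _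
  have hK1 : 1 ≤ K := by linarith
  have hKK : K ≤ K / (ε / 2) := by rw [le_div_iff₀ (by linarith)]; exact mul_le_of_le_one_right (by linarith) (by linarith)
  have hD0 : 0 < D := by linarith
  set r := c₁ / (4 * D) with hr
  have hr0 : 0 < r := by positivity
  have hr1 : r ≤ 1 / 4 := by rw [hr, div_le_div_iff₀ (by positivity) (by norm_num)]; linarith
  refine ⟨min (c₁ / 2) (1 / (16 * (D / r) ^ 7)), by positivity, ?_⟩
  intro q _ χ hχ t x hx hx1
  have ht := abs_nonneg t
  have hq : (1:ℝ) ≤ q := by exact_mod_cast (NeZero.one_le : 1 ≤ q)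
  set T := (q:ℝ) * (|t| + 2) with hT
  have hT1 : 1 ≤ T := one_le_mul_of_one_le_of_one_le hq (by linarith)
  have hT0 : 0 < T := by linarith
  set Y := T ^ ε with hY
  have hY1 : 1 ≤ Y := Real.one_le_rpow hT1 h0.le
  have hpow : ∀ n : ℕ, T ^ (n * ε) = Y ^ n := fun n => by
    rw [mul_comm, rpow_mul hT0.le, rpow_natCast]
  have hY2 : T ^ (2 * ε) = Y ^ 2 := by exact_mod_cast hpow 2
  have hTκ : T ^ (-κ) ≤ 1 / Y ^ 35 := by
    rw [← hpow 35, one_div, ← rpow_neg hT0.le]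
    gcongr
    · push_cast; linarith
  have hDY : 1 ≤ D * Y ^ 2 := one_le_mul_of_one_le_of_one_le (by linarith) (one_le_pow₀ hY1)
  set η := r / Y ^ 3 with hη
  have hη0 : 0 < η := by positivity
  have hη1 : η ≤ r := div_le_self hr0.le (one_le_pow₀ hY1)
  have hLS : χ.LFunction (1 + x + Complex.I * t) = LSeries (fun n => χ n) (1 + x + Complex.I * t) :=
    DirichletCharacter.LFunction_eq_LSeries _ (by simpa using hx)
  have hball : ∀ w : ℂ, 1 ≤ w.re → w.re ≤ 2 → |w.im| ≤ |t| + 1 / 2 → ∀ z, ‖z - w‖ ≤ ε / 2 →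
      DifferentiableAt ℂ χ.LFunction z ∧ ‖χ.LFunction z‖ ≤ K * Y ^ 2 := by
    intro w a b c z hz
    obtain ⟨e1, e2⟩ := ball_aux h0 h1 a b c hz
    rw [← hY2]
    exact ⟨DirichletCharacter.differentiable_LFunction hχ z, U1 h0 h1 hχ e1 e2⟩
  have hfin : 1 / (16 * (D / r) ^ 7) * T ^ (-κ) ≤ 1 / (16 * (D * Y ^ 2 / η) ^ 7) := by
    calc _ ≤ 1 / (16 * (D / r) ^ 7) * (1 / Y ^ 35) := by gcongr
      _ = _ := by rw [hη]; field_simp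
  have hmain : (χ ^ 2 = 1 → η ≤ |t|) → 1 / (16 * (D * Y ^ 2 / η) ^ 7) ≤ ‖χ.LFunction (1 + x + Complex.I * t)‖ := by
    intro hcase
    have hV1 : K * Y ^ 2 / η ≤ D * Y ^ 2 / η := by gcongr; linarith
    refine low_abs (G := fun x => χ.LFunction (1 + x + Complex.I * t)) ?_ ?_ ?_ x hx hx1
    · rw [le_div_iff₀ hη0]; linarith
    · intro x hx hx1
      have := tof h0 h1 χ hη0 (by linarith) hx hx1 (t := t) (fun h => Or.inr (hcase h))
      rw [← hT, ← hK, hY2] at this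
      refine this.trans ?_
      rw [DirichletCharacter.LFunction_eq_LSeries _ (by simpa using hx)]
      gcongr
    · intro x y hx hx1 hy hy1
      refine (lip_aux h0 (t := t) (fun w a b c => hball w a b (by rw [c]; linarith)) x y hx hx1 hy hy1).trans ?_
      refine mul_le_mul_of_nonneg_right ?_ (abs_nonneg _)
      calc K * Y ^ 2 / (ε / 2) = K / (ε / 2) * Y ^ 2 := by ring
        _ ≤ D * Y ^ 2 := by gcongr
        _ ≤ _ := by rw [le_div_iff₀ hη0]; exact mul_le_of_le_one_right (by linarith) (by linarith)
  by_cases hcase : χ ^ 2 = 1 → η ≤ |t|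
  · refine le_trans (le_trans ?_ hfin) (hmain hcase)
    gcongr; exact min_le_right _ _
  push Not at hcase
  obtain ⟨hχ2, htη⟩ := hcase
  rcases le_or_gt η x with hxη | hxη
  · have := tof h0 h1 χ hη0 (by linarith) hx hx1 (t := t) (fun h => Or.inl hxη)
    rw [← hT, ← hK, hY2, ← hLS] at this
    set L := ‖χ.LFunction (1 + x + Complex.I * t)‖
    have h4 : η ^ 4 ≤ (K * Y ^ 2 / η * L) ^ 4 := by
      rw [mul_pow]
      refine le_trans ?_ this
      calc η ^ 4 = η ^ 3 * η := by ring
        _ ≤ x ^ 3 * 1 := by gcongr; linarith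
        _ = _ := by ring
    have h5 := le_of_pow_le_pow_left₀ (by norm_num) (by positivity) h4
    set W := D * Y ^ 2 / η with hW
    have hW1 : 1 ≤ W := by rw [le_div_iff₀ hη0]; linarith
    have hKW : K * Y ^ 2 / η ≤ W := by rw [hW]; gcongr; linarith
    have h6 : 1 / W ≤ η := by
      rw [div_le_iff₀ (by linarith), hW, mul_div_cancel₀ _ hη0.ne']
      exact hDY
    have h7 : 1 / (16 * W ^ 7) ≤ L := by
      rw [div_le_iff₀ (by positivity)]
      have : 1 ≤ W * (W * L) := by
        rw [div_le_iff₀ (by linarith)] at h6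
        have h8 : η ≤ W * L := h5.trans (by gcongr)
        rw [mul_comm W]; exact h6.trans (mul_le_mul_of_nonneg_right h8 (by linarith))
      calc 1 ≤ W * (W * L) := this
        _ = W ^ 2 * L := by ring
        _ ≤ W ^ 7 * L := mul_le_mul_of_nonneg_right (pow_le_pow_right₀ hW1 (by norm_num)) (norm_nonneg _)
        _ ≤ _ := by linarith [show 0 ≤ W ^ 7 * L by positivity, mul_comm L (16 * W ^ 7), mul_assoc 16 (W ^ 7) L]
    refine le_trans (le_trans ?_ hfin) h7
    gcongr; exact min_le_right _ _
  · have hS := hs hχ2 hχ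
    have h3 := lip_gen h0 (conv_strip (-(|t| + 1/2)) (|t| + 1/2))
      (fun w hw => hball w hw.1 hw.2.1 (abs_le.2 hw.2.2)) 1 (by refine ⟨?_, ?_, ?_, ?_⟩ <;> simp <;> linarith)
      (1 + x + Complex.I * t) (by
        refine ⟨?_, ?_, ?_, ?_⟩ <;> simp <;> linarith [neg_abs_le t, le_abs_self t])
    have h4 : ‖(1:ℂ) - (1 + x + Complex.I * t)‖ ≤ 2 * η := by
      rw [show (1:ℂ) - (1 + x + Complex.I * t) = -(x + Complex.I * t) by ring, norm_neg]
      refine (norm_add_le _ _).trans ?_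
      simp [abs_of_pos hx]; linarith
    have h5 : K * Y ^ 2 / (ε / 2) * ‖(1:ℂ) - (1 + x + Complex.I * t)‖ ≤ c₁ / 2 * Y⁻¹ := by
      calc _ ≤ D * Y ^ 2 * (2 * η) := by
            rw [mul_div_right_comm]; gcongr
        _ = _ := by rw [hη, hr]; field_simp; norm_num
    have h6 : Y⁻¹ ≤ (q:ℝ) ^ (-ε) := by
      rw [hY, ← rpow_neg hT0.le]
      refine rpow_le_rpow_of_nonpos (by linarith) (le_mul_of_one_le_right (by linarith) (by linarith)) (by linarith)
    have h7 : T ^ (-κ) ≤ Y⁻¹ := by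
      rw [hY, ← rpow_neg hT0.le]
      gcongr
      linarith
    have h8 := norm_sub_norm_le (χ.LFunction 1) (χ.LFunction (1 + x + Complex.I * t))
    calc _ ≤ c₁ / 2 * Y⁻¹ := by gcongr; exact min_le_left _ _
      _ ≤ _ := by linarith [mul_le_mul_of_nonneg_left h6 hc₁.le]

lemma low_zeta {κ : ℝ} (hκ : 0 < κ) : ∃ c : ℝ, 0 < c ∧ ∀ t x : ℝ, 1 ≤ |t| → 0 < x → x ≤ 1 →
    c * (|t| + 2) ^ (-κ) ≤ ‖riemannZeta (1 + x + Complex.I * t)‖ := by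
  set ε := min (1/2) (κ / 35) with hε
  have h0 : 0 < ε := by positivity
  have h1 : ε ≤ 1 / 2 := min_le_left _ _
  have h35 : 35 * ε ≤ κ := by have := min_le_right (1/2) (κ/35); linarith
  have hZ := Zc_pos ε
  set K := 1 + 8 * Zc ε with hK
  have hK1 : 1 ≤ K := by linarith
  set D := K / (ε / 2) / (1/2) with hD
  have hKK : K ≤ K / (ε / 2) := by rw [le_div_iff₀ (by linarith)]; exact mul_le_of_le_one_right (by linarith) (by linarith)
  have hKD : K / (ε / 2) ≤ D := by rw [hD]; linarith
  refine ⟨1 / (16 * D ^ 7), by positivity, ?_⟩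
  intro t x ht hx hx1
  set T := (|t| + 2) with hT
  have hT1 : 1 ≤ T := by linarith
  have hT0 : 0 < T := by linarith
  set Y := T ^ ε with hY
  have hY1 : 1 ≤ Y := Real.one_le_rpow hT1 h0.le
  have hpow : ∀ n : ℕ, T ^ (n * ε) = Y ^ n := fun n => by
    rw [mul_comm, rpow_mul hT0.le, rpow_natCast]
  have hY2 : T ^ (2 * ε) = Y ^ 2 := by exact_mod_cast hpow 2
  have hTκ : T ^ (-κ) ≤ 1 / Y ^ 14 := by
    rw [← hpow 14, one_div, ← rpow_neg hT0.le]
    gcongr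
    · push_cast; linarith
  refine le_trans (b := 1 / (16 * (D * Y ^ 2) ^ 7)) ?_ ?_
  · calc _ ≤ 1 / (16 * D ^ 7) * (1 / Y ^ 14) := by gcongr
      _ = _ := by field_simp
  refine low_abs (G := fun x => riemannZeta (1 + x + Complex.I * t)) ?_ ?_ ?_ x hx hx1
  · exact one_le_mul_of_one_le_of_one_le (by linarith) (one_le_pow₀ hY1)
  · intro x hx hx1
    have := tof h0 h1 (1 : DirichletCharacter ℂ 1) one_pos le_rfl hx hx1 (t := t) (fun h => Or.inr ht)
    rw [DirichletCharacter.LSeries_modOne_eq, LSeries_one_eq_riemannZeta (by simpa using hx), Nat.cast_one,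
      one_mul, ← hT, ← hK, hY2, div_one] at this
    refine this.trans ?_
    gcongr
    linarith
  · intro x y hx hx1 hy hy1
    refine (lip_aux h0 (t := t) (V := K * Y ^ 2 / (1/2)) (fun w a b c z hz => ?_) x y hx hx1 hy hy1).trans ?_
    · obtain ⟨e1, e2⟩ := ball_aux h0 h1 (t := t) a b (by rw [c]; linarith) hz
      have h3 : 1 / 2 ≤ ‖z - 1‖ := by
        have := (Complex.abs_im_le_norm (z - w)).trans hz
        have h4 := Complex.abs_im_le_norm (z - 1)
        have h5 := abs_sub_abs_le_abs_sub w.im z.im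
        rw [abs_sub_comm] at h5
        simp [c] at this h4 h5
        linarith
      have hz1 : z ≠ 1 := by rintro rfl; simp at h3; linarith
      refine ⟨differentiableAt_riemannZeta hz1, ?_⟩
      refine (U2 h0 h1 (by norm_num) (by norm_num) e1 e2 h3).trans ?_
      rw [← hT, hY2]
      gcongr
      linarith
    · refine le_of_eq ?_
      rw [hD]; ring

lemma logd {g : ℂ → ℂ} {s : ℂ} {ε B b : ℝ} (h0 : 0 < ε) (hg : DifferentiableOn ℂ g (Metric.ball s ε))
    (hB : ∀ z ∈ Metric.ball s ε, ‖g z‖ ≤ B) (hb : 0 < b) (hs : b ≤ ‖g s‖) (k : ℕ) :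
    ‖iteratedDeriv k (fun z => deriv g z / g z) s‖ ≤ k.factorial * (8 * B / (ε * b)) ^ (k + 1) := by
  have bB : b ≤ B := hs.trans (hB s (Metric.mem_ball_self h0))
  have B0 : 0 < B := hb.trans_le bB
  have d1 : ∀ z ∈ Metric.ball s (ε / 2), ‖deriv g z‖ ≤ 4 * B / ε := by
    intro z hz
    have hsub : Metric.closedBall z (ε / 4) ⊆ Metric.ball s ε := by
      intro w hw
      rw [Metric.mem_ball] at *
      rw [Metric.mem_closedBall] at hw
      linarith [dist_triangle w z s]
    have := Complex.norm_deriv_le_of_forall_mem_sphere_norm_le (f := g) (c := z) (R := ε / 4) (C := B)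
      (by linarith) ((hg.mono hsub).diffContOnCl_ball subset_rfl)
      (fun w hw => hB w (hsub (Metric.sphere_subset_closedBall hw)))
    calc _ ≤ B / (ε / 4) := this
      _ = _ := by field_simp
  set D := 8 * B / (ε * b) with hD
  have D0 : 0 < D := by positivity
  have R2 : D⁻¹ ≤ ε / 8 := by
    rw [hD, inv_div, div_le_div_iff₀ (by positivity) (by norm_num)]
    nlinarith
  have sub2 : Metric.closedBall s D⁻¹ ⊆ Metric.ball s (ε / 2) :=
    Metric.closedBall_subset_ball (by linarith)
  have sub3 : Metric.ball s (ε / 2) ⊆ Metric.ball s ε := Metric.ball_subset_ball (by linarith)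
  have low : ∀ z ∈ Metric.closedBall s D⁻¹, b / 2 ≤ ‖g z‖ := by
    intro z hz
    have := (convex_ball s (ε / 2)).norm_image_sub_le_of_norm_deriv_le (𝕜 := ℂ) (f := g) (C := 4 * B / ε)
      (fun w hw => (hg.differentiableAt (Metric.isOpen_ball.mem_nhds (sub3 hw)))) d1
      (Metric.mem_ball_self (by linarith)) (sub2 hz)
    have e : 4 * B / ε * D⁻¹ = b / 2 := by rw [hD]; field_simp; norm_num
    have : ‖g z - g s‖ ≤ b / 2 := by
      refine this.trans (e ▸ ?_)
      exact mul_le_mul_of_nonneg_left (by simpa [dist_eq_norm] using hz) (by positivity)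
    have := norm_sub_norm_le (g s) (g z)
    rw [norm_sub_rev] at this
    linarith
  have dd : DifferentiableOn ℂ (fun z => deriv g z / g z) (Metric.closedBall s D⁻¹) := by
    refine DifferentiableOn.div (((hg.deriv Metric.isOpen_ball)).mono (sub2.trans sub3))
      (hg.mono (sub2.trans sub3)) ?_
    intro z hz h
    have := low z hz
    rw [h, norm_zero] at this
    linarith
  have := Complex.norm_iteratedDeriv_le_of_forall_mem_sphere_norm_le k (c := s) (R := D⁻¹) (C := D)
    (f := fun z => deriv g z / g z) (by positivity) (dd.diffContOnCl_ball subset_rfl) (by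
      intro z hz
      have hz := Metric.sphere_subset_closedBall hz
      rw [norm_div]
      calc _ ≤ (4 * B / ε) / (b / 2) := div_le_div₀ (by positivity) (d1 z (sub2 hz)) (by positivity) (low z hz)
        _ = D := by rw [hD]; field_simp; norm_num)
  refine this.trans (le_of_eq ?_)
  rw [inv_pow, div_inv_eq_mul, pow_succ, mul_assoc, mul_comm D]

lemma pow_conv {X C D ε κ : ℝ} (hX : 1 ≤ X) (k : ℕ) (hC : 0 ≤ C) (hε : ε = 1 / (6 * (k + 1))) (hκ : κ = ε)
    (hD : 0 ≤ D) (h : D ≤ C * (X ^ (2 * ε) / X ^ (-κ))) : D ^ (k + 1) ≤ C ^ (k + 1) * X ^ (1 / 2 : ℝ) := by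
  have X0 : 0 < X := by linarith
  have e : X ^ (2 * ε) / X ^ (-κ) = X ^ (3 * ε) := by
    rw [← rpow_sub X0]; congr 1; rw [hκ]; ring
  rw [e] at h
  calc D ^ (k + 1) ≤ (C * X ^ (3 * ε)) ^ (k + 1) := by gcongr
    _ = C ^ (k + 1) * (X ^ (3 * ε)) ^ (k + 1) := by rw [mul_pow]
    _ = _ := by
        rw [← rpow_natCast (X ^ (3 * ε)), ← rpow_mul X0.le]
        congr 2
        rw [hε]; push_cast; field_simp; norm_num

lemma eps_le (k : ℕ) : 0 < (1:ℝ) / (6 * (k + 1)) ∧ (1:ℝ) / (6 * (k + 1)) ≤ 1 / 2 := by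
  refine ⟨by positivity, ?_⟩
  rw [div_le_div_iff₀ (by positivity) (by norm_num)]
  have : (0:ℝ) ≤ k := k.cast_nonneg
  linarith

lemma pt_aux {t x : ℝ} (h : 0 < x) (h' : x ≤ 1) : 1 ≤ (1 + x + Complex.I * t : ℂ).re ∧
    (1 + x + Complex.I * t : ℂ).re ≤ 2 ∧ |(1 + x + Complex.I * t : ℂ).im| ≤ |t| + 1 / 2 := by
  simp; refine ⟨h.le, by linarith⟩

lemma logd_L (k : ℕ) : ∃ C > 0, ∀ {q : ℕ} [NeZero q] {χ : DirichletCharacter ℂ q}, χ ≠ 1 →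
    ∀ t x : ℝ, 0 < x → x ≤ 1 →
    ‖iteratedDeriv k (fun z => deriv χ.LFunction z / χ.LFunction z) (1 + x + Complex.I * t)‖ ≤
      C * (q * (|t| + 2)) ^ (1 / 2 : ℝ) := by
  obtain ⟨h0, h1⟩ := eps_le k
  set ε := (1:ℝ) / (6 * (k + 1)) with hε
  obtain ⟨c, c0, hc⟩ := low_L h0
  have Z0 := Zc_pos ε
  refine ⟨k.factorial * (16 * (1 + 8 * Zc ε) / (ε * c)) ^ (k + 1), by positivity, ?_⟩
  intro q _ χ hχ t x hx hx1
  have q1 : (1:ℝ) ≤ q := by exact_mod_cast NeZero.one_le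
  have X1 : 1 ≤ q * (|t| + 2) := one_le_mul_of_one_le_of_one_le q1 (by linarith [abs_nonneg t])
  set X := q * (|t| + 2) with hX
  obtain ⟨p1, p2, p3⟩ := pt_aux (t := t) hx hx1
  have X0 : 0 < X := by linarith
  have P := rpow_pos_of_pos X0 (-ε)
  have P' := rpow_pos_of_pos X0 (2 * ε)
  refine (logd (ε := ε / 2) (B := (1 + 8 * Zc ε) * X ^ (2 * ε)) (b := c * X ^ (-ε)) (by positivity)
    (DirichletCharacter.differentiable_LFunction hχ).differentiableOn ?_ (by positivity)
    (hc hχ t x hx hx1) k).trans ?_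
  · intro z hz
    obtain ⟨u, v⟩ := ball_aux h0 h1 p1 p2 p3 (le_of_lt (by simpa [dist_eq_norm] using hz))
    exact U1 h0 h1 hχ u v
  · rw [mul_assoc]
    refine mul_le_mul_of_nonneg_left ?_ (by positivity)
    refine pow_conv (κ := ε) X1 k (by positivity) hε rfl (by positivity) (le_of_eq ?_)
    field_simp; ring

lemma logd_zeta (k : ℕ) : ∃ C > 0, ∀ t x : ℝ, 1 ≤ |t| → 0 < x → x ≤ 1 →
    ‖iteratedDeriv k (fun z => -(deriv riemannZeta z / riemannZeta z) - riemannZeta z) (1 + x + Complex.I * t)‖ ≤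
      C * (|t| + 2) ^ (1 / 2 : ℝ) := by
  obtain ⟨h0, h1⟩ := eps_le k
  set ε := (1:ℝ) / (6 * (k + 1)) with hε
  obtain ⟨c, c0, hc⟩ := low_zeta h0
  have Z0 := Zc_pos ε
  refine ⟨k.factorial * (16 * ((1 + 6 * Zc ε) / (1 / 2)) / (ε * c)) ^ (k + 1) +
    k.factorial * ((1 + 6 * Zc ε) / (1 / 2)) / (ε / 4) ^ k, by positivity, ?_⟩
  intro t x ht hx hx1
  have X1 : 1 ≤ (|t| + 2) := (by linarith [abs_nonneg t])
  set X := (|t| + 2) with hX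
  obtain ⟨p1, p2, p3⟩ := pt_aux (t := t) hx hx1
  have X0 : 0 < X := by linarith
  have P := rpow_pos_of_pos X0 (-ε)
  have P' := rpow_pos_of_pos X0 (2 * ε)
  set s0 : ℂ := 1 + x + Complex.I * t with hs0
  have far : ∀ z ∈ Metric.ball s0 (ε / 2), 1 / 2 ≤ ‖z - 1‖ := by
    intro z hz
    have a1 : ‖z - s0‖ < ε / 2 := by simpa [dist_eq_norm] using hz
    have a2 := Complex.abs_im_le_norm (z - s0)
    have a3 := Complex.abs_im_le_norm (z - 1)
    have a4 : s0.im = t := by simp [hs0]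
    rw [Complex.sub_im, a4] at a2
    rw [Complex.sub_im, Complex.one_im, sub_zero] at a3
    have := abs_sub_abs_le_abs_sub t z.im
    rw [abs_sub_comm] at this
    linarith
  have ne : ∀ z ∈ Metric.ball s0 (ε / 2), z ≠ 1 := by
    intro z hz h
    have := far z hz
    rw [h, sub_self, norm_zero] at this; linarith
  have df : DifferentiableOn ℂ riemannZeta (Metric.ball s0 (ε / 2)) :=
    fun z hz => (differentiableAt_riemannZeta (ne z hz)).differentiableWithinAt
  have bd : ∀ z ∈ Metric.ball s0 (ε / 2), ‖riemannZeta z‖ ≤ (1 + 6 * Zc ε) / (1 / 2) * X ^ (2 * ε) := by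
    intro z hz
    obtain ⟨u, v⟩ := ball_aux h0 h1 p1 p2 p3 (le_of_lt (by simpa [dist_eq_norm] using hz))
    exact (U2 h0 h1 (by norm_num) (by norm_num) u v (far z hz)).trans (le_of_eq (by ring))
  have hlow := hc t x ht hx hx1
  have mem : s0 ∈ Metric.ball s0 (ε / 2) := Metric.mem_ball_self (by linarith)
  have an : ∀ {g : ℂ → ℂ}, DifferentiableOn ℂ g (Metric.ball s0 (ε / 2)) → AnalyticAt ℂ g s0 :=
    fun h => h.analyticAt (Metric.isOpen_ball.mem_nhds mem)
  have z0 : riemannZeta s0 ≠ 0 := by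
    intro h
    rw [h, norm_zero] at hlow
    have : 0 < c * X ^ (-ε) := by positivity
    linarith
  have aq : AnalyticAt ℂ (fun z => deriv riemannZeta z / riemannZeta z) s0 :=
    (an df).deriv.div (an df) z0
  have A1 := logd (ε := ε / 2) (b := c * X ^ (-ε)) (by positivity) df bd (by positivity) hlow k
  have A2 := Complex.norm_iteratedDeriv_le_of_forall_mem_sphere_norm_le k (c := s0) (R := ε / 4)
    (f := riemannZeta) (by positivity)
    ((df.mono (Metric.closedBall_subset_ball (by linarith))).diffContOnCl_ball subset_rfl)
    (fun z hz => bd z (Metric.closedBall_subset_ball (by linarith) (Metric.sphere_subset_closedBall hz)))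
  have e : iteratedDeriv k (fun z => -(deriv riemannZeta z / riemannZeta z) - riemannZeta z) s0 =
      -iteratedDeriv k (fun z => (deriv riemannZeta z / riemannZeta z)) s0 - iteratedDeriv k riemannZeta s0 := by
    rw [← iteratedDeriv_fun_neg, ← iteratedDeriv_fun_sub]
    · exact aq.neg.contDiffAt
    · exact (an df).contDiffAt
  rw [e]
  refine (norm_sub_le _ _).trans ?_
  rw [norm_neg, add_mul]
  refine add_le_add (A1.trans ?_) (A2.trans ?_)
  · rw [mul_assoc]
    refine mul_le_mul_of_nonneg_left ?_ (by positivity)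
    refine pow_conv (κ := ε) X1 k (by positivity) hε rfl (by positivity) (le_of_eq ?_)
    field_simp; ring
  · have : X ^ (2 * ε) ≤ X ^ (1 / 2 : ℝ) := by
      refine rpow_le_rpow_of_exponent_le X1 ?_
      rw [hε, mul_one_div, div_le_div_iff₀ (by positivity) (by norm_num)]
      linarith [(k.cast_nonneg : (0:ℝ) ≤ k)]
    calc _ = (k.factorial * ((1 + 6 * Zc ε) / (1 / 2)) / (ε / 4) ^ k) * X ^ (2 * ε) := by ring
      _ ≤ _ := by gcongr

lemma absc_le {b : ℕ → ℂ} (hb : ∀ n, ‖b n‖ ≤ 1 + log n) : LSeries.abscissaOfAbsConv b ≤ 1 := by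
  refine LSeries.abscissaOfAbsConv_le_of_forall_lt_LSeriesSummable' (fun y hy => ?_)
  have hy : (1:ℝ) < y := by exact_mod_cast hy
  refine LSeriesSummable_of_le_const_mul_rpow (x := (y + 1) / 2) (by simp; linarith)
    ⟨1 + 1 / ((y + 1) / 2 - 1), fun n hn => (hb n).trans ?_⟩
  have n1 : (1:ℝ) ≤ n := by exact_mod_cast Nat.one_le_iff_ne_zero.2 hn
  have := log_le_rpow_div (x := n) (ε := (y + 1) / 2 - 1) (by positivity) (by linarith)
  have := Real.one_le_rpow (x := n) (z := (y + 1) / 2 - 1) n1 (by linarith)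
  rw [add_mul, one_mul, div_mul_eq_mul_div, one_mul]
  linarith

lemma logMul_iter (b : ℕ → ℂ) (k n : ℕ) : (LSeries.logMul^[k] b) n = (log n : ℂ) ^ k * b n := by
  induction k with
  | zero => simp
  | succ k ih =>
    rw [Function.iterate_succ_apply', LSeries.logMul, ih, pow_succ, ← Complex.natCast_log]; ring

lemma iter_eq {b : ℕ → ℂ} (hb : ∀ n, ‖b n‖ ≤ 1 + log n) (k : ℕ) {g : ℂ → ℂ}
    (hg : ∀ s : ℂ, 1 < s.re → LSeries b s = g s) {s : ℂ} (hs : 1 < s.re) :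
    ‖LSeries (LSeries.logMul^[k] b) s‖ = ‖iteratedDeriv k g s‖ := by
  have h : LSeries.abscissaOfAbsConv b < s.re := (absc_le hb).trans_lt (by exact_mod_cast hs)
  have e : LSeries b =ᶠ[nhds s] g := Filter.eventuallyEq_iff_exists_mem.mpr
    ⟨{z | 1 < z.re}, (isOpen_lt continuous_const Complex.continuous_re).mem_nhds hs, hg⟩
  rw [← e.iteratedDeriv_eq, LSeries_iteratedDeriv k h]
  simp

open ArithmeticFunction in
noncomputable def bL {q : ℕ} (χ : DirichletCharacter ℂ q) (n : ℕ) : ℂ := χ n * (vonMangoldt n : ℝ)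
open ArithmeticFunction in
noncomputable def bZ (n : ℕ) : ℂ := (vonMangoldt n : ℝ) - if n = 0 then 0 else 1

lemma vM_le (n : ℕ) : ArithmeticFunction.vonMangoldt n ≤ log n := ArithmeticFunction.vonMangoldt_le_log

lemma bL_bd {q : ℕ} (χ : DirichletCharacter ℂ q) (n : ℕ) : ‖bL χ n‖ ≤ 1 + log n := by
  rw [bL, norm_mul, Complex.norm_real, norm_of_nonneg ArithmeticFunction.vonMangoldt_nonneg]
  have := vM_le n
  have h := mul_le_of_le_one_left (ArithmeticFunction.vonMangoldt_nonneg (n := n)) (χ.norm_le_one n)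
  linarith

lemma bZ_bd (n : ℕ) : ‖bZ n‖ ≤ 1 + log n := by
  rw [bZ]
  refine (norm_sub_le _ _).trans ?_
  rw [Complex.norm_real, norm_of_nonneg ArithmeticFunction.vonMangoldt_nonneg, add_comm]
  refine add_le_add ?_ (vM_le n)
  split_ifs <;> simp

lemma LB_L (k : ℕ) : ∃ C > 0, ∀ {q : ℕ} [NeZero q] {χ : DirichletCharacter ℂ q}, χ ≠ 1 →
    ∀ t x : ℝ, 0 < x → x ≤ 1 →
    ‖LSeries (LSeries.logMul^[k] (bL χ)) (1 + x + Complex.I * t)‖ ≤ C * (q * (|t| + 2)) ^ (1 / 2 : ℝ) := by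
  obtain ⟨C, C0, hC⟩ := logd_L k
  refine ⟨C, C0, fun {q} _ {χ} hχ t x hx hx1 => ?_⟩
  rw [iter_eq (bL_bd χ) k (g := fun z => -(deriv χ.LFunction z / χ.LFunction z)) ?_ (by simpa using hx)]
  · rw [iteratedDeriv_fun_neg, norm_neg]
    exact hC hχ t x hx hx1
  · intro s hs
    have := DirichletCharacter.LSeries_twist_vonMangoldt_eq χ hs
    have e : deriv (LSeries fun n => χ n) s = deriv χ.LFunction s := by
      refine Filter.EventuallyEq.deriv_eq <| Filter.eventuallyEq_iff_exists_mem.mpr ?_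
      exact ⟨{z | 1 < z.re}, (isOpen_lt continuous_const Complex.continuous_re).mem_nhds hs,
        fun z hz => (χ.LFunction_eq_LSeries hz).symm⟩
    rw [e, ← χ.LFunction_eq_LSeries hs, neg_div] at this
    exact this

lemma LS_bZ {s : ℂ} (hs : 1 < s.re) : LSeries bZ s = -(deriv riemannZeta s / riemannZeta s) - riemannZeta s := by
  have h := ArithmeticFunction.LSeries_vonMangoldt_eq_deriv_riemannZeta_div hs
  have h2 := LSeries_one_eq_riemannZeta hs
  rw [← neg_div, ← h, ← h2, ← LSeries_sub (ArithmeticFunction.LSeriesSummable_vonMangoldt hs)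
    (LSeriesSummable_one_iff.2 hs)]
  refine LSeries_congr (fun {n} hn => ?_) s
  simp [bZ, hn]

lemma LB_Z (k : ℕ) : ∃ C > 0, ∀ t x : ℝ, 0 < x → x ≤ 1 →
    ‖LSeries (LSeries.logMul^[k] bZ) (1 + x + Complex.I * t)‖ ≤ C * (|t| + 2) ^ (1 / 2 : ℝ) := by
  obtain ⟨C, C0, hC⟩ := logd_zeta k
  set H : ℂ → ℂ := fun z => -(deriv riemannZeta₁ z / riemannZeta₁ z) - dslope riemannZeta₁ 1 z with hH
  have ne0 : ∀ z : ℂ, 1 ≤ z.re → riemannZeta₁ z ≠ 0 := by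
    intro z hz
    by_cases h : z = 1
    · rw [h, riemannZeta₁_one]; exact one_ne_zero
    · rw [zeta₁_eq h]; exact mul_ne_zero (sub_ne_zero.2 h) (riemannZeta_ne_zero_of_one_le_re hz)
  have aH : ∀ z : ℂ, 1 ≤ z.re → AnalyticAt ℂ (iteratedDeriv k H) z := by
    intro z hz
    have a1 : ∀ w, AnalyticAt ℂ riemannZeta₁ w := fun w => differentiable_riemannZeta₁.analyticAt w
    rw [iteratedDeriv_eq_iterate]
    refine AnalyticAt.iterated_deriv ?_ k
    refine ((a1 z).deriv.div (a1 z) (ne0 z hz)).neg.sub ?_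
    refine DifferentiableOn.analyticAt (s := Set.univ) ?_ univ_mem
    exact (Complex.differentiableOn_dslope univ_mem).2 differentiable_riemannZeta₁.differentiableOn
  obtain ⟨C', hC'⟩ := ((isCompact_Icc (a := (1:ℝ)) (b := 2)).reProdIm
    (isCompact_Icc (a := (-1:ℝ)) (b := 1))).exists_bound_of_continuousOn (f := iteratedDeriv k H)
    (fun z hz => (aH z hz.1.1).continuousAt.continuousWithinAt)
  refine ⟨max C C', lt_max_of_lt_left C0, fun t x hx hx1 => ?_⟩
  have X1 : 1 ≤ (|t| + 2) ^ (1 / 2 : ℝ) := Real.one_le_rpow (by linarith [abs_nonneg t]) (by norm_num)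
  by_cases ht : 1 ≤ |t|
  · rw [iter_eq bZ_bd k (fun s hs => LS_bZ hs) (by simpa using hx)]
    refine (hC t x ht hx hx1).trans ?_
    gcongr
    exact le_max_left _ _
  · rw [iter_eq bZ_bd k (g := H) ?_ (by simpa using hx)]
    · have := hC' (1 + x + Complex.I * t) (by
        rw [not_le, abs_lt] at ht
        simp [Complex.mem_reProdIm]
        exact ⟨⟨hx.le, by linarith⟩, ht.1.le, ht.2.le⟩)
      refine this.trans ((le_max_right C C').trans (le_mul_of_one_le_right ?_ X1))
      exact (C0.le.trans (le_max_left _ _))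
    · intro s hs
      have s1 : s ≠ 1 := by rintro rfl; simp at hs
      have s1' := sub_ne_zero.2 s1
      have z0 := riemannZeta_ne_zero_of_one_le_re hs.le
      rw [LS_bZ hs]
      have e : deriv riemannZeta₁ s = riemannZeta s + (s - 1) * deriv riemannZeta s := by
        have : riemannZeta₁ =ᶠ[nhds s] fun z => (z - 1) * riemannZeta z := by
          filter_upwards [isOpen_ne.mem_nhds s1] with z hz using zeta₁_eq hz
        rw [this.deriv_eq]
        have := ((hasDerivAt_id s).sub_const 1).fun_mul (differentiableAt_riemannZeta s1).hasDerivAt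
        simpa using this.deriv
      simp only [hH]
      rw [dslope_of_ne _ s1, slope_def_field, e, riemannZeta₁_one, zeta₁_eq s1]
      field_simp
      ring

section
open MeasureTheory Complex

noncomputable def hk (σ y : ℝ) : ℂ := ((max 0 (1 - Real.exp (-y)) * Real.exp (-σ * y) : ℝ) : ℂ)
noncomputable def sl (σ ξ : ℝ) : ℂ := σ + I * (2 * π * ξ : ℝ)
noncomputable def kern (σ ξ : ℝ) : ℂ := 1 / (sl σ ξ * (sl σ ξ + 1))

lemma sl_re (σ ξ : ℝ) : (sl σ ξ).re = σ := by simp [sl]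
lemma sl_im (σ ξ : ℝ) : (sl σ ξ).im = 2 * π * ξ := by simp [sl]

lemma hk_eq (σ : ℝ) : hk σ = (Set.Ioi (0:ℝ)).indicator
    (fun y : ℝ => cexp (-σ * y) - cexp (-(σ + 1) * y)) := by
  ext y
  by_cases h : 0 < y
  · rw [Set.indicator_of_mem (Set.mem_Ioi.2 h), hk, max_eq_right]
    · push_cast
      rw [sub_mul, one_mul, ← Complex.exp_add]
      ring_nf
    · have : Real.exp (-y) ≤ 1 := exp_le_one_iff.2 (by linarith)
      linarith
  · rw [Set.indicator_of_notMem (by simpa using h), hk, max_eq_left]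
    · simp
    · have : 1 ≤ Real.exp (-y) := Real.one_le_exp (by linarith)
      linarith

lemma hk_int {σ : ℝ} (h : 1 ≤ σ) : Integrable (hk σ) := by
  rw [hk_eq, integrable_indicator_iff measurableSet_Ioi]
  refine Integrable.sub ?_ ?_
  · exact integrableOn_exp_mul_complex_Ioi (a := -σ) (by simp; linarith) 0
  · exact integrableOn_exp_mul_complex_Ioi (a := -(σ + 1)) (by simp; linarith) 0

lemma hk_cont (σ : ℝ) : Continuous (hk σ) := by unfold hk; fun_prop

lemma sl_norm {σ ξ : ℝ} (h : 1 ≤ σ) : 1 + (2 * π * ξ) ^ 2 ≤ ‖sl σ ξ‖ ^ 2 ∧ ‖sl σ ξ‖ ≤ ‖sl σ ξ + 1‖ := by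
  constructor
  · rw [← Complex.normSq_eq_norm_sq, Complex.normSq_apply, sl_re, sl_im]; nlinarith
  · rw [← sq_le_sq₀ (norm_nonneg _) (norm_nonneg _), ← Complex.normSq_eq_norm_sq,
      ← Complex.normSq_eq_norm_sq, Complex.normSq_apply, Complex.normSq_apply]
    simp only [add_re, add_im, sl_re, sl_im, one_re, one_im]; nlinarith

lemma sl_ne {σ ξ : ℝ} (h : 1 ≤ σ) : sl σ ξ ≠ 0 ∧ sl σ ξ + 1 ≠ 0 := by
  constructor <;> intro h' <;> have := congrArg re h' <;> simp [sl_re] at this <;> linarith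

lemma kern_bd {σ ξ : ℝ} (h : 1 ≤ σ) : ‖kern σ ξ‖ ≤ (1 + (2 * π * ξ) ^ 2)⁻¹ := by
  obtain ⟨a, b⟩ := sl_norm (ξ := ξ) h
  rw [kern, norm_div, norm_one, one_div, norm_mul]
  refine inv_anti₀ (by positivity) (a.trans ?_)
  rw [sq]
  gcongr

lemma kern_cont {σ : ℝ} (h : 1 ≤ σ) : Continuous (kern σ) := by
  unfold kern
  refine Continuous.div (by fun_prop) (by unfold sl; fun_prop) ?_
  intro ξ
  exact mul_ne_zero (sl_ne h).1 (sl_ne h).2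

lemma kern_int {σ : ℝ} (h : 1 ≤ σ) : Integrable (kern σ) := by
  refine Integrable.mono' (g := fun ξ => (1 + (2 * π * ξ) ^ 2)⁻¹) ?_
    (kern_cont h).aestronglyMeasurable (ae_of_all _ fun ξ => kern_bd h)
  exact integrable_inv_one_add_sq.comp_mul_left' (by positivity)

lemma four_hk {σ : ℝ} (h : 1 ≤ σ) : FourierTransform.fourier (hk σ) = kern σ := by
  ext ξ
  rw [Real.fourier_eq', hk_eq]
  have e : ∀ v : ℝ, cexp (↑(-2 * π * inner ℝ v ξ) * I) • (Set.Ioi 0).indicator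
      (fun y : ℝ => cexp (-σ * y) - cexp (-(σ + 1) * y)) v = (Set.Ioi 0).indicator
      (fun y : ℝ => cexp (-sl σ ξ * y) - cexp (-(sl σ ξ + 1) * y)) v := by
    intro v
    by_cases hv : v ∈ Set.Ioi (0:ℝ)
    · rw [Set.indicator_of_mem hv, Set.indicator_of_mem hv, smul_eq_mul, mul_sub, ← Complex.exp_add,
        ← Complex.exp_add, sl]
      simp only [RCLike.inner_apply, conj_trivial]
      push_cast
      ring_nf
    · rw [Set.indicator_of_notMem hv, Set.indicator_of_notMem hv, smul_zero]
  simp_rw [e]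
  rw [integral_indicator measurableSet_Ioi]
  have r1 : (-sl σ ξ).re < 0 := by rw [neg_re, sl_re]; linarith
  have r2 : (-(sl σ ξ + 1)).re < 0 := by rw [neg_re, add_re, sl_re, one_re]; linarith
  rw [integral_sub (integrableOn_exp_mul_complex_Ioi r1 0) (integrableOn_exp_mul_complex_Ioi r2 0),
    integral_exp_mul_complex_Ioi r1, integral_exp_mul_complex_Ioi r2, kern]
  obtain ⟨a, b⟩ := sl_ne (ξ := ξ) h
  simp only [ofReal_zero, mul_zero, Complex.exp_zero]
  field_simp
  ring

lemma kern_inv {σ : ℝ} (h : 1 ≤ σ) (y : ℝ) : ∫ ξ : ℝ, cexp ((2 * π * ξ * y : ℝ) * I) * kern σ ξ = hk σ y := by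
  have := congrFun ((hk_cont σ).fourierInv_fourier_eq (hk_int h) (by rw [four_hk h]; exact kern_int h)) y
  rw [four_hk h, Real.fourierInv_eq'] at this
  rw [← this]
  refine integral_congr_ae (ae_of_all _ fun ξ => ?_)
  simp only [RCLike.inner_apply, conj_trivial, smul_eq_mul]
  congr 3
  push_cast
  ring

lemma gg_int : Integrable (fun ξ : ℝ => (2:ℝ) * (1 + (2 * π * ξ) ^ 2) ^ (-(3 / 2 : ℝ) / 2)) := by
  have := (integrable_rpow_neg_one_add_norm_sq (E := ℝ) (μ := volume) (r := 3 / 2) (by simp; norm_num))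
  have := (this.comp_mul_left' (R := 2 * π) (by positivity)).const_mul 2
  simpa only [norm_eq_abs, sq_abs] using this

lemma gg_le (t : ℝ) : (1 + t ^ 2)⁻¹ * (|t| + 2) ^ (1 / 2 : ℝ) ≤ 2 * (1 + t ^ 2) ^ (-(3 / 2 : ℝ) / 2) := by
  have p : 0 < 1 + t ^ 2 := by positivity
  have : (|t| + 2) ^ (1 / 2 : ℝ) ≤ 2 * (1 + t ^ 2) ^ (1 / 4 : ℝ) := by
    have e : 2 * (1 + t ^ 2) ^ (1 / 4 : ℝ) = (16 * (1 + t ^ 2)) ^ (1 / 4 : ℝ) := by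
      rw [Real.mul_rpow (by norm_num) p.le, show (16:ℝ) = 2 ^ (4:ℝ) by norm_num, ← rpow_mul (by norm_num)]
      norm_num
    have e2 : (|t| + 2) ^ (1 / 2 : ℝ) = ((|t| + 2) ^ 2) ^ (1 / 4 : ℝ) := by
      rw [← rpow_natCast, ← rpow_mul (by positivity)]; norm_num
    rw [e, e2]
    refine rpow_le_rpow (by positivity) ?_ (by norm_num)
    have := sq_abs t
    nlinarith [sq_nonneg (|t| - 1)]
  calc _ ≤ (1 + t ^ 2)⁻¹ * (2 * (1 + t ^ 2) ^ (1 / 4 : ℝ)) := by gcongr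
    _ = 2 * ((1 + t ^ 2) ^ (-1 : ℝ) * (1 + t ^ 2) ^ (1 / 4 : ℝ)) := by rw [rpow_neg_one]; ring
    _ = _ := by rw [← rpow_add p]; norm_num

lemma perron : ∃ K > 0, ∀ (a : ℕ → ℂ) (B : ℝ), a 0 = 0 → LSeries.abscissaOfAbsConv a ≤ 1 →
    (∀ t x : ℝ, 0 < x → x ≤ 1 → ‖LSeries a (1 + x + I * t)‖ ≤ B * (|t| + 2) ^ (1 / 2 : ℝ)) →
    ∀ N : ℕ, 3 ≤ N → ‖∑ n ∈ range N, a n * (N - n : ℂ)‖ ≤ K * B * N ^ 2 := by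
  set J := ∫ ξ : ℝ, (2:ℝ) * (1 + (2 * π * ξ) ^ 2) ^ (-(3 / 2 : ℝ) / 2) with hJ
  have J0 : 0 ≤ J := integral_nonneg fun ξ => by positivity
  refine ⟨Real.exp 1 * (J + 1), by positivity, fun a B a0 ha hB N hN => ?_⟩
  have B0 : 0 ≤ B := by
    have := (norm_nonneg _).trans (hB 0 1 one_pos le_rfl)
    by_contra! h
    have : B * (|0| + 2) ^ (1 / 2 : ℝ) < 0 := mul_neg_of_neg_of_pos h (by positivity)
    linarith
  have N0 : (0:ℝ) < N := by positivity
  have lN : 1 ≤ Real.log N := by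
    rw [Real.le_log_iff_exp_le N0]
    have : (3:ℝ) ≤ N := by exact_mod_cast hN
    linarith [Real.exp_one_lt_d9]
  set δ := 1 / Real.log N with hδ
  have δ0 : 0 < δ := by positivity
  have δ1 : δ ≤ 1 := by rw [hδ, div_le_one (by linarith)]; exact lN
  set σ := 1 + δ with hσ
  have σ1 : 1 ≤ σ := by linarith
  have sum : ∀ ξ, LSeriesSummable a (sl σ ξ) := fun ξ => LSeriesSummable_of_abscissaOfAbsConv_lt_re
    (ha.trans_lt (by rw [sl_re]; exact_mod_cast (by linarith)))
  set F : ℕ → ℝ → ℂ := fun n ξ => LSeries.term a σ n * (cexp ((2 * π * ξ * (Real.log N - Real.log n) : ℝ) * I) * kern σ ξ) with hF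
  have nF : ∀ n ξ, ‖F n ξ‖ = ‖LSeries.term a σ n‖ * ‖kern σ ξ‖ := by
    intro n ξ
    rw [hF, norm_mul, norm_mul, Complex.norm_exp_ofReal_mul_I, one_mul]
  have Fi : ∀ n, Integrable (F n) := by
    intro n
    refine ((kern_int σ1).norm.const_mul ‖LSeries.term a σ n‖).mono' ?_ (ae_of_all _ fun ξ => (nF n ξ).le)
    refine Continuous.aestronglyMeasurable ?_
    have := kern_cont σ1
    simp only [hF]; fun_prop
  have H := hasSum_integral_of_summable_integral_norm Fi (by
    simp_rw [nF, integral_const_mul]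
    have := (sum 0).norm.mul_right (∫ ξ, ‖kern σ ξ‖)
    simpa [sl, LSeriesSummable] using this)
  have nz : ∀ n : ℕ, n ≠ 0 → (n:ℂ) ≠ 0 := fun n h => by exact_mod_cast h
  have eF : ∀ ξ, ∑' n, F n ξ = cexp ((2 * π * ξ * Real.log N : ℝ) * I) * kern σ ξ * LSeries a (sl σ ξ) := by
    intro ξ
    rw [LSeries, ← tsum_mul_left]
    refine tsum_congr fun n => ?_
    simp only [hF]
    by_cases h : n = 0
    · simp [h]
    rw [LSeries.term_of_ne_zero h, LSeries.term_of_ne_zero h, sl, Complex.cpow_add _ _ (by exact_mod_cast h : (n:ℂ) ≠ 0)]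
    have : (n:ℂ) ^ (I * (2 * π * ξ : ℝ)) = cexp ((2 * π * ξ * Real.log n : ℝ) * I) := by
      rw [Complex.cpow_def_of_ne_zero (nz n h), ← Complex.natCast_log]; push_cast; ring_nf
    rw [this, mul_sub, ofReal_sub, sub_mul, Complex.exp_sub]
    have := Complex.exp_ne_zero ((2 * π * ξ * Real.log n : ℝ) * I)
    field_simp
  have eI : ∀ n, ∫ ξ, F n ξ = if n < N then a n * (N - n : ℂ) * ((N : ℂ) * ((N:ℝ) ^ σ : ℝ))⁻¹ else 0 := by
    intro n
    simp only [hF]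
    rw [integral_const_mul, kern_inv σ1]
    by_cases h : n = 0
    · simp [h, a0]
    have n0 : (0:ℝ) < n := by positivity
    have e1 : Real.exp (-(Real.log N - Real.log n)) = n / N := by
      rw [neg_sub, Real.exp_sub, Real.exp_log n0, Real.exp_log N0]
    have e2 : Real.exp (-σ * (Real.log N - Real.log n)) = (n:ℝ) ^ σ / (N:ℝ) ^ σ := by
      rw [Real.rpow_def_of_pos n0, Real.rpow_def_of_pos N0, ← Real.exp_sub]; ring_nf
    have e3 : (n : ℂ) ^ (σ : ℂ) = ((n:ℝ) ^ σ : ℝ) := by rw [Complex.ofReal_cpow n0.le]; simp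
    have p1 : (((n:ℝ) ^ σ : ℝ) : ℂ) ≠ 0 := by exact_mod_cast (by positivity)
    have p2 : (((N:ℝ) ^ σ : ℝ) : ℂ) ≠ 0 := by exact_mod_cast (by positivity)
    have p3 : (N:ℂ) ≠ 0 := by exact_mod_cast N0.ne'
    rw [hk, e1, e2, LSeries.term_of_ne_zero h, e3]
    split_ifs with hn
    · have : (n:ℝ) < N := by exact_mod_cast hn
      rw [max_eq_right (by rw [sub_nonneg, div_le_one N0]; exact this.le)]
      push_cast
      field_simp
    · have : (N:ℝ) ≤ n := by exact_mod_cast not_lt.1 hn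
      rw [max_eq_left (by rw [sub_nonpos, one_le_div N0]; exact this)]
      simp
  have T := H.tsum_eq
  simp_rw [eI, eF] at T
  rw [tsum_eq_sum (s := range N) (by intro n hn; simp at hn; simp [not_lt.2 hn]),
    sum_congr rfl (g := fun n => a n * (N - n : ℂ) * ((N : ℂ) * ((N:ℝ) ^ σ : ℝ))⁻¹)
      (by intro n hn; simp at hn; simp [hn]), ← sum_mul] at T
  have np : (N : ℂ) * ((N:ℝ) ^ σ : ℝ) ≠ 0 := by
    refine mul_ne_zero (by exact_mod_cast N0.ne') ?_
    exact_mod_cast (by positivity)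
  rw [← div_eq_mul_inv, div_eq_iff np] at T
  rw [T, norm_mul, norm_mul, Complex.norm_real, Complex.norm_natCast, Real.norm_of_nonneg (by positivity)]
  have eN : (N:ℝ) ^ σ = N * Real.exp 1 := by
    rw [hσ, Real.rpow_add N0, Real.rpow_one, hδ, Real.rpow_def_of_pos N0, mul_one_div_cancel (by linarith)]
  have key : ‖∫ ξ, cexp ((2 * π * ξ * Real.log N : ℝ) * I) * kern σ ξ * LSeries a (sl σ ξ)‖ ≤ B * J := by
    rw [hJ, ← integral_const_mul]
    refine norm_integral_le_of_norm_le (gg_int.const_mul B) (ae_of_all _ fun ξ => ?_)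
    rw [norm_mul, norm_mul, Complex.norm_exp_ofReal_mul_I, one_mul]
    have h1 := hB (2 * π * ξ) δ δ0 δ1
    have h2 : (1 + δ + I * (2 * π * ξ : ℝ) : ℂ) = sl σ ξ := by rw [sl, hσ]; push_cast; ring
    rw [h2] at h1
    calc _ ≤ (1 + (2 * π * ξ) ^ 2)⁻¹ * (B * (|2 * π * ξ| + 2) ^ (1 / 2 : ℝ)) := by
          gcongr
          exact kern_bd σ1
      _ = B * ((1 + (2 * π * ξ) ^ 2)⁻¹ * (|2 * π * ξ| + 2) ^ (1 / 2 : ℝ)) := by ring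
      _ ≤ _ := mul_le_mul_of_nonneg_left (gg_le _) B0
  rw [eN]
  calc _ ≤ (B * (J + 1)) * (N * (N * Real.exp 1)) := by
        gcongr
        refine key.trans ?_
        gcongr
        linarith
    _ = _ := by ring
end

lemma abel_bd {z g : ℕ → ℂ} {N : ℕ} {E : ℝ} (h : ∀ j ≤ N, ‖∑ n ∈ range j, z n‖ ≤ E) :
    ‖∑ n ∈ range N, z n * g n‖ ≤ E * (‖g (N - 1)‖ + ∑ i ∈ range (N - 1), ‖g (i + 1) - g i‖) := by
  have := sum_range_by_parts g z N
  simp only [smul_eq_mul] at this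
  simp_rw [mul_comm (z _)]
  rw [this, mul_add, Finset.mul_sum (range (N - 1)) _ E]
  refine (norm_sub_le _ _).trans (add_le_add ?_ ?_)
  · rw [norm_mul, mul_comm]
    exact mul_le_mul_of_nonneg_right (h N le_rfl) (norm_nonneg _)
  · refine (norm_sum_le _ _).trans (sum_le_sum fun i hi => ?_)
    rw [norm_mul, mul_comm]
    refine mul_le_mul_of_nonneg_right (h _ ?_) (norm_nonneg _)
    have := mem_range.1 hi
    omega

lemma abel_mono {z : ℕ → ℂ} {u : ℕ → ℝ} {N : ℕ} {E : ℝ} (h : ∀ j ≤ N, ‖∑ n ∈ range j, z n‖ ≤ E)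
    (hu : ∀ i, u (i + 1) ≤ u i) (h0 : ∀ i, 0 ≤ u i) :
    ‖∑ n ∈ range N, z n * u n‖ ≤ E * u 0 := by
  have := abel_bd (g := fun n => (u n : ℂ)) h
  refine this.trans (le_of_eq ?_)
  congr 1
  have e : ∀ i, ‖(u (i + 1) : ℂ) - u i‖ = u i - u (i + 1) := by
    intro i
    rw [← Complex.ofReal_sub, Complex.norm_real, norm_eq_abs, abs_sub_comm, abs_of_nonneg]
    linarith [hu i]
  simp_rw [e]
  rw [Finset.sum_range_sub', Complex.norm_real, norm_of_nonneg (h0 _)]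
  ring

lemma log_pow_le (m : ℕ) {x : ℝ} (hx : 1 ≤ x) : log x ^ m ≤ m.factorial * x := by
  have := Real.pow_div_factorial_le_exp (log x) (log_nonneg hx) m
  rw [exp_log (by linarith), div_le_iff₀ (by positivity)] at this
  linarith

lemma one_le_log {N : ℕ} (hN : 3 ≤ N) : 1 ≤ log N := by
  rw [Real.le_log_iff_exp_le (by positivity)]
  have : (3:ℝ) ≤ N := by exact_mod_cast hN
  linarith [exp_one_lt_d9]

lemma sum_bound1 (m : ℕ) (hm : 1 ≤ m) : ∃ C > 0, ∀ b : ℕ → ℂ, (∀ n, ‖b n‖ ≤ 1 + log n) → ∀ B : ℝ, 1 ≤ B →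
    (∀ t x : ℝ, 0 < x → x ≤ 1 → ‖LSeries (LSeries.logMul^[2 * m - 1] b) (1 + x + Complex.I * t)‖ ≤
      B * (|t| + 2) ^ (1 / 2 : ℝ)) →
    ∀ N : ℕ, 3 ≤ N → ‖∑ n ∈ range N, (log n : ℂ) ^ (2 * m - 1) * b n‖ ≤ C * B * (N * log N ^ m) := by
  obtain ⟨K, K0, hK⟩ := perron
  refine ⟨5 * K + (1 + m.factorial) * 9 ^ m, by positivity, fun b hb B B1 hB N hN => ?_⟩
  set a : ℕ → ℂ := fun n => (log n : ℂ) ^ (2 * m - 1) * b n with ha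
  have aeq : a = LSeries.logMul^[2 * m - 1] b := by ext n; rw [logMul_iter]
  have P := hK a B (by simp only [ha]; rw [Nat.cast_zero, log_zero, Complex.ofReal_zero, zero_pow (by omega), zero_mul])
    (by rw [aeq, LSeries.absicssaOfAbsConv_logPowMul]; exact absc_le hb) (by rw [aeq]; exact hB)
  have l1 := one_le_log hN
  set l := log N with hl
  have N0 : (0:ℝ) < N := by positivity
  set h := ⌈(N:ℝ) / l ^ m⌉₊ with hh
  have lm : 1 ≤ l ^ m := one_le_pow₀ l1
  have h1 : (N:ℝ) / l ^ m ≤ h := Nat.le_ceil _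
  have h2 : h ≤ N := Nat.ceil_le.2 (div_le_self N0.le lm)
  have h2' : (h:ℝ) ≤ N := by exact_mod_cast h2
  have h0 : (0:ℝ) < h := lt_of_lt_of_le (by positivity) h1
  have h3 : (h:ℝ) ≤ (1 + m.factorial) * (N / l ^ m) := by
    have := Nat.ceil_lt_add_one (a := (N:ℝ) / l ^ m) (by positivity)
    have h4 : 1 ≤ m.factorial * (N / l ^ m) := by
      rw [← mul_div_assoc, one_le_div (by positivity)]
      exact log_pow_le m (by exact_mod_cast (by omega : 1 ≤ N))
    rw [add_mul, one_mul]
    linarith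
  have id : (h:ℂ) * ∑ n ∈ range N, a n = ∑ n ∈ range (N + h), a n * (((N + h : ℕ) : ℂ) - n) -
      ∑ n ∈ range N, a n * ((N:ℂ) - n) - ∑ n ∈ Finset.Ico N (N + h), a n * (((N + h : ℕ) : ℂ) - n) := by
    rw [← sum_range_add_sum_Ico _ (Nat.le_add_right N h), add_sub_right_comm, add_sub_cancel_right,
      ← sum_sub_distrib, Finset.mul_sum]
    refine sum_congr rfl fun n _ => ?_
    push_cast; ring
  have tail : ‖∑ n ∈ Finset.Ico N (N + h), a n * (((N + h : ℕ) : ℂ) - n)‖ ≤ h * (h * (9 ^ m * (l ^ m * l ^ m))) := by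
    have : (h:ℝ) * (h * (9 ^ m * (l ^ m * l ^ m))) = (Finset.Ico N (N + h)).card • (h * (9 ^ m * (l ^ m * l ^ m))) := by simp
    rw [this]
    refine (norm_sum_le_of_le _ fun n hn => ?_).trans (sum_le_card_nsmul _ (fun _ => h * (9 ^ m * (l ^ m * l ^ m))) _ fun _ _ => le_rfl)
    obtain ⟨u, v⟩ := mem_Ico.1 hn
    have ln0 : 0 ≤ log n := log_natCast_nonneg n
    have ln : log n ≤ 2 * l := by
      have : log n ≤ log (N * N) := by
        apply log_le_log (by exact_mod_cast (by omega : 0 < n))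
        exact_mod_cast (show n ≤ N * N by nlinarith)
      rw [log_mul N0.ne' N0.ne'] at this
      linarith
    have e : ‖((N + h : ℕ) : ℂ) - n‖ ≤ h := by
      rw [← Nat.cast_sub v.le, Complex.norm_natCast]
      exact_mod_cast (by omega)
    rw [norm_mul, mul_comm]
    refine mul_le_mul e ?_ (norm_nonneg _) h0.le
    rw [norm_mul, norm_pow, Complex.norm_real, norm_of_nonneg ln0]
    calc _ ≤ (3 * l) ^ (2 * m - 1) * (3 * l) := by
          gcongr
          · linarith
          · exact (hb n).trans (by linarith)
      _ = (3 * l) ^ (2 * m) := by rw [← pow_succ]; congr 1; omega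
      _ = _ := by rw [mul_pow, ← pow_add, pow_mul]; norm_num; congr 1; ring
  have M : h * ‖∑ n ∈ range N, a n‖ ≤ K * B * (2 * N) ^ 2 + K * B * N ^ 2 + h * (h * (9 ^ m * (l ^ m * l ^ m))) := by
    have e : (h:ℝ) * ‖∑ n ∈ range N, a n‖ = ‖(h:ℂ) * ∑ n ∈ range N, a n‖ := by
      rw [norm_mul, Complex.norm_natCast]
    rw [e, id]
    refine (norm_sub_le _ _).trans (add_le_add ((norm_sub_le _ _).trans (add_le_add ?_ (P N hN))) tail)
    refine (P (N + h) (by omega)).trans ?_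
    gcongr
    push_cast; linarith
  have M2 : ‖∑ n ∈ range N, a n‖ ≤ 5 * K * B * N ^ 2 / h + h * (9 ^ m * (l ^ m * l ^ m)) := by
    rw [← mul_le_mul_iff_right₀ h0, mul_add, mul_div_cancel₀ _ h0.ne']
    refine M.trans (le_of_eq ?_)
    ring
  refine M2.trans ?_
  have q1 : 5 * K * B * N ^ 2 / h ≤ 5 * K * B * (N * l ^ m) := by
    rw [div_le_iff₀ h0]
    rw [div_le_iff₀ (by positivity)] at h1
    calc 5 * K * B * (N:ℝ) ^ 2 = 5 * K * B * N * N := by ring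
      _ ≤ 5 * K * B * N * (h * l ^ m) := by gcongr
      _ = _ := by ring
  have q2 : h * (9 ^ m * (l ^ m * l ^ m)) ≤ (1 + m.factorial) * 9 ^ m * B * (N * l ^ m) := by
    calc _ ≤ (1 + m.factorial) * (N / l ^ m) * (9 ^ m * (l ^ m * l ^ m)) := by gcongr
      _ = (1 + m.factorial) * 9 ^ m * 1 * (N * l ^ m) := by field_simp
      _ ≤ _ := by gcongr
  calc _ ≤ _ := add_le_add q1 q2
    _ = _ := by ring

lemma sum_bound (j : ℕ) : ∃ C > 0, ∀ b : ℕ → ℂ, (∀ n, ‖b n‖ ≤ 1 + log n) → ∀ B : ℝ, 1 ≤ B →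
    (∀ t x : ℝ, 0 < x → x ≤ 1 → ‖LSeries (LSeries.logMul^[2 * (j + 1) - 1] b) (1 + x + Complex.I * t)‖ ≤
      B * (|t| + 2) ^ (1 / 2 : ℝ)) →
    ∀ N : ℕ, 3 ≤ N → ‖∑ n ∈ range N, b n‖ ≤ C * B * (N / log N ^ j) := by
  obtain ⟨C, C0, hC⟩ := sum_bound1 (j + 1) (by omega)
  refine ⟨4 * 2 ^ (j + 1) * (j + 1).factorial + 2 * 2 ^ (2 * j + 1) * C, by positivity, fun b hb B B1 hB N hN => ?_⟩
  have hA := hC b hb B B1 hB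
  have ek : 2 * (j + 1) - 1 = 2 * j + 1 := by omega
  rw [ek] at hA
  set a : ℕ → ℂ := fun n => (log n : ℂ) ^ (2 * j + 1) * b n with ha
  have l1 := one_le_log hN
  set l := log N with hl
  have N3 : (3:ℝ) ≤ N := by exact_mod_cast hN
  have N0 : (0:ℝ) < N := by positivity
  have s1 : 1 < √(N:ℝ) := by rw [Real.lt_sqrt one_pos.le]; linarith
  set Y := ⌈√(N:ℝ)⌉₊ with hY
  have Y1 : √(N:ℝ) ≤ Y := Nat.le_ceil _
  have Y2 : 2 ≤ Y := by
    have : (1:ℝ) < Y := by linarith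
    exact_mod_cast this
  have ss := Real.mul_self_sqrt N0.le
  have Y3 : Y ≤ N := Nat.ceil_le.2 (by nlinarith)
  have lsq : l = 2 * log √(N:ℝ) := by rw [log_sqrt N0.le]; ring
  have A0 : ∀ i ≤ N, ‖∑ n ∈ range i, a n‖ ≤ C * B * (N * l ^ (j + 1)) := by
    intro i hi
    by_cases h : 3 ≤ i
    · refine (hA i h).trans ?_
      have i0 : (0:ℝ) < i := by positivity
      gcongr
      exact log_le_log i0 (by exact_mod_cast hi)
    · have : ∑ n ∈ range i, a n = 0 := by
        refine sum_eq_zero fun n hn => ?_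
        have : n = 0 ∨ n = 1 := by have := mem_range.1 hn; omega
        rcases this with rfl | rfl <;> simp [ha]
      rw [this, norm_zero]; positivity
  set u : ℕ → ℝ := fun i => 1 / log (Y + i : ℕ) ^ (2 * j + 1) with hu
  have lY : l / 2 ≤ log Y := by
    have := log_le_log (by linarith) Y1
    linarith
  have lp : ∀ i, 0 < log (Y + i : ℕ) := fun i => log_pos (by exact_mod_cast (by omega))
  have M := abel_mono (z := fun i => a (Y + i)) (u := u) (N := N - Y) (E := 2 * (C * B * (N * l ^ (j + 1)))) (by
      intro i hi
      have := sum_range_add_sum_Ico a (Nat.le_add_right Y i)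
      rw [sum_Ico_eq_sum_range, Nat.add_sub_cancel_left, ← eq_sub_iff_add_eq'] at this
      rw [this, two_mul]
      exact (norm_sub_le _ _).trans (add_le_add (A0 _ (by omega)) (A0 _ Y3))) (by
      intro i
      simp only [hu]
      refine one_div_le_one_div_of_le (pow_pos (lp i) _) ?_
      refine pow_le_pow_left₀ (lp i).le ?_ _
      refine log_le_log (by exact_mod_cast (by omega)) (by exact_mod_cast (by omega))) (by
      intro i
      have := lp i
      simp only [hu]; positivity)
  have e : ∑ n ∈ range N, b n = ∑ n ∈ range Y, b n + ∑ i ∈ range (N - Y), a (Y + i) * u i := by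
    rw [← sum_range_add_sum_Ico b Y3, sum_Ico_eq_sum_range]
    congr 1
    refine sum_congr rfl fun i _ => ?_
    have : ((log (Y + i : ℕ) : ℝ) : ℂ) ≠ 0 := by exact_mod_cast (lp i).ne'
    simp only [ha, hu]
    push_cast at *
    field_simp
  rw [e, add_mul, add_mul]
  refine (norm_add_le _ _).trans (add_le_add ?_ (M.trans ?_))
  · have f1 : ‖∑ n ∈ range Y, b n‖ ≤ Y * (2 * l) := by
      have := norm_sum_le_of_le (range Y) (f := b) (n := fun _ => 2 * l) (fun n hn => by
        refine (hb n).trans ?_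
        by_cases h : n = 0
        · rw [h, Nat.cast_zero, log_zero]; linarith
        have : log n ≤ l := log_le_log (by positivity) (by
          have := mem_range.1 hn
          exact_mod_cast (by omega))
        linarith)
      simpa using this
    have Y4 : (Y:ℝ) ≤ 2 * √N := by
      have := Nat.ceil_lt_add_one (a := √(N:ℝ)) (by positivity)
      linarith
    have L := log_pow_le (j + 1) s1.le
    have L2 : l ^ (j + 1) ≤ 2 ^ (j + 1) * ((j + 1).factorial * √N) := by
      rw [lsq, mul_pow]; gcongr
    have lj : 0 < l ^ j := by positivity
    calc _ ≤ 2 * √N * (2 * l) := f1.trans (by gcongr)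
      _ = 4 * √N * l ^ (j + 1) / l ^ j := by field_simp; ring
      _ ≤ 4 * √N * (2 ^ (j + 1) * ((j + 1).factorial * √N)) / l ^ j := by gcongr
      _ = 4 * 2 ^ (j + 1) * (j + 1).factorial * 1 * ((√N * √N) / l ^ j) := by ring
      _ ≤ _ := by rw [ss]; gcongr
  · have l0 : 0 < l := by linarith
    have uY : u 0 ≤ 2 ^ (2 * j + 1) / l ^ (2 * j + 1) := by
      simp only [hu, add_zero]
      rw [← div_pow, ← one_div_pow, ← inv_div l, one_div]
      refine pow_le_pow_left₀ (inv_nonneg.2 (by linarith)) (inv_anti₀ (by positivity) lY) _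
    calc _ ≤ 2 * (C * B * (N * l ^ (j + 1))) * (2 ^ (2 * j + 1) / l ^ (2 * j + 1)) := by gcongr
      _ = _ := by
        have : l ^ (2 * j + 1) = l ^ (j + 1) * l ^ j := by rw [← pow_add]; congr 1; ring
        rw [this]; field_simp

lemma SW_L (j : ℕ) : ∃ C > 0, ∀ {q : ℕ} [NeZero q] {χ : DirichletCharacter ℂ q}, χ ≠ 1 →
    ∀ N : ℕ, 3 ≤ N → ‖∑ n ∈ range N, bL χ n‖ ≤ C * q * (N / log N ^ j) := by
  obtain ⟨C, C0, hC⟩ := sum_bound j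
  obtain ⟨D, D0, hD⟩ := LB_L (2 * (j + 1) - 1)
  refine ⟨C * max D 1, by positivity, fun {q} _ {χ} hχ N hN => ?_⟩
  have q1 : (1:ℝ) ≤ q := by exact_mod_cast NeZero.one_le
  have := hC (bL χ) (bL_bd χ) (max D 1 * q) (one_le_mul_of_one_le_of_one_le (le_max_right _ _) q1) (fun t x hx hx1 => by
    refine (hD hχ t x hx hx1).trans ?_
    rw [Real.mul_rpow (by positivity) (by positivity), ← mul_assoc]
    gcongr
    · exact le_max_left _ _
    · calc (q:ℝ) ^ (1 / 2 : ℝ) ≤ (q:ℝ) ^ (1:ℝ) := rpow_le_rpow_of_exponent_le q1 (by norm_num)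
        _ = q := rpow_one _) N hN
  rwa [← mul_assoc] at this

lemma SW_Z (j : ℕ) : ∃ C > 0, ∀ N : ℕ, 3 ≤ N → ‖∑ n ∈ range N, bZ n‖ ≤ C * (N / log N ^ j) := by
  obtain ⟨C, C0, hC⟩ := sum_bound j
  obtain ⟨D, D0, hD⟩ := LB_Z (2 * (j + 1) - 1)
  refine ⟨C * max D 1, by positivity, fun N hN => ?_⟩
  refine hC bZ bZ_bd (max D 1) (le_max_right _ _) (fun t x hx hx1 => ?_) N hN
  refine (hD t x hx hx1).trans ?_
  gcongr
  exact le_max_left _ _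

lemma ram0 {n : ℕ} (hn : 0 < n) : ∑ i ∈ n.divisors, ∑ ζ ∈ primitiveRoots i ℂ, ζ = if n = 1 then 1 else 0 := by
  classical
  rw [← sum_biUnion (fun i _ j _ h => IsPrimitiveRoot.disjoint h),
    ← IsPrimitiveRoot.nthRoots_one_eq_biUnion_primitiveRoots]
  have h := Complex.isPrimitiveRoot_exp n hn.ne'
  have : NeZero n := ⟨hn.ne'⟩
  set ω := Complex.exp (2 * π * Complex.I / n)
  have e : ∑ ζ ∈ Polynomial.nthRootsFinset n (1:ℂ), ζ = ∑ i ∈ range n, ω ^ i := by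
    symm
    refine sum_nbij (fun i => ω ^ i) ?_ ?_ ?_ (fun _ _ => rfl)
    · intro i _
      rw [Polynomial.mem_nthRootsFinset hn, ← pow_mul, mul_comm, pow_mul, h.pow_eq_one, one_pow]
    · intro i hi j hj hij
      exact h.pow_inj (mem_range.1 hi) (mem_range.1 hj) hij
    · intro ζ hζ
      obtain ⟨i, hi, h2⟩ := h.eq_pow_of_pow_eq_one ((Polynomial.mem_nthRootsFinset hn _).1 hζ)
      exact ⟨i, by simpa using hi, h2⟩
  rw [e]
  split_ifs with h1
  · subst h1; simp
  · exact h.geom_sum_eq_zero (by omega)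

lemma ram {q a : ℕ} (hq : 1 ≤ q) (ha : a.Coprime q) :
    ∑ r ∈ (range q).filter (fun r => r.Coprime q), ee ((a / q : ℝ) * r) = (ArithmeticFunction.moebius q : ℂ) := by
  have : NeZero q := ⟨by omega⟩
  have h := Complex.isPrimitiveRoot_exp_of_coprime a q (by omega) ha
  have H := ArithmeticFunction.sum_eq_iff_sum_mul_moebius_eq.1 (fun n (hn : n > 0) => ram0 hn) q hq
  have m : (q, 1) ∈ q.divisorsAntidiagonal := by simp; omega
  rw [sum_eq_single (q, 1)] at H
  · simp only [if_true, mul_one] at H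
    rw [H]
    refine sum_nbij (fun i => Complex.exp (2 * π * Complex.I * (a / q)) ^ i) ?_ ?_ ?_ ?_
    · intro i hi
      rw [mem_primitiveRoots hq, h.isPrimitiveRoot_iff]
      simp at hi
      exact ⟨i, hi.1, hi.2, rfl⟩
    · intro i hi j hj hij
      simp at hi hj
      exact h.pow_inj hi.1 hj.1 hij
    · intro ζ hζ
      obtain ⟨i, h1, h2, h3⟩ := h.isPrimitiveRoot_iff.1 ((mem_primitiveRoots hq).1 hζ)
      exact ⟨i, mem_coe.2 (mem_filter.2 ⟨mem_range.2 h1, h2⟩), h3⟩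
    · intro i _
      rw [ee, ← Complex.exp_nat_mul]
      push_cast; ring_nf
  · rintro ⟨u, v⟩ h1 h2
    rw [if_neg, mul_zero]
    rintro rfl
    simp at h1
    exact h2 (by rw [h1.1])
  · intro h; exact absurd m h

local notation "Λ" => ArithmeticFunction.vonMangoldt

lemma nc_bd {q y N : ℕ} (hq : 1 ≤ q) (hN : 3 ≤ N) (hy : y ≤ N) :
    ∑ n ∈ (range y).filter (fun n => ¬ n.Coprime q), Λ n ≤ 6 * q * log N ^ 2 := by
  have l1 := one_le_log hN
  set S := (range y).filter (fun n => ¬ n.Coprime q)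
  have e : ∑ n ∈ S, Λ n = ∑ n ∈ S.filter (fun n => Λ n ≠ 0), Λ n := (sum_filter_ne_zero S).symm
  have c : (S.filter (fun n => Λ n ≠ 0)).card ≤ (q + 1) * (Nat.log 2 N + 1) := by
    have : S.filter (fun n => Λ n ≠ 0) ⊆
        ((range (q + 1)) ×ˢ (range (Nat.log 2 N + 1))).image (fun x => x.1 ^ x.2) := by
      intro n hn
      obtain ⟨h1, h2⟩ := mem_filter.1 hn
      obtain ⟨h3, h4⟩ := mem_filter.1 h1
      obtain ⟨p, i, pp, hi, rfl⟩ := ArithmeticFunction.vonMangoldt_ne_zero_iff.1 h2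
      have pp := pp.nat_prime
      have pd : p ∣ q := by
        rw [Nat.coprime_pow_left_iff hi, Nat.Prime.coprime_iff_not_dvd pp, not_not] at h4
        exact h4
      refine mem_image.2 ⟨(p, i), ?_, rfl⟩
      rw [mem_product, mem_range, mem_range]
      refine ⟨by have := Nat.le_of_dvd (by omega) pd; omega, ?_⟩
      refine Nat.lt_succ_of_le (Nat.le_log_of_pow_le (by norm_num) ?_)
      exact ((Nat.pow_le_pow_left pp.two_le i).trans (mem_range.1 h3).le).trans hy
    refine (Finset.card_le_card this).trans (Finset.card_image_le.trans ?_)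
    simp
  have b : ∀ n ∈ S.filter (fun n => Λ n ≠ 0), Λ n ≤ log N := by
    intro n hn
    have h1 := mem_range.1 (mem_filter.1 (mem_filter.1 hn).1).1
    rcases Nat.eq_zero_or_pos n with h | h
    · rw [h, ArithmeticFunction.map_zero]; linarith
    · exact (vM_le n).trans (log_le_log (by exact_mod_cast h) (by exact_mod_cast (by omega)))
  have L : (Nat.log 2 N : ℝ) ≤ 2 * log N := by
    have h1 : (2:ℝ) ^ Nat.log 2 N ≤ N := by exact_mod_cast Nat.pow_log_le_self 2 (by omega)
    have := log_le_log (by positivity) h1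
    rw [log_pow] at this
    have l2 := log_two_gt_d9
    have : (Nat.log 2 N : ℝ) * (1 / 2) ≤ Nat.log 2 N * log 2 := by gcongr; linarith
    linarith
  have q1 : (1:ℝ) ≤ q := by exact_mod_cast hq
  rw [e]
  refine (sum_le_card_nsmul _ _ _ b).trans ?_
  rw [nsmul_eq_mul]
  calc _ ≤ (((q + 1) * (Nat.log 2 N + 1) : ℕ) : ℝ) * log N := by gcongr
    _ ≤ (2 * q) * (3 * log N) * log N := by
      push_cast
      gcongr <;> linarith
    _ = _ := by ring

lemma ylog (j : ℕ) {y N : ℕ} (hy : 3 ≤ y) (hN : y ≤ N) :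
    (y:ℝ) / log y ^ j ≤ 2 ^ j * (1 + j.factorial) * (N / log N ^ j) := by
  have ly := one_le_log hy
  have lN := one_le_log (hy.trans hN)
  have y0 : (0:ℝ) < y := by positivity
  have yN : (y:ℝ) ≤ N := by exact_mod_cast hN
  have N0 : (0:ℝ) < N := by linarith
  have r1 : 1 ≤ (N:ℝ) / y := (one_le_div y0).2 yN
  have e : log N = log y + log (N / y) := by rw [log_div N0.ne' y0.ne']; ring
  have r0 := log_nonneg r1
  have h1 : log N ^ j ≤ 2 ^ j * (log y ^ j + j.factorial * (N / y)) := by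
    rw [e]
    calc _ ≤ (2 * max (log y) (log (N / y))) ^ j := by
          gcongr
          have := le_max_left (log y) (log (N / y))
          have := le_max_right (log y) (log (N / y))
          linarith
      _ = 2 ^ j * (max (log y) (log (N / y))) ^ j := mul_pow _ _ _
      _ ≤ _ := by
        gcongr
        rcases max_cases (log y) (log (N / y)) with h | h <;> rw [h.1]
        · have : 0 ≤ (j.factorial : ℝ) * (N / y) := by positivity
          linarith
        · have := log_pow_le j r1
          have : 0 ≤ log y ^ j := by positivity
          linarith
  rw [← mul_div_assoc, div_le_div_iff₀ (by positivity) (by positivity)]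
  have lj : 1 ≤ log y ^ j := one_le_pow₀ ly
  calc (y:ℝ) * log N ^ j ≤ y * (2 ^ j * (log y ^ j + j.factorial * (N / y))) := by gcongr
    _ = 2 ^ j * (y * log y ^ j + j.factorial * N * 1) := by field_simp
    _ ≤ 2 ^ j * (N * log y ^ j + j.factorial * N * log y ^ j) := by gcongr
    _ = _ := by ring

lemma psi_r (j : ℕ) : ∃ C > 0, ∀ q r N y : ℕ, 1 ≤ q → r.Coprime q → 3 ≤ y → y ≤ N →
    ‖(∑ n ∈ (range y).filter (fun n : ℕ => (r : ZMod q) = n), (Λ n : ℂ)) - y / (q.totient : ℂ)‖ ≤ C * q * (N / log N ^ j) := by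
  obtain ⟨C1, C10, h1⟩ := SW_L j
  obtain ⟨C2, C20, h2⟩ := SW_Z j
  refine ⟨(C1 + C2 + 1) * (2 ^ j * (1 + j.factorial)) + 6 * (j + 2).factorial, by positivity,
    fun q r N y hq hr hy hN => ?_⟩
  have : NeZero q := ⟨by omega⟩
  have q1 : (1:ℝ) ≤ q := by exact_mod_cast hq
  have p0 : 0 < q.totient := Nat.totient_pos.2 hq
  have p1 : (1:ℝ) ≤ q.totient := by exact_mod_cast p0
  have pc : (q.totient : ℂ) ≠ 0 := by exact_mod_cast p0.ne'
  have ru : IsUnit (r : ZMod q) := (ZMod.isUnit_iff_coprime r q).2 hr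
  have riu : IsUnit (r : ZMod q)⁻¹ := IsUnit.of_mul_eq_one _ (ZMod.inv_mul_of_unit _ ru)
  set D := (y:ℝ) / log y ^ j with hD
  have ly := one_le_log hy
  have D0 : 0 ≤ D := by positivity
  set Ψ : ℂ := ∑ n ∈ (range y).filter (fun n : ℕ => (r : ZMod q) = n), (Λ n : ℂ) with hΨ
  have e1 : (q.totient : ℂ) * Ψ = ∑ χ : DirichletCharacter ℂ q, χ (r : ZMod q)⁻¹ * ∑ n ∈ range y, bL χ n := by
    simp_rw [Finset.mul_sum]
    rw [sum_comm, hΨ, Finset.mul_sum, sum_filter]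
    refine sum_congr rfl fun n _ => ?_
    have := DirichletCharacter.sum_char_inv_mul_char_eq ℂ ru (n : ZMod q)
    simp only [bL, ← mul_assoc]
    rw [← sum_mul, this]
    split_ifs <;> simp
  classical
  rw [← Finset.add_sum_erase _ _ (mem_univ (1 : DirichletCharacter ℂ q)), MulChar.one_apply riu, one_mul] at e1
  have t1 : ‖∑ χ ∈ Finset.univ.erase (1 : DirichletCharacter ℂ q), χ (r : ZMod q)⁻¹ * ∑ n ∈ range y, bL χ n‖ ≤
      q.totient * (C1 * q * D) := by
    have := norm_sum_le_of_le (Finset.univ.erase (1 : DirichletCharacter ℂ q))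
      (f := fun χ => χ (r : ZMod q)⁻¹ * ∑ n ∈ range y, bL χ n) (n := fun _ => C1 * q * D) (fun χ hχ => by
        rw [norm_mul]
        refine (mul_le_of_le_one_left (norm_nonneg _) (χ.norm_le_one _)).trans (h1 (Finset.ne_of_mem_erase hχ) y hy))
    refine this.trans ?_
    rw [sum_const, nsmul_eq_mul]
    gcongr
    refine (Finset.card_erase_le).trans (le_of_eq ?_)
    rw [← DirichletCharacter.card_eq_totient_of_hasEnoughRootsOfUnity ℂ q, Nat.card_eq_fintype_card, Finset.card_univ]
  have t2 : ‖(∑ n ∈ range y, bL (1 : DirichletCharacter ℂ q) n) - y‖ ≤ C2 * D + 1 + 6 * q * log N ^ 2 := by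
    have e2 : (∑ n ∈ range y, bL (1 : DirichletCharacter ℂ q) n) - y = (∑ n ∈ range y, bZ n) - 1 -
        ((∑ n ∈ (range y).filter (fun n => ¬ n.Coprime q), Λ n : ℝ) : ℂ) := by
      have : (∑ n ∈ range y, if n = 0 then (0:ℂ) else 1) + 1 = y := by
        obtain ⟨y, rfl⟩ : ∃ z, y = z + 1 := ⟨y - 1, by omega⟩
        rw [Finset.sum_range_succ']
        simp
      rw [← this]
      simp only [bZ, sum_sub_distrib, sum_filter, Complex.ofReal_sum]
      rw [← sub_eq_zero]
      have : ∑ n ∈ range y, bL (1 : DirichletCharacter ℂ q) n = ∑ n ∈ range y, (Λ n : ℂ) -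
          ∑ n ∈ range y, ((if ¬ n.Coprime q then Λ n else 0 : ℝ) : ℂ) := by
        rw [← sum_sub_distrib]
        refine sum_congr rfl fun n _ => ?_
        by_cases h : n.Coprime q
        · simp [bL, h, MulChar.one_apply ((ZMod.isUnit_iff_coprime n q).2 h)]
        · rw [bL, MulChar.map_nonunit _ (fun h' => h ((ZMod.isUnit_iff_coprime n q).1 h'))]; simp [h]
      rw [this]; ring
    rw [e2]
    refine (norm_sub_le _ _).trans (add_le_add ((norm_sub_le _ _).trans (add_le_add (h2 y hy) (by simp))) ?_)
    rw [Complex.norm_real, norm_of_nonneg (sum_nonneg fun _ _ => ArithmeticFunction.vonMangoldt_nonneg)]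
    exact nc_bd hq (hy.trans hN) hN
  have yl := ylog j hy hN
  have l1 := one_le_log (hy.trans hN)
  have N3 : (3:ℝ) ≤ N := by exact_mod_cast (hy.trans hN)
  have ll : log N ^ 2 ≤ (j + 2).factorial * (N / log N ^ j) := by
    rw [← mul_div_assoc, le_div_iff₀ (by positivity), ← pow_add, add_comm 2]
    exact log_pow_le _ (by linarith)
  have D1 : 1 ≤ 2 ^ j * (1 + j.factorial) * (N / log N ^ j) := by
    rw [← mul_div_assoc, one_le_div (by positivity)]
    refine (log_pow_le j (by linarith)).trans ?_
    gcongr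
    have : (1:ℝ) ≤ 2 ^ j := one_le_pow₀ (by norm_num)
    have h3 : (0:ℝ) ≤ j.factorial := by positivity
    nlinarith
  set W := (N:ℝ) / log N ^ j
  have key : (q.totient:ℝ) * ‖Ψ - y / (q.totient : ℂ)‖ ≤ q.totient * (C1 * q * D) + (C2 * D + 1 + 6 * q * log N ^ 2) := by
    have : (q.totient:ℝ) * ‖Ψ - y / (q.totient : ℂ)‖ = ‖(q.totient : ℂ) * (Ψ - y / (q.totient : ℂ))‖ := by
      rw [norm_mul, Complex.norm_natCast]
    rw [this, mul_sub, mul_div_cancel₀ _ pc, e1, add_sub_right_comm, add_comm]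
    exact (norm_add_le _ _).trans (add_le_add t1 t2)
  rw [← mul_le_mul_iff_right₀ (by linarith : (0:ℝ) < q.totient)]
  refine key.trans ?_
  have W0 : 0 ≤ W := by positivity
  set E := (2:ℝ) ^ j * (1 + j.factorial)
  have E0 : 0 ≤ E * W := by linarith
  have z1 : C1 * q * D ≤ C1 * q * (E * W) := by gcongr
  have z2 : C2 * D + 1 + 6 * q * log N ^ 2 ≤ q * ((C2 + 1) * (E * W)) + 6 * q * ((j + 2).factorial * W) := by
    have : C2 * D + 1 ≤ 1 * ((C2 + 1) * (E * W)) := by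
      have : C2 * D ≤ C2 * (E * W) := by gcongr
      linarith
    have h3 : 1 * ((C2 + 1) * (E * W)) ≤ q * ((C2 + 1) * (E * W)) := by gcongr
    have h4 : 6 * q * log N ^ 2 ≤ 6 * q * ((j + 2).factorial * W) := by gcongr
    linarith
  calc _ ≤ q.totient * (C1 * q * (E * W)) + 1 * (q * ((C2 + 1) * (E * W)) + 6 * q * ((j + 2).factorial * W)) := by
        rw [one_mul]; gcongr
    _ ≤ q.totient * (C1 * q * (E * W)) + q.totient * (q * ((C2 + 1) * (E * W)) + 6 * q * ((j + 2).factorial * W)) := by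
        gcongr
    _ = _ := by ring

lemma PD (j : ℕ) : ∃ C > 0, ∀ q a N y : ℕ, 1 ≤ q → a.Coprime q → 3 ≤ N → y ≤ N →
    ‖∑ n ∈ range y, (Λ n * ee ((a / q : ℝ) * n) - (ArithmeticFunction.moebius q : ℂ) / q.totient)‖ ≤
      C * q ^ 2 * (N / log N ^ j) := by
  obtain ⟨C, C0, hC⟩ := psi_r j
  refine ⟨C + 6 * (j + 2).factorial + 2 * j.factorial, by positivity, fun q a N y hq ha hN hy => ?_⟩
  have : NeZero q := ⟨by omega⟩
  have q1 : (1:ℝ) ≤ q := by exact_mod_cast hq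
  have l1 := one_le_log hN
  have p0 : 0 < q.totient := Nat.totient_pos.2 hq
  have p1 : (1:ℝ) ≤ q.totient := by exact_mod_cast p0
  have N3 : (3:ℝ) ≤ N := by exact_mod_cast hN
  have ll : ∀ i, log N ^ i ≤ (j + i).factorial * (N / log N ^ j) := by
    intro i
    rw [← mul_div_assoc, le_div_iff₀ (by positivity), ← pow_add, add_comm i]
    exact log_pow_le _ (by linarith)
  have ll2 := ll 2
  have ll0 := ll 0
  set W := (N:ℝ) / log N ^ j
  have W0 : 0 ≤ W := by positivity
  have q2 : (q:ℝ) ≤ q ^ 2 := by rw [sq]; exact le_mul_of_one_le_left (by linarith) q1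
  rw [sum_sub_distrib, sum_const, Finset.card_range, nsmul_eq_mul]
  have mu1 : ‖(ArithmeticFunction.moebius q : ℂ) / q.totient‖ ≤ 1 := by
    rw [norm_div, Complex.norm_natCast, Complex.norm_intCast]
    refine div_le_one_of_le₀ (le_trans ?_ p1) (by linarith)
    exact_mod_cast ArithmeticFunction.abs_moebius_le_one
  by_cases h3 : 3 ≤ y
  · set S := (range q).filter (fun r => r.Coprime q)
    set F : ℕ → ℂ := fun r => ∑ n ∈ (range y).filter (fun n : ℕ => (r : ZMod q) = n), (Λ n : ℂ) with hF
    have cS : S.card ≤ q := (Finset.card_filter_le _ _).trans (by simp)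
    have sp : ∑ n ∈ range y, Λ n * ee ((a / q : ℝ) * n) = ∑ r ∈ S, ee ((a / q : ℝ) * r) * F r +
        ∑ n ∈ (range y).filter (fun n => ¬ n.Coprime q), Λ n * ee ((a / q : ℝ) * n) := by
      simp only [hF, sum_filter, Finset.mul_sum]
      rw [sum_comm, ← sum_add_distrib]
      refine sum_congr rfl fun n _ => ?_
      have iff : ∀ r ∈ S, ((r : ZMod q) = n ↔ r = n % q) := by
        intro r hr
        have := mem_range.1 (mem_filter.1 hr).1
        rw [ZMod.natCast_eq_natCast_iff', Nat.mod_eq_of_lt this]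
      by_cases h : n.Coprime q
      · have m : n % q ∈ S := by
          refine mem_filter.2 ⟨mem_range.2 (Nat.mod_lt _ hq), ?_⟩
          rw [Nat.Coprime, ← Nat.gcd_rec, Nat.gcd_comm]; exact h
        rw [sum_eq_single_of_mem (n % q) m, if_pos ((iff _ m).2 rfl), if_neg (not_not.2 h), add_zero, mul_comm]
        · congr 1
          have : (a / q : ℝ) * n = (a / q : ℝ) * (n % q : ℕ) + ((a * (n / q : ℕ) : ℤ) : ℝ) := by
            have e : (n:ℝ) = (n % q : ℕ) + q * (n / q : ℕ) := by exact_mod_cast (Nat.mod_add_div n q).symm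
            have e2 : (((a:ℤ) * ((n / q : ℕ) : ℤ) : ℤ) : ℝ) = a * (n / q : ℕ) := by
              generalize n / q = t; push_cast; rfl
            rw [e2]
            generalize n / q = t at *
            rw [e]
            field_simp
          rw [this, ee_add_int]
        · intro r hr hne
          rw [if_neg (fun h => hne ((iff r hr).1 h)), mul_zero]
      · rw [if_pos h, sum_eq_zero, zero_add]
        intro r hr
        rw [if_neg, mul_zero]
        intro h'
        apply h
        have := (iff r hr).1 h'
        have h2 := (mem_filter.1 hr).2
        rw [this, Nat.Coprime, ← Nat.gcd_rec, Nat.gcd_comm] at h2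
        exact h2
    have b1 : ‖∑ n ∈ (range y).filter (fun n => ¬ n.Coprime q), Λ n * ee ((a / q : ℝ) * n)‖ ≤ 6 * q * log N ^ 2 := by
      refine (norm_sum_le_of_le _ fun n _ => ?_).trans (nc_bd hq hN hy)
      rw [norm_mul, norm_ee, mul_one, Complex.norm_real, norm_of_nonneg ArithmeticFunction.vonMangoldt_nonneg]
    have b2 : ‖∑ r ∈ S, ee ((a / q : ℝ) * r) * (F r - y / (q.totient : ℂ))‖ ≤ q * (C * q * W) := by
      have := norm_sum_le_of_le S (f := fun r => ee ((a / q : ℝ) * r) * (F r - y / (q.totient : ℂ))) (n := fun _ => C * q * W) (fun r hr => by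
        rw [norm_mul, norm_ee, one_mul]
        exact hC q r N y hq (mem_filter.1 hr).2 h3 hy)
      refine this.trans ?_
      rw [sum_const, nsmul_eq_mul]
      gcongr
    have e3 : ∑ r ∈ S, ee ((a / q : ℝ) * r) * F r = ∑ r ∈ S, ee ((a / q : ℝ) * r) * (F r - y / (q.totient : ℂ)) +
        y * ((ArithmeticFunction.moebius q : ℂ) / q.totient) := by
      simp_rw [mul_sub]
      rw [sum_sub_distrib, ← sum_mul, ram hq ha]
      ring
    rw [sp, e3, add_right_comm, add_sub_cancel_right]
    refine (norm_add_le _ _).trans ((add_le_add b2 b1).trans ?_)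
    have g1 : 6 * q * log N ^ 2 ≤ 6 * q ^ 2 * ((j + 2).factorial * W) := by gcongr
    have g2 : 0 ≤ 2 * j.factorial * (q:ℝ) ^ 2 * W := by positivity
    have g3 : q * (C * q * W) = C * q ^ 2 * W := by ring
    rw [g3]
    linarith
  · have z : ∑ n ∈ range y, Λ n * ee ((a / q : ℝ) * n) = 0 := by
      refine sum_eq_zero fun n hn => ?_
      have : n = 0 ∨ n = 1 := by have := mem_range.1 hn; omega
      rcases this with rfl | rfl <;> simp
    rw [z, zero_sub, norm_neg, norm_mul, Complex.norm_natCast]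
    have y2 : (y:ℝ) ≤ 2 := by exact_mod_cast (by omega : y ≤ 2)
    have f1 : (1:ℝ) ≤ j.factorial * W := by simpa using ll0
    calc _ ≤ 2 * 1 := mul_le_mul y2 mu1 (norm_nonneg _) (by norm_num)
      _ ≤ 2 * (j.factorial * W) := by linarith
      _ ≤ (C + 6 * (j + 2).factorial + 2 * j.factorial) * 1 * W := by
        have : 0 ≤ (C + 6 * (j + 2).factorial) * W := by positivity
        linarith
      _ ≤ _ := by gcongr; exact one_le_pow₀ q1

def WW (c k : ℕ) (w : ℕ → ℝ) : Prop :=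
  Antitone w ∧ (∀ n, 0 ≤ w n) ∧ ∀ d : ℕ, ∑ i ∈ range (c * d ^ k), w i = d

lemma exists_w {c k : ℕ} (hc : 1 ≤ c) (hk : 1 ≤ k) : ∃ w, WW c k w := by
  have c0 : (0:ℝ) < c := by exact_mod_cast hc
  have k0 : (k:ℝ) ≠ 0 := by positivity
  have k1 : (1:ℝ) ≤ k := by exact_mod_cast hk
  set G : ℕ → ℝ := fun n => ((n:ℝ) / c) ^ ((1:ℝ) / k) with hG
  refine ⟨fun n => G (n + 1) - G n, antitone_nat_of_succ_le fun n => ?_, fun n => ?_, fun d => ?_⟩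
  · obtain ⟨-, this⟩ := Real.concaveOn_rpow (p := 1 / (k:ℝ)) (by positivity) (by rw [div_le_one (by linarith)]; exact k1)
    have := @this ((n:ℝ) / c) (by rw [Set.mem_Ici]; positivity) (((n + 2 : ℕ):ℝ) / c) (by rw [Set.mem_Ici]; positivity) (1 / 2) (1 / 2)
      (by norm_num) (by norm_num) (by norm_num)
    simp only [smul_eq_mul] at this
    have e : 1 / 2 * ((n:ℝ) / c) + 1 / 2 * (((n + 2 : ℕ):ℝ) / c) = ((n + 1 : ℕ):ℝ) / c := by
      push_cast; field_simp; ring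
    rw [e] at this
    simp only [hG]
    linarith
  · rw [sub_nonneg]
    exact rpow_le_rpow (by positivity) (by gcongr; simp) (by positivity)
  · rw [sum_range_sub]
    simp only [hG]
    rw [Nat.cast_zero, zero_div, Real.zero_rpow (by positivity), sub_zero]
    push_cast
    rw [mul_div_cancel_left₀ _ c0.ne', ← rpow_natCast, ← rpow_mul (by positivity), mul_one_div_cancel k0, rpow_one]

lemma w_block {c k : ℕ} {w : ℕ → ℝ} (hw : WW c k w) (d : ℕ) :
    ∑ i ∈ Finset.Ico (c * d ^ k) (c * (d + 1) ^ k), w i = 1 := by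
  rw [sum_Ico_eq_sub _ (by gcongr; omega), hw.2.2, hw.2.2]; push_cast; ring

lemma w_max {c k : ℕ} (hc : 1 ≤ c) (hk : 1 ≤ k) {w : ℕ → ℝ} (hw : WW c k w) {D : ℕ} (hD : 1 ≤ D) :
    w (c * D ^ k) ≤ 1 / (D:ℝ) ^ (k - 1) := by
  obtain ⟨D, rfl⟩ := Nat.exists_eq_add_of_le' hD
  obtain ⟨k, rfl⟩ := Nat.exists_eq_add_of_le' hk
  rw [le_div_iff₀ (by positivity), ← w_block hw D]
  have h := Finset.card_nsmul_le_sum (Finset.Ico (c * D ^ (k + 1)) (c * (D + 1) ^ (k + 1))) w (w (c * (D + 1) ^ (k + 1)))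
    (fun i hi => hw.1 (mem_Ico.1 hi).2.le)
  refine le_trans ?_ h
  rw [nsmul_eq_mul, mul_comm]
  refine mul_le_mul_of_nonneg_right ?_ (hw.2.1 _)
  rw [Nat.card_Ico]
  have : (D + 1) ^ k ≤ c * (D + 1) ^ (k + 1) - c * D ^ (k + 1) := by
    rw [← Nat.mul_sub]
    refine le_trans ?_ (Nat.le_mul_of_pos_left _ hc)
    have : D ^ k ≤ (D + 1) ^ k := by gcongr; omega
    apply Nat.le_sub_of_add_le
    rw [pow_succ, pow_succ]
    nlinarith
  simp only [Nat.add_sub_cancel]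
  exact_mod_cast this

lemma w_abel {c k : ℕ} (hc : 1 ≤ c) (hk : 1 ≤ k) {w : ℕ → ℝ} (hw : WW c k w) {D X : ℕ} (hD : 1 ≤ D) {z : ℕ → ℂ} {E B : ℝ}
    (h1 : ∀ j ≤ X, ‖∑ n ∈ range j, z n‖ ≤ E) (h2 : ∀ n < X, ‖z n‖ ≤ B) (hB : 0 ≤ B) :
    ‖∑ n ∈ range X, z n * w n‖ ≤ D * B + 2 * E / (D:ℝ) ^ (k - 1) := by
  have E0 : 0 ≤ E := (norm_nonneg _).trans (h1 0 (by omega))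
  have hh : ∀ Y ≤ X, Y ≤ c * D ^ k → ‖∑ n ∈ range Y, z n * w n‖ ≤ D * B := by
    intro Y hY hY2
    rw [← hw.2.2 D, sum_mul]
    refine le_trans (norm_sum_le_of_le (f := fun n => z n * (w n:ℂ)) (n := fun n => w n * B) _ fun n hn => ?_) (sum_le_sum_of_subset_of_nonneg (f := fun n => w n * B) (Finset.range_mono hY2) fun i _ _ => mul_nonneg (hw.2.1 i) hB)
    rw [norm_mul, Complex.norm_real, norm_of_nonneg (hw.2.1 n), mul_comm]
    exact mul_le_mul_of_nonneg_left (h2 n (by have := mem_range.1 hn; omega)) (hw.2.1 n)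
  rcases le_total X (c * D ^ k) with h | h
  · have := hh X le_rfl h
    have : 0 ≤ 2 * E / (D:ℝ) ^ (k - 1) := by positivity
    linarith
  · obtain ⟨Z, rfl⟩ := Nat.exists_eq_add_of_le h
    rw [sum_range_add]
    refine (norm_add_le _ _).trans (add_le_add (hh _ h le_rfl) ?_)
    have := abel_mono (z := fun n => z (c * D ^ k + n)) (u := fun n => w (c * D ^ k + n)) (N := Z) (E := 2 * E) (fun j hj => ?_)
      (fun i => hw.1 (by omega)) (fun i => hw.2.1 _)
    · refine this.trans ?_
      rw [div_eq_mul_one_div (2 * E)]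
      exact mul_le_mul_of_nonneg_left (w_max hc hk hw hD) (by positivity)
    · have e := sum_range_add z (c * D ^ k) j
      rw [show ∑ n ∈ range j, z (c * D ^ k + n) = ∑ n ∈ range (c * D ^ k + j), z n - ∑ n ∈ range (c * D ^ k), z n by rw [e]; ring]
      refine (norm_sub_le _ _).trans ?_
      linarith [h1 _ h, h1 (c * D ^ k + j) (by omega)]

/-- smearing: compare a sum over d with a weighted sum. -/
lemma w_smear {c k : ℕ} (hk : 1 ≤ k) {w : ℕ → ℝ} (hw : WW c k w) {M : ℕ} {g : ℕ → ℂ} {L : ℝ} (hL : 0 ≤ L)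
    (hg : ∀ i j : ℕ, ‖g i - g j‖ ≤ L * |(i:ℝ) - j|) :
    ‖∑ d ∈ range M, g (c * d ^ k) - ∑ m ∈ range (c * M ^ k), g m * w m‖ ≤ L * (c * M ^ k : ℕ) := by
  have key : ∀ M, ‖∑ d ∈ range M, g (c * d ^ k) - ∑ m ∈ Finset.Ico (c * 0 ^ k) (c * M ^ k), g m * w m‖ ≤ L * ((c * M ^ k : ℕ) - (c * 0 ^ k : ℕ)) := by
    intro M
    induction M with
    | zero => simp
    | succ M ih =>
      have l1 : c * 0 ^ k ≤ c * M ^ k := by gcongr; omega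
      have l2 : c * M ^ k ≤ c * (M + 1) ^ k := by gcongr; omega
      rw [sum_range_succ, ← sum_Ico_consecutive _ l1 l2]
      have e : g (c * M ^ k) = ∑ m ∈ Finset.Ico (c * M ^ k) (c * (M + 1) ^ k), g (c * M ^ k) * w m := by
        rw [← Finset.mul_sum]
        have := w_block hw M
        have h2 : ∑ m ∈ Finset.Ico (c * M ^ k) (c * (M + 1) ^ k), (w m : ℂ) = 1 := by rw [← Complex.ofReal_sum, this]; simp
        rw [h2, mul_one]
      have b : ‖g (c * M ^ k) - ∑ m ∈ Finset.Ico (c * M ^ k) (c * (M + 1) ^ k), g m * w m‖ ≤ L * ((c * (M + 1) ^ k : ℕ) - (c * M ^ k : ℕ)) := by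
        rw [e, ← sum_sub_distrib]
        have : L * ((c * (M + 1) ^ k : ℕ) - (c * M ^ k : ℕ)) = ∑ m ∈ Finset.Ico (c * M ^ k) (c * (M + 1) ^ k), L * ((c * (M + 1) ^ k : ℕ) - (c * M ^ k : ℕ)) * w m := by
          rw [← Finset.mul_sum, w_block hw M, mul_one]
        rw [this]
        refine norm_sum_le_of_le _ fun m hm => ?_
        rw [← sub_mul, norm_mul, Complex.norm_real, norm_of_nonneg (hw.2.1 m)]
        refine mul_le_mul_of_nonneg_right ((hg _ _).trans (mul_le_mul_of_nonneg_left ?_ hL)) (hw.2.1 m)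
        obtain ⟨h1, h2⟩ := mem_Ico.1 hm
        have h1 : ((c * M ^ k : ℕ):ℝ) ≤ m := by exact_mod_cast h1
        have h2 : (m:ℝ) ≤ (c * (M + 1) ^ k : ℕ) := by exact_mod_cast h2.le
        rw [abs_le]; constructor <;> linarith
      calc _ = ‖(∑ d ∈ range M, g (c * d ^ k) - ∑ m ∈ Finset.Ico (c * 0 ^ k) (c * M ^ k), g m * w m) + (g (c * M ^ k) - ∑ m ∈ Finset.Ico (c * M ^ k) (c * (M + 1) ^ k), g m * w m)‖ := by congr 1; ring
        _ ≤ _ := (norm_add_le _ _).trans (add_le_add ih b)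
        _ = _ := by ring
  have := key M
  rw [zero_pow (by omega : k ≠ 0), mul_zero, ← Finset.range_eq_Ico, Nat.cast_zero, sub_zero] at this
  exact this

lemma w_hat {c k : ℕ} (hc : 1 ≤ c) (hk : 1 ≤ k) {w : ℕ → ℝ} (hw : WW c k w) {D : ℕ} (X : ℕ) (hD : 1 ≤ D) {b β : ℝ} (hb : 0 < b)
    (h : ∀ m : ℤ, b ≤ |β - m|) : ‖∑ m ∈ range X, ee (m * β) * w m‖ ≤ D + 1 / b / (D:ℝ) ^ (k - 1) := by
  have := w_abel hc hk hw (X := X) hD (fun j _ => geom_ee_le β hb h j) (fun n _ => (norm_ee (n * β)).le) zero_le_one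
  refine this.trans (le_of_eq ?_)
  rw [mul_one]; congr 2; field_simp

lemma poly_err (f : Polynomial ℤ) (k : ℕ) (hk : 1 ≤ k) (hdeg : f.natDegree = k) :
    ∃ C : ℝ, 0 < C ∧ ∀ M d : ℕ, d ≤ M → 1 ≤ M → |((f.eval (d:ℤ) : ℤ) : ℝ) - f.leadingCoeff * (d:ℝ) ^ k| ≤ C * (M:ℝ) ^ (k - 1) := by
  refine ⟨∑ i ∈ range k, |(f.coeff i : ℝ)| + 1, by positivity, fun M d hd hM => ?_⟩
  have M1 : (1:ℝ) ≤ M := by exact_mod_cast hM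
  have dM : (d:ℝ) ≤ M := by exact_mod_cast hd
  rw [Polynomial.eval_eq_sum_range, hdeg, sum_range_succ, Polynomial.leadingCoeff, hdeg]
  push_cast
  rw [add_sub_cancel_right, add_mul, sum_mul]
  refine (Finset.abs_sum_le_sum_abs _ _).trans (le_trans (sum_le_sum fun i hi => ?_) (le_add_of_nonneg_right (by positivity)))
  rw [abs_mul, abs_of_nonneg (by positivity : (0:ℝ) ≤ d ^ i)]
  have := mem_range.1 hi
  gcongr
  calc (d:ℝ) ^ i ≤ M ^ i := by gcongr
    _ ≤ _ := pow_le_pow_right₀ M1 (by omega)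

lemma pz (f : Polynomial ℤ) (a : ℤ) (q : ℕ) (hq : 1 ≤ q) (j : ℕ) :
    ‖Saq f a q / q‖ ≤ 1 ∧ ‖∑ n ∈ range j, (ee ((a / q : ℝ) * (f.eval (n:ℤ) : ℤ)) - Saq f a q / q)‖ ≤ 2 * q := by
  have q0 : (0:ℝ) < q := by exact_mod_cast hq
  have qc : (q:ℂ) ≠ 0 := by exact_mod_cast q0.ne'
  have h1 : ‖Saq f a q / q‖ ≤ 1 := by
    rw [norm_div, Complex.norm_natCast, div_le_one q0, Saq_eq]
    refine (norm_sum_le _ _).trans ?_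
    simp [norm_ee]
  refine ⟨h1, ?_⟩
  set g : ℕ → ℂ := fun n => ee ((a / q : ℝ) * (f.eval (n:ℤ) : ℤ)) - Saq f a q / q with hg
  have hp : ∀ n j, g (q * j + n) = g n := fun n j => by simp only [hg]; rw [ee_per f a q hq n j]
  have hz : ∑ n ∈ range q, g n = 0 := by
    simp only [hg]
    rw [sum_sub_distrib, ← Saq_eq]; simp; field_simp; simp
  rw [← Nat.div_add_mod j q, sum_range_add, sum_per hp, hz, mul_zero, zero_add]
  have : ∀ n ∈ range (j % q), ‖g (q * (j / q) + n)‖ ≤ 2 := fun n _ => by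
    rw [hp]; refine (norm_sub_le _ _).trans ?_
    rw [norm_ee]; linarith
  refine (norm_sum_le_of_le _ this).trans ?_
  have h2 : ((j % q : ℕ) : ℝ) ≤ q := by exact_mod_cast (Nat.mod_lt j hq).le
  rw [sum_const, Finset.card_range, nsmul_eq_mul]; linarith

lemma major (f : Polynomial ℤ) {c k : ℕ} (hk : 1 ≤ k) (hdeg : f.natDegree = k) (hlc : f.leadingCoeff = c)
    {w : ℕ → ℝ} (hw : WW c k w) : ∃ C : ℝ, 0 < C ∧ ∀ q : ℕ, 1 ≤ q → ∀ a : ℤ, ∀ M : ℕ, 1 ≤ M → ∀ P β : ℝ, 1 ≤ P → |β| ≤ P / M ^ k →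
      ‖∑ d ∈ range M, ee ((a / q + β) * (f.eval (d:ℤ) : ℤ)) - Saq f a q / q * ∑ m ∈ range (c * M ^ k), ee (m * β) * w m‖ ≤ C * q * P := by
  obtain ⟨Cf, Cf0, hf⟩ := poly_err f k hk hdeg
  refine ⟨2 * π * Cf + 2 + 6 * π * c, by positivity, fun q hq a M hM P β hP hβ => ?_⟩
  have M0 : (0:ℝ) < M := by exact_mod_cast hM
  have q1 : (1:ℝ) ≤ q := by exact_mod_cast hq
  rw [le_div_iff₀ (by positivity)] at hβ
  set s := Saq f a q / q
  set E : ℕ → ℂ := fun d => ee ((a / q : ℝ) * (f.eval (d:ℤ) : ℤ))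
  set g : ℕ → ℂ := fun m => ee (m * β) with hg
  have hgL : ∀ i j : ℕ, ‖g i - g j‖ ≤ (2 * π * |β|) * |(i:ℝ) - j| := fun i j => by
    refine (ee_sub_le _ _).trans (le_of_eq ?_)
    rw [← sub_mul, abs_mul]; ring
  have e : ∑ d ∈ range M, ee ((a / q + β) * (f.eval (d:ℤ) : ℤ)) - s * ∑ m ∈ range (c * M ^ k), g m * w m
      = ∑ d ∈ range M, (ee ((a / q + β) * (f.eval (d:ℤ) : ℤ)) - E d * g (c * d ^ k)) + ∑ d ∈ range M, (E d - s) * g (c * d ^ k) +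
        s * (∑ d ∈ range M, g (c * d ^ k) - ∑ m ∈ range (c * M ^ k), g m * w m) := by
    simp only [sub_mul, sum_sub_distrib, mul_sub, Finset.mul_sum]; ring
  rw [e]
  have b1 : ‖∑ d ∈ range M, (ee ((a / q + β) * (f.eval (d:ℤ) : ℤ)) - E d * g (c * d ^ k))‖ ≤ 2 * π * Cf * P := by
    have : ∀ d ∈ range M, ‖ee ((a / q + β) * (f.eval (d:ℤ) : ℤ)) - E d * g (c * d ^ k)‖ ≤ 2 * π * (|β| * (Cf * M ^ (k - 1))) := fun d hd => by
      rw [add_mul, ee_add, ← mul_sub, norm_mul, norm_ee, one_mul]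
      refine (ee_sub_le _ _).trans ?_
      rw [mul_comm ((c * d ^ k : ℕ):ℝ) β, ← mul_sub, abs_mul]
      have := hf M d (mem_range.1 hd).le hM
      rw [hlc] at this
      push_cast at this ⊢
      gcongr
    refine (norm_sum_le_of_le _ this).trans ?_
    rw [sum_const, Finset.card_range, nsmul_eq_mul]
    calc _ = 2 * π * Cf * (|β| * (M ^ (k - 1) * M)) := by ring
      _ ≤ _ := by rw [← pow_succ, Nat.sub_add_cancel hk]; gcongr
  have b2 : ‖∑ d ∈ range M, (E d - s) * g (c * d ^ k)‖ ≤ 2 * q * (1 + 2 * π * c * P) := by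
    refine (abel_bd (g := fun d => g (c * d ^ k)) (E := 2 * q) fun j _ => (pz f a q hq j).2).trans ?_
    refine mul_le_mul_of_nonneg_left (add_le_add (norm_ee _).le ?_) (by positivity)
    have : ∀ i ∈ range (M - 1), ‖g (c * (i + 1) ^ k) - g (c * i ^ k)‖ ≤ 2 * π * |β| * c * (((i + 1 : ℕ):ℝ) ^ k - (i:ℝ) ^ k) := fun i _ => by
      refine (hgL _ _).trans (le_of_eq ?_)
      have h : ((c * i ^ k : ℕ):ℝ) ≤ (c * (i + 1) ^ k : ℕ) := by exact_mod_cast Nat.mul_le_mul_left c (Nat.pow_le_pow_left (by omega) k)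
      rw [abs_of_nonneg (sub_nonneg.2 h)]
      push_cast; ring
    refine (sum_le_sum this).trans ?_
    rw [← Finset.mul_sum, sum_range_sub (fun i : ℕ => (i:ℝ) ^ k)]
    calc _ ≤ 2 * π * |β| * c * (M:ℝ) ^ k := by
          refine mul_le_mul_of_nonneg_left ?_ (by positivity)
          have : ((M - 1 : ℕ) : ℝ) ^ k ≤ M ^ k := by gcongr; omega
          have : (0:ℝ) ≤ ((0:ℕ):ℝ) ^ k := by positivity
          linarith
      _ = 2 * π * c * (|β| * M ^ k) := by ring
      _ ≤ _ := by gcongr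
  have b3 : ‖s * (∑ d ∈ range M, g (c * d ^ k) - ∑ m ∈ range (c * M ^ k), g m * w m)‖ ≤ 2 * π * c * P := by
    rw [norm_mul]
    refine (mul_le_of_le_one_left (norm_nonneg _) (pz f a q hq 0).1).trans ((w_smear hk hw (by positivity) hgL).trans ?_)
    push_cast
    calc _ = 2 * π * c * (|β| * M ^ k) := by ring
      _ ≤ _ := by gcongr
  refine (norm_add₃_le).trans ((add_le_add (add_le_add b1 b2) b3).trans ?_)
  have h1 : P ≤ q * P := le_mul_of_one_le_left (by linarith) q1
  have h2 : (q:ℝ) ≤ q * P := le_mul_of_one_le_right (by linarith) hP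
  have := mul_le_mul_of_nonneg_left h1 (by positivity : 0 ≤ 2 * π * Cf + 2 * π * c)
  linarith

lemma red (b : ℤ) (n : ℕ) (hn : 1 ≤ n) : ∃ q a : ℕ, ∃ z : ℤ, 1 ≤ q ∧ q ≤ n ∧ a < q ∧ a.Coprime q ∧ (b:ℝ) / n = a / q + z := by
  set x : ℚ := (b:ℚ) / n with hx
  have d0 : (0:ℤ) < x.den := by exact_mod_cast x.pos
  have hdvd : (x.den : ℤ) ∣ n := by rw [hx]; exact_mod_cast Rat.den_dvd b n
  have a0 := Int.emod_nonneg x.num d0.ne'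
  have e := Int.toNat_of_nonneg a0
  refine ⟨x.den, (x.num % x.den).toNat, x.num / x.den, x.pos, Nat.le_of_dvd hn (by exact_mod_cast hdvd), ?_, ?_, ?_⟩
  · zify; rw [e]; exact Int.emod_lt_of_pos _ d0
  · have h := x.reduced
    rw [← Nat.isCoprime_iff_coprime, e]
    have h2 : IsCoprime x.num (x.den:ℤ) := by rw [Int.isCoprime_iff_gcd_eq_one]; exact h
    rw [← Int.emod_add_mul_ediv x.num x.den] at h2
    exact (IsCoprime.add_mul_left_left_iff).1 h2
  · have h1 : ((b:ℝ) / n) = ((x:ℚ):ℝ) := by rw [hx]; push_cast; rfl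
    have h2 : ((x:ℚ):ℝ) = x.num / x.den := by exact_mod_cast (Rat.num_div_den x).symm
    have h3 : (((x.num % x.den).toNat : ℕ):ℝ) = ((x.num % x.den : ℤ):ℝ) := by exact_mod_cast e
    have h4 : (x.num:ℝ) = ((x.num % x.den : ℤ):ℝ) + x.den * ((x.num / x.den : ℤ) : ℝ) := by exact_mod_cast (Int.emod_add_mul_ediv x.num x.den).symm
    have h5 : (x.den:ℝ) ≠ 0 := by exact_mod_cast d0.ne'
    rw [h1, h2, h3, h4, add_div, mul_div_cancel_left₀ _ h5]

lemma sep {q a q' a' : ℕ} {z z' : ℤ} (h1 : a < q) (h2 : a.Coprime q) (h3 : a' < q') (h4 : a'.Coprime q')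
    (h : ¬ (q' = q ∧ a' = a)) : 1 / ((q:ℝ) * q') ≤ |((a:ℝ) / q + z) - (a' / q' + z')| := by
  have q0 : (0:ℝ) < q := by exact_mod_cast (by omega : 0 < q)
  have q0' : (0:ℝ) < q' := by exact_mod_cast (by omega : 0 < q')
  have e : ((a:ℝ) / q + z) - (a' / q' + z') = (((a + z * q) * q' - (a' + z' * q') * q : ℤ):ℝ) / (q * q') := by
    push_cast; field_simp
  rw [e, abs_div, abs_of_pos (by positivity : (0:ℝ) < q * q')]
  gcongr
  have : ((a:ℤ) + z * q) * q' - (a' + z' * q') * q ≠ 0 := by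
    intro h0
    have c1 : IsCoprime ((a:ℤ) + z * q) q := (IsCoprime.add_mul_right_left_iff).2 (Nat.isCoprime_iff_coprime.2 h2)
    have c2 : IsCoprime ((a':ℤ) + z' * q') q' := (IsCoprime.add_mul_right_left_iff).2 (Nat.isCoprime_iff_coprime.2 h4)
    have d1 : (q:ℤ) ∣ q' := c1.symm.dvd_of_dvd_mul_left ⟨a' + z' * q', by linarith⟩
    have d2 : (q':ℤ) ∣ q := c2.symm.dvd_of_dvd_mul_left ⟨a + z * q, by linarith⟩
    have e : q = q' := Nat.dvd_antisymm (by exact_mod_cast d1) (by exact_mod_cast d2)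
    subst e
    have h5 : (a:ℤ) + z * q = a' + z' * q := by
      have : (q:ℤ) ≠ 0 := by omega
      apply mul_right_cancel₀ this; linarith
    have h6 := congrArg (fun t : ℤ => t % q) h5
    simp only [Int.add_mul_emod_self_right] at h6
    rw [Int.emod_eq_of_lt (by omega) (by omega), Int.emod_eq_of_lt (by omega) (by omega)] at h6
    exact h ⟨rfl, by omega⟩
  exact_mod_cast Int.one_le_abs this

def II (Q : ℕ) : Finset (Σ _ : ℕ, ℕ) := (range (Q + 1)).sigma fun q => (range q).filter fun a => Nat.Coprime a q

lemma II_mem {Q : ℕ} {x : Σ _ : ℕ, ℕ} : x ∈ II Q ↔ x.1 ≤ Q ∧ x.2 < x.1 ∧ x.2.Coprime x.1 := by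
  simp [II, Nat.lt_succ_iff]

lemma II_card {Q : ℕ} (hQ : 1 ≤ Q) : ((II Q).card : ℝ) ≤ 2 * Q ^ 2 := by
  have : (II Q).card ≤ (Q + 1) * Q := by
    rw [II, Finset.card_sigma]
    refine (sum_le_card_nsmul _ _ Q fun q hq => ?_).trans (by simp)
    have := mem_range.1 hq
    exact (Finset.card_filter_le _ _).trans (by simp; omega)
  have h : ((II Q).card : ℝ) ≤ (Q + 1) * Q := by exact_mod_cast this
  have : (1:ℝ) ≤ Q := by exact_mod_cast hQ
  nlinarith

noncomputable def Fh (f : Polynomial ℤ) (M : ℕ) (α : ℝ) : ℂ := ∑ d ∈ range M, ee (α * (f.eval (d:ℤ) : ℤ))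
noncomputable def Th (w : ℕ → ℝ) (X : ℕ) (α : ℝ) : ℂ := ∑ m ∈ range X, ee (m * α) * w m

lemma Fh_add (f : Polynomial ℤ) (M : ℕ) (α : ℝ) (z : ℤ) : Fh f M (α + z) = Fh f M α := by
  refine sum_congr rfl fun d _ => ?_
  rw [add_mul, ← Int.cast_mul, ee_add_int]

lemma Th_add (w : ℕ → ℝ) (X : ℕ) (α : ℝ) (z : ℤ) : Th w X (α + z) = Th w X α := by
  refine sum_congr rfl fun d _ => ?_
  rw [mul_add, ← Int.cast_natCast, ← Int.cast_mul, ee_add_int]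

lemma supF (f : Polynomial ℤ) {c k : ℕ} (hc : 1 ≤ c) (hk : 1 ≤ k) (hdeg : f.natDegree = k) (hlc : f.leadingCoeff = c)
    {w : ℕ → ℝ} (hw : WW c k w) : ∃ C0 : ℕ, ∃ C : ℝ, 0 < C ∧ ∀ K : ℝ, 2 ≤ K → ∀ Q M : ℕ, (k.factorial * c) * K ^ C0 ≤ Q →
      (2 * K * Q ^ 2) ^ (k + 1) ≤ (M:ℝ) → ∀ α : ℝ,
      ‖Fh f M α - ∑ x ∈ II Q, Saq f x.2 x.1 / x.1 * Th w (c * M ^ k) (α - x.2 / x.1)‖ ≤ C * (M / K) := by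
  obtain ⟨C0, h0⟩ := weyl_poly f k hk hdeg
  obtain ⟨C1, C10, h1⟩ := major f hk hdeg hlc hw
  refine ⟨C0, C1 + 4, by positivity, fun K hK Q M hQ hM α => ?_⟩
  have kc : (1:ℝ) ≤ k.factorial * c := by exact_mod_cast Nat.mul_pos (Nat.factorial_pos k) hc
  have K1 : (1:ℝ) ≤ K ^ C0 := one_le_pow₀ (by linarith)
  have Q0 : K ^ C0 ≤ Q := (le_mul_of_one_le_left (by linarith) kc).trans hQ
  have Q1 : (1:ℝ) ≤ Q := K1.trans Q0
  have Q1' : 1 ≤ Q := by exact_mod_cast Q1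
  have Q2 : (1:ℝ) ≤ Q ^ 2 := one_le_pow₀ Q1
  set H := 2 * K * (Q:ℝ) ^ 2 with hH
  have f1 : (Q:ℝ) ≤ Q ^ 2 := le_self_pow₀ Q1 two_ne_zero
  have f2 : (Q:ℝ) ^ 2 ≤ K * Q ^ 2 := le_mul_of_one_le_left (by positivity) (by linarith)
  have H1 : 1 ≤ H := by rw [hH]; linarith
  have HH : H * H ^ k ≤ M := by rw [← pow_succ']; exact hM
  have Hk : H ≤ H ^ k := le_self_pow₀ H1 (by omega)
  have HM : H ≤ M := by nlinarith
  have M1 : (1:ℝ) ≤ M := H1.trans HM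
  have M1' : 1 ≤ M := by exact_mod_cast M1
  have MMk : (M:ℝ) ≤ M ^ k := le_self_pow₀ M1 (by omega)
  have KQ : 0 < K * (Q:ℝ) ^ 2 := by positivity
  obtain ⟨D, D1, D2, D3⟩ : ∃ D : ℕ, 1 ≤ D ∧ (D:ℝ) ≤ M / (K * Q ^ 2) ∧ (M:ℝ) / H ≤ D := by
    have h1 : 1 ≤ (M:ℝ) / (K * Q ^ 2) := by rw [one_le_div KQ]; linarith
    refine ⟨⌊(M:ℝ) / (K * Q ^ 2)⌋₊, Nat.le_floor (by simpa using h1), Nat.floor_le (by positivity), ?_⟩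
    have h2 := Nat.lt_floor_add_one ((M:ℝ) / (K * Q ^ 2))
    have h3 : (1:ℝ) ≤ ⌊(M:ℝ) / (K * Q ^ 2)⌋₊ := by exact_mod_cast Nat.le_floor (by simpa using h1)
    have : (M:ℝ) / H = (M / (K * Q ^ 2)) / 2 := by rw [hH]; field_simp
    rw [this]; linarith
  have tb : ∀ β b : ℝ, 0 < b → (∀ z : ℤ, b ≤ |β - z|) → ‖Th w (c * M ^ k) β‖ ≤ M / (K * Q ^ 2) + 1 / b * (H ^ (k - 1) / M ^ (k - 1)) := by
    intro β b hb h
    refine (w_hat hc hk hw (c * M ^ k) D1 hb h).trans (add_le_add D2 ?_)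
    rw [div_eq_mul_one_div]
    have : 1 / (D:ℝ) ^ (k - 1) ≤ H ^ (k - 1) / M ^ (k - 1) := by
      rw [← div_pow, ← one_div_pow]
      refine pow_le_pow_left₀ (by positivity) ?_ _
      rw [← one_div_div (M:ℝ) H]
      exact one_div_le_one_div_of_le (by positivity) D3
    gcongr
  have sb : ∀ (S : Finset (Σ _ : ℕ, ℕ)) (b : ℝ), S ⊆ II Q → 0 < b → (∀ x ∈ S, ∀ z : ℤ, b ≤ |α - x.2 / x.1 - z|) →
      2 * Q ^ 2 * (1 / b * (H ^ (k - 1) / M ^ (k - 1))) ≤ M / K →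
      ‖∑ x ∈ S, Saq f x.2 x.1 / x.1 * Th w (c * M ^ k) (α - x.2 / x.1)‖ ≤ 3 * (M / K) := by
    intro S b hS hb h hh
    have : ∀ x ∈ S, ‖Saq f x.2 x.1 / x.1 * Th w (c * M ^ k) (α - x.2 / x.1)‖ ≤ M / (K * Q ^ 2) + 1 / b * (H ^ (k - 1) / M ^ (k - 1)) := by
      intro x hx
      have hx1 := II_mem.1 (hS hx)
      rw [norm_mul]
      refine (mul_le_of_le_one_left (norm_nonneg _) (pz f x.2 x.1 (by omega) 0).1).trans (tb _ b hb (h x hx))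
    refine (norm_sum_le_of_le _ this).trans ?_
    rw [sum_const, nsmul_eq_mul]
    have hc : (S.card : ℝ) ≤ 2 * Q ^ 2 := le_trans (by exact_mod_cast Finset.card_le_card hS) (II_card Q1')
    refine (mul_le_mul_of_nonneg_right hc (by positivity)).trans ?_
    have : 2 * (Q:ℝ) ^ 2 * (M / (K * Q ^ 2)) = 2 * (M / K) := by field_simp
    rw [mul_add, this]; linarith
  have MK : 0 ≤ M / K := by positivity
  have Hs : H ^ k = H * H ^ (k - 1) := by rw [← pow_succ', Nat.sub_add_cancel hk]
  have Ms : (M:ℝ) ^ k = M * M ^ (k - 1) := by rw [← pow_succ', Nat.sub_add_cancel hk]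
  by_cases hcase : ∃ x ∈ II Q, ∃ z : ℤ, |α - x.2 / x.1 - z| ≤ H ^ k / M ^ k
  · obtain ⟨x, hx, z, hz⟩ := hcase
    have hx1 := II_mem.1 hx
    have xq : (1:ℝ) ≤ x.1 := by exact_mod_cast (by omega : 1 ≤ x.1)
    have xQ : (x.1:ℝ) ≤ Q := by exact_mod_cast hx1.1
    rw [← Finset.add_sum_erase _ _ hx, ← sub_sub]
    refine (norm_sub_le _ _).trans ?_
    have b1 := h1 x.1 (by omega) x.2 M M1' (H ^ k) (α - x.2 / x.1 - z) (one_le_pow₀ H1) hz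
    have e1 : Fh f M α = ∑ d ∈ range M, ee (((x.2:ℤ) / x.1 + (α - x.2 / x.1 - z)) * (f.eval (d:ℤ) : ℤ)) := by
      rw [← Fh_add f M α (-z)]
      refine sum_congr rfl fun d _ => ?_
      congr 1; push_cast; ring
    have e2 : Th w (c * M ^ k) (α - x.2 / x.1) = ∑ m ∈ range (c * M ^ k), ee (m * (α - x.2 / x.1 - z)) * w m := by
      rw [← Th_add w _ (α - x.2 / x.1) (-z)]
      refine sum_congr rfl fun d _ => ?_
      congr 2; push_cast; ring
    rw [← e1, ← e2] at b1
    have b2 := sb ((II Q).erase x) (1 / (2 * Q ^ 2)) (Finset.erase_subset _ _) (by positivity) ?_ ?_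
    · have : C1 * x.1 * H ^ k ≤ C1 * (M / K) := by
        rw [mul_assoc]
        refine mul_le_mul_of_nonneg_left ?_ C10.le
        rw [le_div_iff₀ (by linarith)]
        calc (x.1:ℝ) * H ^ k * K = (K * x.1) * H ^ k := by ring
          _ ≤ H * H ^ k := by
            refine mul_le_mul_of_nonneg_right ?_ (by positivity)
            have : K * (x.1:ℝ) ≤ K * Q ^ 2 := mul_le_mul_of_nonneg_left (xQ.trans f1) (by linarith)
            rw [hH]; linarith
          _ ≤ M := HH
      linarith
    · intro y hy z'
      obtain ⟨hy1, hy2⟩ := mem_erase.1 hy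
      have hy3 := II_mem.1 hy2
      have yq : (1:ℝ) ≤ y.1 := by exact_mod_cast (by omega : 1 ≤ y.1)
      have yQ : (y.1:ℝ) ≤ Q := by exact_mod_cast hy3.1
      have s := sep (z := z) (z' := z') hx1.2.1 hx1.2.2 hy3.2.1 hy3.2.2 (by
        rintro ⟨u, v⟩; exact hy1 (Sigma.ext u (heq_of_eq v)))
      have s2 : 1 / (Q:ℝ) ^ 2 ≤ 1 / ((x.1:ℝ) * y.1) := by
        rw [sq]; gcongr
      have s3 : H ^ k / (M:ℝ) ^ k ≤ 1 / (2 * Q ^ 2) := by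
        rw [div_le_div_iff₀ (by positivity) (by positivity), one_mul]
        refine le_trans ?_ (HH.trans MMk)
        rw [mul_comm H]
        gcongr
        rw [hH]; linarith
      have e : 1 / (Q:ℝ) ^ 2 = 1 / (2 * Q ^ 2) + 1 / (2 * Q ^ 2) := by field_simp; norm_num
      have t := abs_sub_le ((x.2:ℝ) / x.1 + z) α (y.2 / y.1 + z')
      rw [abs_sub_comm _ α, ← sub_sub α, ← sub_sub α] at t
      linarith
    · rw [one_div_one_div, ← mul_assoc, mul_div_assoc', div_le_div_iff₀ (by positivity) (by linarith), ← Ms]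
      refine le_trans ?_ (HH.trans MMk)
      have g : 4 * K * ((Q:ℝ) ^ 2) ^ 2 ≤ H * H := by
        have := mul_le_mul_of_nonneg_left f2 KQ.le
        rw [hH]; nlinarith
      rw [Hs]
      calc _ = 4 * K * ((Q:ℝ) ^ 2) ^ 2 * H ^ (k - 1) := by ring
        _ ≤ H * H * H ^ (k - 1) := mul_le_mul_of_nonneg_right g (by positivity)
        _ = _ := by ring
  · push Not at hcase
    have b1 : ‖Fh f M α‖ ≤ M / K := by
      by_contra hcon
      push Not at hcon
      obtain ⟨q, q1, q2, b, hb⟩ := h0 K hK M M1' α M le_rfl hcon.le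
      have n1 : 1 ≤ q * (k.factorial * c) := Nat.mul_pos q1 (Nat.mul_pos (Nat.factorial_pos k) hc)
      obtain ⟨q', a, z, r1, r2, r3, r4, r5⟩ := red b (q * (k.factorial * c)) n1
      have n2 : ((q * (k.factorial * c) : ℕ) : ℝ) ≤ Q := by
        refine le_trans ?_ hQ
        push_cast; rw [mul_comm]; gcongr
      have := hcase ⟨q', a⟩ (II_mem.2 ⟨r2.trans (by exact_mod_cast n2), r3, r4⟩) z
      simp only at this
      rw [sub_sub, ← r5] at this
      refine absurd this (not_lt.2 ?_)
      have n3 : (1:ℝ) ≤ (q * (k.factorial * c) : ℕ) := by exact_mod_cast n1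
      have e : α - b / (q * (k.factorial * c) : ℕ) = (q * ((k.factorial * f.leadingCoeff : ℤ) * α) - b) / (q * (k.factorial * c) : ℕ) := by
        rw [hlc]; field_simp; push_cast; ring
      rw [e, abs_div, abs_of_nonneg (a := (((q * (k.factorial * c) : ℕ) : ℝ))) (by positivity)]
      refine (div_le_self (abs_nonneg _) n3).trans (hb.trans ?_)
      gcongr
      refine le_trans ?_ Hk
      rw [hH]; linarith
    have b2 := sb (II Q) (H ^ k / M ^ k) subset_rfl (by positivity) (fun x hx z => (hcase x hx z).le) ?_
    · refine (norm_sub_le _ _).trans ?_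
      have := mul_nonneg C10.le MK
      linarith
    · refine le_of_eq ?_
      rw [Hs, Ms, hH]
      have : H ^ (k-1) ≠ 0 := by positivity
      field_simp


noncomputable def rr (u : ℕ → ℝ) (n : ℕ) (m : ℤ) : ℝ :=
  ∑ x ∈ range n, ∑ y ∈ range n, if (x:ℤ) - y = m then u x * u y else 0

lemma orth {L : ℕ} {v : ℤ} (h : |v| < L) : ∑ j ∈ range L, ee (j / L * v) = if v = 0 then (L:ℂ) else 0 := by
  have L0 : (0:ℝ) < L := by
    have : (0:ℤ) < L := (abs_nonneg v).trans_lt h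
    exact_mod_cast this
  split_ifs with hv
  · simp [hv, ee_zero]
  · have e : ∀ j : ℕ, ee (j / L * v) = ee (v / L) ^ j := fun j => by
      rw [ee, ee, ← Complex.exp_nat_mul]; congr 1; push_cast; ring
    simp_rw [e]
    have h1 : ee (v / L) ≠ 1 := by
      rw [ee, Ne, Complex.exp_eq_one_iff]
      rintro ⟨m, hm⟩
      have h2 : (v:ℝ) / L = m := by
        have : ((2 * π : ℝ) : ℂ) * Complex.I ≠ 0 := mul_ne_zero (by exact_mod_cast two_pi_pos.ne') Complex.I_ne_zero
        have h3 : (((v:ℝ) / L : ℝ) : ℂ) = ((m:ℝ):ℂ) := by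
          apply mul_left_cancel₀ this
          rw [Complex.ofReal_mul] at hm
          push_cast at hm ⊢
          linear_combination hm
        exact_mod_cast h3
      rw [div_eq_iff L0.ne'] at h2
      have h4 : v = m * L := by exact_mod_cast h2
      rw [h4, abs_mul, Nat.abs_cast] at h
      have : m ≠ 0 := by rintro rfl; simp at h4; exact hv h4
      have := Int.one_le_abs this
      nlinarith
    rw [geom_sum_eq h1, ← e, div_self L0.ne'.symm.symm, one_mul, ee_int, sub_self, zero_div]

noncomputable def UU (u : ℕ → ℝ) (n : ℕ) (α : ℝ) : ℂ := ∑ y ∈ range n, u y * ee (α * y)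

lemma rr_fourier (u : ℕ → ℝ) {n L : ℕ} {m : ℤ} (h : |m| + n ≤ L) :
    (L:ℂ) * rr u n m = ∑ j ∈ range L, ee (j / L * m) * ((‖UU u n (j / L)‖ ^ 2 : ℝ) : ℂ) := by
  have e : ∀ j : ℕ, ee (j / L * m) * ((‖UU u n (j / L)‖ ^ 2 : ℝ) : ℂ) =
      ∑ x ∈ range n, ∑ y ∈ range n, (u x * u y : ℂ) * ee (j / L * ((m - x + y : ℤ) : ℝ)) := by
    intro j
    rw [Complex.ofReal_pow, ← Complex.conj_mul', UU, map_sum, sum_mul_sum, Finset.mul_sum]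
    refine sum_congr rfl fun x _ => ?_
    rw [Finset.mul_sum]
    refine sum_congr rfl fun y _ => ?_
    rw [map_mul, Complex.conj_ofReal, ← ee_neg, show (j / L * ((m - x + y : ℤ) : ℝ) : ℝ) = j / L * m + (-(j / L * x) + j / L * y) by push_cast; ring, ee_add, ee_add]
    ring
  simp_rw [e]
  rw [sum_comm, rr, Complex.ofReal_sum, Finset.mul_sum]
  refine sum_congr rfl fun x hx => ?_
  rw [sum_comm, Complex.ofReal_sum, Finset.mul_sum]
  refine sum_congr rfl fun y hy => ?_
  have := mem_range.1 hx
  have := mem_range.1 hy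
  rw [← Finset.mul_sum, orth (by rw [abs_lt]; have := abs_le.1 (le_refl |m|); constructor <;> omega)]
  by_cases h : (x:ℤ) - y = m
  · rw [if_pos h, if_pos (by omega)]; push_cast; ring
  · rw [if_neg h, if_neg (by omega)]; simp

lemma dual {ι : Type} (T : Finset ι) (b : ι → ℂ) (g : ι → ℤ) (u : ℕ → ℝ) (n : ℕ) {E : ℝ}
    (h : ∀ α : ℝ, ‖∑ t ∈ T, b t * ee (α * g t)‖ ≤ E) :
    ‖∑ t ∈ T, b t * (rr u n (g t) : ℂ)‖ ≤ E * ∑ x ∈ range n, u x ^ 2 := by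
  set L : ℕ := n + 1 + ∑ t ∈ T, (g t).natAbs with hL
  have L0 : (0:ℝ) < L := by rw [hL]; positivity
  have r0 : (L:ℂ) * rr u n 0 = ∑ j ∈ range L, ee (j / L * (0:ℤ)) * ((‖UU u n (j / L)‖ ^ 2 : ℝ) : ℂ) := rr_fourier u (by simp; omega)
  have r1 : rr u n 0 = ∑ x ∈ range n, u x ^ 2 := by
    refine sum_congr rfl fun x hx => ?_
    rw [sum_eq_single_of_mem x hx, if_pos (by omega), sq]
    intro y _ hy
    rw [if_neg (by omega)]
  rw [← r1]
  have r2 : (L:ℝ) * rr u n 0 = ∑ j ∈ range L, ‖UU u n (j / L)‖ ^ 2 := by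
    simp only [Int.cast_zero, mul_zero, ee_zero, one_mul] at r0
    exact_mod_cast r0
  have r3 : (L:ℂ) * ∑ t ∈ T, b t * (rr u n (g t) : ℂ) = ∑ j ∈ range L, (∑ t ∈ T, b t * ee (j / L * g t)) * ((‖UU u n (j / L)‖ ^ 2 : ℝ) : ℂ) := by
    simp_rw [sum_mul]
    rw [sum_comm, Finset.mul_sum]
    refine sum_congr rfl fun t ht => ?_
    have : (g t).natAbs ≤ ∑ t ∈ T, (g t).natAbs := Finset.single_le_sum (f := fun t => (g t).natAbs) (fun _ _ => Nat.zero_le _) ht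
    rw [mul_left_comm, rr_fourier u (L := L) (by rw [Int.abs_eq_natAbs]; omega), Finset.mul_sum]
    exact sum_congr rfl fun j _ => by ring
  have r4 : (L:ℝ) * ‖∑ t ∈ T, b t * (rr u n (g t) : ℂ)‖ ≤ L * (E * rr u n 0) := by
    rw [← Complex.norm_natCast, ← norm_mul, r3, Complex.norm_natCast, mul_left_comm, r2, Finset.mul_sum]
    refine norm_sum_le_of_le _ fun j _ => ?_
    rw [norm_mul, Complex.norm_real, norm_of_nonneg (by positivity)]
    exact mul_le_mul_of_nonneg_right (h _) (by positivity)
  exact le_of_mul_le_mul_left r4 L0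

lemma LamN_eq (N : ℕ) (v : ℤ) : LamN N v = ∑ y ∈ range (N + 1), if v = y then Λ y else 0 := by
  rw [LamN]
  split_ifs with h
  · rw [sum_eq_single_of_mem v.toNat (mem_range.2 (by omega)), if_pos (by omega)]
    intro y _ hy
    rw [if_neg (by omega)]
  · symm
    refine sum_eq_zero fun y hy => ?_
    have := mem_range.1 hy
    split_ifs with h2
    · have : y = 0 := by omega
      rw [this]; simp
    · rfl

lemma Rf_eq (f : Polynomial ℤ) (k N : ℕ) : Rf f k N = ∑ d ∈ Icc 1 (Mf f k N), rr Λ (N + 1) (f.eval (d:ℤ)) := by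
  refine sum_congr rfl fun d _ => ?_
  rw [tsum_eq_sum (s := (range (N + 1)).map Nat.castEmbedding), sum_map, rr]
  · refine sum_congr rfl fun x hx => ?_
    have : LamN N (x:ℤ) = Λ x := by
      rw [LamN_eq, sum_eq_single_of_mem x hx, if_pos rfl]
      intro y _ hy
      rw [if_neg (by omega)]
    rw [Nat.castEmbedding_apply, this, LamN_eq, Finset.mul_sum]
    refine sum_congr rfl fun y _ => ?_
    rw [mul_ite, mul_zero]
    refine if_congr (by omega) rfl rfl
  · intro v hv
    rw [LamN, if_neg, zero_mul]
    rintro ⟨h1, h2⟩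
    exact hv (mem_map.2 ⟨v.toNat, mem_range.2 (by omega), by simp; omega⟩)


lemma inner_bd {c k : ℕ} (hc : 1 ≤ c) (hk : 1 ≤ k) {w : ℕ → ℝ} (hw : WW c k w) {A B : ℕ → ℂ} {ρ : ℂ} {ε l : ℝ} {n M D : ℕ} (hD : 1 ≤ D)
    (hA : ∀ y ≤ n, ‖∑ x ∈ range y, (A x - ρ)‖ ≤ ε) (hB : ∀ y ≤ n, ‖∑ x ∈ range y, (B x - ρ)‖ ≤ ε)
    (lA : ∀ x < n, ‖A x‖ ≤ l) (lB : ∀ x < n, ‖B x‖ ≤ l) (hρ : ‖ρ‖ ≤ 1) (hl : 1 ≤ l) :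
    ‖∑ m ∈ range (c * M ^ k), w m * ∑ y ∈ range (n - m), A (y + m) * B y -
      ρ ^ 2 * ∑ m ∈ range (c * M ^ k), (w m : ℂ) * (n - m : ℕ)‖ ≤ n * (l * (D * (2 * l) + 2 * (2 * ε) / (D:ℝ) ^ (k - 1))) + M * ε := by
  set X := c * M ^ k with hX
  have ε0 : 0 ≤ ε := (norm_nonneg _).trans (hA 0 (by omega))
  have e1 : ∑ m ∈ range X, ∑ y ∈ range (n - m), (w m : ℂ) * ((A (y + m) - ρ) * B y) =
      ∑ y ∈ range n, B y * ∑ m ∈ range (min X (n - y)), (A (y + m) - ρ) * w m := by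
    rw [Finset.sum_comm' (t' := range n) (s' := fun y => range (min X (n - y))) (fun m y => by simp only [mem_range]; omega)]
    refine sum_congr rfl fun y _ => ?_
    rw [Finset.mul_sum]
    exact sum_congr rfl fun m _ => by ring
  have e2 : ∑ m ∈ range X, w m * ∑ y ∈ range (n - m), A (y + m) * B y - ρ ^ 2 * ∑ m ∈ range X, (w m : ℂ) * (n - m : ℕ)
      = ∑ m ∈ range X, ∑ y ∈ range (n - m), (w m : ℂ) * ((A (y + m) - ρ) * B y) +
        ρ * ∑ m ∈ range X, w m * ∑ y ∈ range (n - m), (B y - ρ) := by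
    simp only [Finset.mul_sum]
    rw [← sum_sub_distrib, ← sum_add_distrib]
    refine sum_congr rfl fun m _ => ?_
    rw [← sum_add_distrib, show ρ ^ 2 * ((w m : ℂ) * (n - m : ℕ)) = ∑ y ∈ range (n - m), ρ ^ 2 * w m by simp; ring, ← sum_sub_distrib]
    exact sum_congr rfl fun y _ => by ring
  rw [e2, e1]
  refine (norm_add_le _ _).trans (add_le_add ?_ ?_)
  · refine (norm_sum_le_of_le (n := fun _ => l * (D * (2 * l) + 2 * (2 * ε) / (D:ℝ) ^ (k - 1))) _ fun y hy => ?_).trans (by simp)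
    have hy := mem_range.1 hy
    rw [norm_mul]
    refine mul_le_mul (lB y hy) ?_ (norm_nonneg _) (by linarith)
    refine w_abel hc hk hw hD (fun j hj => ?_) (fun m hm => (norm_sub_le _ _).trans (by linarith [lA (y + m) (by omega)])) (by linarith)
    have e := sum_range_add (fun x => A x - ρ) y j
    rw [show ∑ m ∈ range j, (A (y + m) - ρ) = ∑ m ∈ range (y + j), (A m - ρ) - ∑ m ∈ range y, (A m - ρ) by rw [e]; ring]
    exact (norm_sub_le _ _).trans (by linarith [hA (y + j) (by omega), hA y hy.le])
  · rw [norm_mul]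
    refine (mul_le_of_le_one_left (norm_nonneg _) hρ).trans ?_
    rw [← hw.2.2 M, sum_mul]
    refine norm_sum_le_of_le _ fun m _ => ?_
    rw [norm_mul, Complex.norm_real, norm_of_nonneg (hw.2.1 m)]
    exact mul_le_mul_of_nonneg_left (hB _ (by omega)) (hw.2.1 m)

lemma rr_nat (u : ℕ → ℝ) (n m : ℕ) : rr u n m = ∑ y ∈ range (n - m), u (y + m) * u y := by
  have : ∀ y ∈ range n, ∑ x ∈ range n, (if (x:ℤ) - y = (m:ℤ) then u x * u y else 0) = if y ∈ range (n - m) then u (y + m) * u y else 0 := by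
    intro y hy
    split_ifs with h
    · rw [sum_eq_single_of_mem (y + m) (by rw [mem_range] at *; omega), if_pos (by push_cast; ring)]
      intro x _ hx
      rw [if_neg (by omega)]
    · refine sum_eq_zero fun x hx => ?_
      rw [mem_range] at *
      rw [if_neg (by omega)]
  rw [rr, sum_comm, sum_congr rfl this, sum_ite_mem]
  congr 1
  ext; simp

lemma J_bd (j : ℕ) : ∃ C > 0, ∀ {c k : ℕ}, 1 ≤ c → 1 ≤ k → ∀ {w : ℕ → ℝ}, WW c k w → ∀ q a n M D : ℕ, 1 ≤ q → a.Coprime q → 3 ≤ n → 1 ≤ D →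
    ‖∑ m ∈ range (c * M ^ k), w m * ee (-(m * (a / q : ℝ))) * rr Λ n m - ((ArithmeticFunction.moebius q : ℂ) / q.totient) ^ 2 * ∑ m ∈ range (c * M ^ k), (w m : ℂ) * (n - m : ℕ)‖
    ≤ n * (log n * (D * (2 * log n) + 2 * (2 * (C * q ^ 2 * (n / log n ^ j))) / (D:ℝ) ^ (k - 1))) + M * (C * q ^ 2 * (n / log n ^ j)) := by
  obtain ⟨C, C0, hC⟩ := PD j
  refine ⟨C, C0, fun {c k} hc hk {w} hw q a n M D hq ha hn hD => ?_⟩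
  have l1 := one_le_log hn
  have lv : ∀ x < n, ∀ y : ℝ, ‖(Λ x : ℂ) * ee y‖ ≤ log n := by
    intro x hx y
    rw [norm_mul, norm_ee, mul_one, Complex.norm_real, norm_of_nonneg ArithmeticFunction.vonMangoldt_nonneg]
    rcases Nat.eq_zero_or_pos x with h | h
    · rw [h, ArithmeticFunction.map_zero]; linarith
    · exact (vM_le x).trans (log_le_log (by exact_mod_cast h) (by exact_mod_cast hx.le))
  have p1 : (1:ℝ) ≤ q.totient := by exact_mod_cast Nat.totient_pos.2 hq
  have mu1 : ‖(ArithmeticFunction.moebius q : ℂ) / q.totient‖ ≤ 1 := by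
    rw [norm_div, Complex.norm_natCast, Complex.norm_intCast]
    refine div_le_one_of_le₀ (le_trans ?_ p1) (by linarith)
    exact_mod_cast ArithmeticFunction.abs_moebius_le_one
  have := inner_bd (A := fun x => (Λ x : ℂ) * ee (-((a / q : ℝ) * x))) (B := fun x => (Λ x : ℂ) * ee ((a / q : ℝ) * x)) (M := M) hc hk hw hD (fun y hy => ?_) (fun y hy => hC q a n y hq ha hn hy)
    (fun x hx => lv x hx _) (fun x hx => lv x hx _) mu1 l1
  · convert this using 4
    rename_i m _
    rw [rr_nat, mul_assoc]
    congr 1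
    push_cast
    rw [Finset.mul_sum]
    refine sum_congr rfl fun y _ => ?_
    rw [show -((m:ℝ) * (a / q : ℝ)) = -((a / q : ℝ) * ((y:ℝ) + m)) + (a / q : ℝ) * y by ring, ee_add]
    ring
  · have := hC q a n y hq ha hn hy
    rw [← Complex.norm_conj, map_sum] at this
    refine le_trans (le_of_eq ?_) this
    congr 1
    refine sum_congr rfl fun x _ => ?_
    rw [map_sub, map_mul, map_div₀, ee_neg]
    simp


lemma pw1 {x : ℝ} (hx : 0 ≤ x) (k : ℕ) : x ^ (k + 1) + (k + 1) * x ^ k ≤ (x + 1) ^ (k + 1) := by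
  induction k with
  | zero => simp
  | succ k ih =>
    rw [pow_succ (x + 1)]
    refine le_trans ?_ (mul_le_mul_of_nonneg_right ih (by linarith))
    have : 0 ≤ (k + 1) * x ^ k := by positivity
    push_cast
    nlinarith [pow_succ x k, pow_succ x (k + 1)]

lemma pw2 {x : ℝ} (hx : 0 ≤ x) (k : ℕ) : (x + 1) ^ (k + 1) ≤ x ^ (k + 1) + (k + 1) * (x + 1) ^ k := by
  induction k with
  | zero => simp
  | succ k ih =>
    have h := mul_le_mul_of_nonneg_left ih hx
    have : 0 ≤ (k + 1) * (x + 1) ^ k := by positivity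
    push_cast
    nlinarith [pow_succ (x + 1) k, pow_succ (x + 1) (k + 1), pow_succ x (k + 1)]

lemma sum_pow_bd (k M : ℕ) : |∑ d ∈ range M, (d:ℝ) ^ k - (M:ℝ) ^ (k + 1) / (k + 1)| ≤ (M:ℝ) ^ k := by
  have h1 : ∑ d ∈ range M, (d:ℝ) ^ k ≤ (M:ℝ) ^ (k + 1) / (k + 1) := by
    induction M with
    | zero => simp
    | succ M ih =>
      rw [sum_range_succ, le_div_iff₀ (by positivity)]
      rw [le_div_iff₀ (by positivity)] at ih
      have := pw1 (Nat.cast_nonneg (α := ℝ) M) k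
      push_cast; linarith
  have h2 : (M:ℝ) ^ (k + 1) / (k + 1) ≤ ∑ d ∈ range M, (d:ℝ) ^ k + (M:ℝ) ^ k := by
    clear h1
    induction M with
    | zero => simp
    | succ M ih =>
      rw [sum_range_succ, div_le_iff₀ (by positivity)]
      rw [div_le_iff₀ (by positivity)] at ih
      have := pw2 (Nat.cast_nonneg (α := ℝ) M) k
      push_cast; linarith
  rw [abs_le]
  constructor
  · linarith
  · have : (0:ℝ) ≤ (M:ℝ) ^ k := by positivity
    linarith

lemma W_main {c k : ℕ} (hk : 1 ≤ k) {w : ℕ → ℝ} (hw : WW c k w) {N M : ℕ} {y : ℝ} (hy : 1 ≤ y) (hyN : y ≤ N) (hcy : c * y ^ k = N)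
    (h1 : (M:ℝ) ≤ y) (h2 : y ≤ M + 1) :
    |∑ m ∈ range (c * M ^ k), w m * ((N + 1 - m : ℕ):ℝ) - k / (k + 1) * (N * y)| ≤ 5 * (N + 1 : ℕ) := by
  have cM : (c:ℝ) * M ^ k ≤ N := by rw [← hcy]; gcongr
  have cM' : c * M ^ k ≤ N := by exact_mod_cast cM
  have s := w_smear hk hw (M := M) (g := fun m => (((N + 1 : ℕ) - m : ℝ) : ℂ)) (L := 1) zero_le_one (fun i j => by
    rw [← Complex.ofReal_sub, Complex.norm_real, norm_eq_abs, one_mul, abs_sub_comm]; ring_nf; rfl)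
  have e : ∑ m ∈ range (c * M ^ k), w m * ((N + 1 - m : ℕ):ℝ) = ∑ m ∈ range (c * M ^ k), ((N + 1 : ℕ) - m : ℝ) * w m := by
    refine sum_congr rfl fun m hm => ?_
    have := mem_range.1 hm
    rw [Nat.cast_sub (by omega), mul_comm]
  rw [e]
  have s : |∑ d ∈ range M, ((N + 1 : ℕ) - (c * d ^ k : ℕ) : ℝ) - ∑ m ∈ range (c * M ^ k), ((N + 1 : ℕ) - m : ℝ) * w m| ≤ 1 * (c * M ^ k : ℕ) := by
    rw [← norm_eq_abs, ← Complex.norm_real]; push_cast at s ⊢; exact s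
  have e2 : ∑ d ∈ range M, ((N + 1 : ℕ) - (c * d ^ k : ℕ) : ℝ) = (N + 1) * M - c * ∑ d ∈ range M, (d:ℝ) ^ k := by
    rw [sum_sub_distrib, Finset.mul_sum]; push_cast; simp; ring
  rw [e2] at s
  have p := sum_pow_bd k M
  have c0 : (0:ℝ) ≤ c := Nat.cast_nonneg c
  have k1 : (0:ℝ) < k + 1 := by positivity
  have p' : |(c:ℝ) * ∑ d ∈ range M, (d:ℝ) ^ k - c * ((M:ℝ) ^ (k + 1) / (k + 1))| ≤ N := by
    rw [← mul_sub, abs_mul, abs_of_nonneg c0]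
    exact (mul_le_mul_of_nonneg_left p c0).trans cM
  have t1 : (c:ℝ) * ((M:ℝ) ^ (k + 1) / (k + 1)) ≤ N * y / (k + 1) := by
    rw [← mul_div_assoc]
    refine div_le_div_of_nonneg_right ?_ k1.le
    rw [← hcy, mul_assoc, ← pow_succ]; gcongr
  have t2 : N * y / (k + 1) ≤ (c:ℝ) * ((M:ℝ) ^ (k + 1) / (k + 1)) + N := by
    have := pw2 (by linarith : 0 ≤ y - 1) k
    rw [sub_add_cancel] at this
    have h3 : (y - 1) ^ (k + 1) ≤ (M:ℝ) ^ (k + 1) := pow_le_pow_left₀ (by linarith) (by linarith) _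
    rw [div_le_iff₀ k1, add_mul, mul_assoc, div_mul_cancel₀ _ k1.ne']
    have := mul_le_mul_of_nonneg_left (this.trans (add_le_add_left h3 _)) c0
    rw [← hcy]
    calc _ = (c:ℝ) * y ^ (k + 1) := by ring
      _ ≤ _ := this
      _ = _ := by ring
  have t3 : (k:ℝ) / (k + 1) * (N * y) = N * y - N * y / (k + 1) := by field_simp; ring
  rw [t3]
  have N0 : (0:ℝ) ≤ N := Nat.cast_nonneg N
  have t4 : N * y - N ≤ N * M := by nlinarith
  have t5 : N * (M:ℝ) ≤ N * y := by gcongr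
  push_cast at s ⊢
  rw [abs_le] at s p' ⊢
  constructor <;> nlinarith


lemma sumsq_bd {n : ℕ} (hn : 3 ≤ n) : ∑ x ∈ range n, (Λ x : ℝ) ^ 2 ≤ n * log n ^ 2 := by
  have l1 := one_le_log hn
  refine (sum_le_card_nsmul _ _ (log n ^ 2) fun x hx => ?_).trans (by simp)
  refine pow_le_pow_left₀ ArithmeticFunction.vonMangoldt_nonneg ?_ 2
  rcases Nat.eq_zero_or_pos x with h | h
  · rw [h, ArithmeticFunction.map_zero]; linarith
  · exact (vM_le x).trans (log_le_log (by exact_mod_cast h) (by exact_mod_cast (mem_range.1 hx).le))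

lemma rr_bd {n : ℕ} (hn : 3 ≤ n) (m : ℤ) : ‖(rr Λ n m : ℂ)‖ ≤ n * log n ^ 2 := by
  have := dual (E := 1) {()} (fun _ => 1) (fun _ => m) Λ n (fun α => by simp [norm_ee])
  simp only [sum_singleton, one_mul] at this
  exact this.trans (sumsq_bd hn)

set_option maxHeartbeats 600000 in
lemma pre (f : Polynomial ℤ) {c k : ℕ} (hc : 1 ≤ c) (hk : 1 ≤ k) (hdeg : f.natDegree = k) (hlead : 0 < f.leadingCoeff) (hlc : f.leadingCoeff = c)
    {w : ℕ → ℝ} (hw : WW c k w) : ∃ C0 : ℕ, ∃ c0 : ℝ, 0 < c0 ∧ ∀ j : ℕ, ∃ C : ℝ, 0 < C ∧ ∀ K : ℝ, 2 ≤ K → ∀ Q M D n : ℕ,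
      (k.factorial * c) * K ^ C0 ≤ Q → (2 * K * Q ^ 2) ^ (k + 1) ≤ (M:ℝ) → 3 ≤ n → 1 ≤ D →
      ‖∑ d ∈ Icc 1 M, (rr Λ n (f.eval (d:ℤ)) : ℂ) - SingSeries f * ∑ m ∈ range (c * M ^ k), (w m : ℂ) * (n - m : ℕ)‖ ≤
      C * (n * log n ^ 2 + M / K * (n * log n ^ 2) + Q ^ 2 * (n * (log n * (D * log n + Q ^ 2 * (n / log n ^ j) / (D:ℝ) ^ (k - 1))) + M * (Q ^ 2 * (n / log n ^ j))) + (Q:ℝ) ^ (-c0) * (n * M)) := by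
  obtain ⟨C0, C1, C10, h1⟩ := supF f hc hk hdeg hlc hw
  obtain ⟨C3, C30, c0, c00, h3⟩ := SS_tail f k hk hdeg hlead
  refine ⟨C0, c0, c00, fun j => ?_⟩
  obtain ⟨C2, C20, h2⟩ := J_bd j
  refine ⟨2 + C1 + 4 + 8 * C2 + C3, by positivity, fun K hK Q M D n hQ hM hn hD => ?_⟩
  set l := log n with hl
  have l1 : 1 ≤ l := one_le_log hn
  set W : ℂ := ∑ m ∈ range (c * M ^ k), (w m : ℂ) * (n - m : ℕ) with hW
  set Z : ℝ := n / l ^ j with hZ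
  have Z0 : 0 ≤ Z := by positivity
  have kc : (1:ℝ) ≤ k.factorial * c := by exact_mod_cast Nat.mul_pos (Nat.factorial_pos k) hc
  have Q1 : (1:ℝ) ≤ Q := le_trans (by nlinarith [one_le_pow₀ (n := C0) (by linarith : (1:ℝ) ≤ K)]) hQ
  have Q1' : 1 ≤ Q := by exact_mod_cast Q1
  set r : ℕ → ℂ := fun d => (rr Λ n (f.eval (d:ℤ)) : ℂ) with hr
  set J : (Σ _ : ℕ, ℕ) → ℂ := fun x => ∑ m ∈ range (c * M ^ k), w m * ee (-(m * (x.2 / x.1 : ℝ))) * rr Λ n m with hJ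
  set ρ : ℕ → ℂ := fun q => (ArithmeticFunction.moebius q : ℂ) / q.totient with hρ
  have e1 : ‖∑ d ∈ Icc 1 M, r d - ∑ d ∈ range M, r d‖ ≤ 2 * (n * l ^ 2) := by
    have a1 := sum_range_succ r M
    have a2 := Finset.sum_range_succ' r M
    have a3 : ∑ d ∈ Icc 1 M, r d = ∑ d ∈ range M, r (d + 1) := by
      rw [← Finset.Ico_succ_right_eq_Icc, sum_Ico_eq_sum_range]; simp [add_comm]
    rw [show ∑ d ∈ Icc 1 M, r d - ∑ d ∈ range M, r d = r M - r 0 by rw [a3]; linear_combination a1 - a2]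
    exact (norm_sub_le _ _).trans (by linarith [rr_bd hn (f.eval (M:ℤ)), rr_bd hn (f.eval ((0:ℕ):ℤ))])
  have e2 : ‖∑ d ∈ range M, r d - ∑ x ∈ II Q, Saq f x.2 x.1 / x.1 * J x‖ ≤ C1 * (M / K) * (n * l ^ 2) := by
    have := dual (E := C1 * (M / K)) ((range M).disjSum ((II Q) ×ˢ range (c * M ^ k)))
      (Sum.elim (fun _ => 1) (fun p => -(Saq f p.1.2 p.1.1 / p.1.1 * (w p.2 * ee (-(p.2 * (p.1.2 / p.1.1 : ℝ)))))))
      (Sum.elim (fun d => f.eval (d:ℤ)) (fun p => (p.2:ℤ))) Λ n (fun α => by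
        refine le_trans (le_of_eq ?_) (h1 K hK Q M hQ hM α)
        rw [sum_disjSum, sum_product, sub_eq_add_neg, ← sum_neg_distrib]
        congr 2
        · refine sum_congr rfl fun d _ => ?_
          simp
        · refine sum_congr rfl fun x _ => ?_
          rw [Th, Finset.mul_sum, ← sum_neg_distrib]
          refine sum_congr rfl fun m _ => ?_
          simp only [Sum.elim_inr, Int.cast_natCast]
          rw [show (m:ℝ) * (α - x.2 / x.1) = -(m * (x.2 / x.1 : ℝ)) + α * m by ring, ee_add]
          ring)
    refine le_trans (le_of_eq ?_) (this.trans (mul_le_mul_of_nonneg_left (sumsq_bd hn) (by positivity)))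
    rw [sum_disjSum, sum_product, sub_eq_add_neg, ← sum_neg_distrib]
    congr 2
    · refine sum_congr rfl fun d _ => ?_
      simp [hr]
    · refine sum_congr rfl fun x _ => ?_
      rw [hJ, Finset.mul_sum, ← sum_neg_distrib]
      refine sum_congr rfl fun m _ => ?_
      simp only [Sum.elim_inr]
      ring
  set T : ℝ := n * (l * (D * l + Q ^ 2 * Z / (D:ℝ) ^ (k - 1))) + M * (Q ^ 2 * Z) with hT
  have T0 : 0 ≤ T := by positivity
  have e3 : ‖∑ x ∈ II Q, Saq f x.2 x.1 / x.1 * J x - ∑ x ∈ II Q, Saq f x.2 x.1 / x.1 * (ρ x.1 ^ 2 * W)‖ ≤ 2 * Q ^ 2 * ((2 + 4 * C2) * T) := by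
    rw [← sum_sub_distrib]
    have : ∀ x ∈ II Q, ‖Saq f x.2 x.1 / x.1 * J x - Saq f x.2 x.1 / x.1 * (ρ x.1 ^ 2 * W)‖ ≤ (2 + 4 * C2) * T := by
      intro x hx
      have hx1 := II_mem.1 hx
      have xQ : (x.1:ℝ) ≤ Q := by exact_mod_cast hx1.1
      rw [← mul_sub, norm_mul]
      refine (mul_le_of_le_one_left (norm_nonneg _) (pz f x.2 x.1 (by omega) 0).1).trans ?_
      refine (h2 hc hk hw x.1 x.2 n M D (by omega) hx1.2.2 hn hD).trans ?_
      have q2 : (x.1:ℝ) ^ 2 * Z ≤ Q ^ 2 * Z := by gcongr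
      have n0 : (0:ℝ) ≤ n := by positivity
      calc _ ≤ n * (l * (D * (2 * l) + 4 * C2 * (Q ^ 2 * Z) / (D:ℝ) ^ (k - 1))) + M * (C2 * (Q ^ 2 * Z)) := by
            gcongr n * (l * (D * (2 * l) + ?_ / (D:ℝ) ^ (k - 1))) + M * ?_
            · nlinarith
            · nlinarith
        _ = 2 * (n * (l * (D * l))) + 4 * C2 * (n * (l * (Q ^ 2 * Z / (D:ℝ) ^ (k - 1)))) + C2 * (M * (Q ^ 2 * Z)) := by ring
        _ ≤ (2 + 4 * C2) * (n * (l * (D * l)) + n * (l * (Q ^ 2 * Z / (D:ℝ) ^ (k - 1))) + M * (Q ^ 2 * Z)) := by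
            have a1 : 0 ≤ n * (l * (D * l)) := by positivity
            have a2 : 0 ≤ n * (l * (Q ^ 2 * Z / (D:ℝ) ^ (k - 1))) := by positivity
            have a3 : 0 ≤ M * (Q ^ 2 * Z) := by positivity
            nlinarith [mul_nonneg C20.le a1, mul_nonneg C20.le a3]
        _ = _ := by rw [hT]; ring
    refine (norm_sum_le_of_le _ this).trans ?_
    rw [sum_const, nsmul_eq_mul]
    exact mul_le_mul_of_nonneg_right (II_card Q1') (by positivity)
  have e4 : ∀ V : ℂ, ∑ x ∈ II Q, Saq f x.2 x.1 / x.1 * (ρ x.1 ^ 2 * V) = (∑ q ∈ range (Q + 1), sterm f q) * V := by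
    intro V
    rw [II, sum_sigma, sum_mul]
    refine sum_congr rfl fun q _ => ?_
    rw [sterm, Finset.mul_sum, sum_mul]
    refine sum_congr rfl fun a _ => ?_
    simp only [hρ]
    push_cast
    ring
  have Wb : ‖W‖ ≤ n * M := by
    rw [mul_comm, ← hw.2.2 M, sum_mul]
    refine norm_sum_le_of_le _ fun m _ => ?_
    rw [norm_mul, Complex.norm_real, norm_of_nonneg (hw.2.1 m), Complex.norm_natCast]
    exact mul_le_mul_of_nonneg_left (by exact_mod_cast Nat.sub_le n m) (hw.2.1 m)
  have e5 : ‖(∑ q ∈ range (Q + 1), sterm f q) * W - SingSeries f * W‖ ≤ C3 * ((Q:ℝ) ^ (-c0) * (n * M)) := by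
    rw [← sub_mul, norm_mul, norm_sub_rev, ← mul_assoc]
    refine mul_le_mul ((h3 (Q + 1) (by omega)).trans (mul_le_mul_of_nonneg_left ?_ C30.le)) Wb (norm_nonneg _) (by positivity)
    exact rpow_le_rpow_of_nonpos (by linarith) (by push_cast; linarith) (by linarith)
  rw [e4] at e3
  calc _ = ‖(∑ d ∈ Icc 1 M, r d - ∑ d ∈ range M, r d) + (∑ d ∈ range M, r d - ∑ x ∈ II Q, Saq f x.2 x.1 / x.1 * J x)
        + (∑ x ∈ II Q, Saq f x.2 x.1 / x.1 * J x - (∑ q ∈ range (Q + 1), sterm f q) * W) + ((∑ q ∈ range (Q + 1), sterm f q) * W - SingSeries f * W)‖ := by congr 1; ring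
    _ ≤ 2 * (n * l ^ 2) + C1 * (M / K) * (n * l ^ 2) + 2 * Q ^ 2 * ((2 + 4 * C2) * T) + C3 * ((Q:ℝ) ^ (-c0) * (n * M)) :=
        (norm_add_le _ _).trans (add_le_add ((norm_add₃_le).trans (add_le_add (add_le_add e1 e2) e3)) e5)
    _ ≤ _ := by
        have a1 : 0 ≤ n * l ^ 2 := by positivity
        have a2 : 0 ≤ M / K * (n * l ^ 2) := by positivity
        have a3 : 0 ≤ Q ^ 2 * T := by positivity
        have a4 : 0 ≤ (Q:ℝ) ^ (-c0) * (n * M) := by positivity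
        generalize n * l ^ 2 = A1 at *
        have : C1 * (M / K) * A1 = C1 * (M / K * A1) := by ring
        rw [this]
        generalize M / K * A1 = A2 at *
        have : 2 * Q ^ 2 * ((2 + 4 * C2) * T) = (4 + 8 * C2) * (Q ^ 2 * T) := by ring
        rw [this]
        generalize (Q:ℝ) ^ 2 * T = A3 at *
        generalize (Q:ℝ) ^ (-c0) * (n * M) = A4 at *
        nlinarith [mul_nonneg C10.le a1, mul_nonneg C10.le a2, mul_nonneg C10.le a3, mul_nonneg C10.le a4, mul_nonneg C20.le a1, mul_nonneg C20.le a2, mul_nonneg C20.le a3, mul_nonneg C20.le a4,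
          mul_nonneg C30.le a1, mul_nonneg C30.le a2, mul_nonneg C30.le a3, mul_nonneg C30.le a4]

lemma fin_M_big {c k N M : ℕ} {X : ℝ} (p : ℕ) (hX : 0 ≤ X) (hN : 2 ≤ N) (h : (N:ℝ) ≤ c * (M + 1) ^ k)
    (hl : ((p * k + 1).factorial : ℝ) * (2 * (c * (X + 1) ^ k)) < log (N + 1 : ℕ)) : X * log (N + 1 : ℕ) ^ p ≤ M := by
  have l1 : 1 ≤ log (N + 1 : ℕ) := one_le_log (by omega)
  have lp := log_pow_le (p * k + 1) (x := ((N + 1 : ℕ):ℝ)) (by push_cast; linarith [(N.cast_nonneg : (0:ℝ) ≤ N)])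
  set l := log (N + 1 : ℕ) with hl'
  by_contra hc
  push Not at hc
  have l0 : 0 < l ^ (p * k) := by positivity
  have a1 : (N:ℝ) ≤ c * (X + 1) ^ k * l ^ (p * k) := by
    refine h.trans ?_
    rw [mul_assoc, pow_mul l, ← mul_pow]
    gcongr
    nlinarith [one_le_pow₀ (n := p) l1]
  have a2 : ((N + 1 : ℕ):ℝ) ≤ 2 * N := by push_cast; have : (2:ℝ) ≤ N := by exact_mod_cast hN
                                          linarith
  have a3 : l ^ (p * k) * l ≤ l ^ (p * k) * (((p * k + 1).factorial : ℝ) * (2 * (c * (X + 1) ^ k))) := by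
    rw [← pow_succ]
    refine lp.trans ?_
    calc ((p * k + 1).factorial : ℝ) * ((N + 1 : ℕ):ℝ) ≤ ((p * k + 1).factorial : ℝ) * (2 * (c * (X + 1) ^ k * l ^ (p * k))) := by
          gcongr; linarith
      _ = _ := by ring
  exact absurd (le_of_mul_le_mul_left a3 l0) (not_le.2 hl)

lemma fin_alg {n M l Q D C4 c0 : ℝ} {a0 B k : ℕ} (hk : 1 ≤ k) (n0 : 0 ≤ n) (M0 : 0 < M) (l1 : 1 ≤ l) (c00 : 0 < c0)
    (hQ1 : l ^ B ≤ Q) (hQ2 : Q ≤ 2 * l ^ B) (hC4 : 0 ≤ C4) (hn : n ≤ C4 * M ^ k) (hB : (a0:ℝ) ≤ B * c0)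
    (hD1 : M / (2 * l ^ (2 * B + 2 + a0)) ≤ D) (hD2 : D ≤ M / l ^ (2 * B + 2 + a0)) (hM : l ^ (a0 + 2) ≤ M) :
    n * l ^ 2 + M / l ^ (a0 + 2) * (n * l ^ 2) + Q ^ 2 * (n * (l * (D * l + Q ^ 2 * (n / l ^ (4 * B + 1 + (2 * B + 2 + a0) * (k - 1) + a0)) / D ^ (k - 1))) + M * (Q ^ 2 * (n / l ^ (4 * B + 1 + (2 * B + 2 + a0) * (k - 1) + a0)))) + Q ^ (-c0) * (n * M)
      ≤ (23 + 16 * C4 * 2 ^ (k - 1)) * (n * M / l ^ a0) := by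
  have l0 : 0 < l := by linarith
  have Q0 : 0 < Q := lt_of_lt_of_le (by positivity) hQ1
  have D0 : 0 < D := lt_of_lt_of_le (by positivity) hD1
  set E := 2 * B + 2 + a0 with hE
  have hQs : Q ^ 2 ≤ 4 * l ^ (2 * B) := by
    calc Q ^ 2 ≤ (2 * l ^ B) ^ 2 := by gcongr
      _ = _ := by rw [mul_comm 2 B, pow_mul]; ring
  have t1 : n * l ^ 2 ≤ n * M / l ^ a0 := by
    rw [le_div_iff₀ (by positivity), mul_assoc, ← pow_add, add_comm 2]; gcongr
  have t2 : M / l ^ (a0 + 2) * (n * l ^ 2) = n * M / l ^ a0 := by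
    rw [pow_add]; field_simp
  have t3 : Q ^ 2 * (n * (l * (D * l))) ≤ 4 * (n * M / l ^ a0) := by
    calc Q ^ 2 * (n * (l * (D * l))) ≤ 4 * l ^ (2 * B) * (n * (l * (M / l ^ E * l))) := by gcongr
      _ = _ := by rw [hE, pow_add, pow_add]; field_simp
  have t4 : Q ^ 2 * (n * (l * (Q ^ 2 * (n / l ^ (4 * B + 1 + E * (k - 1) + a0)) / D ^ (k - 1)))) ≤ 16 * C4 * 2 ^ (k - 1) * (n * M / l ^ a0) := by
    calc _ ≤ 4 * l ^ (2 * B) * (n * (l * (4 * l ^ (2 * B) * (C4 * M ^ k / l ^ (4 * B + 1 + E * (k - 1) + a0)) / (M / (2 * l ^ E)) ^ (k - 1)))) := by gcongr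
      _ = _ := by
        obtain ⟨k', rfl⟩ : ∃ k', k = k' + 1 := ⟨k - 1, by omega⟩
        rw [Nat.add_sub_cancel, div_pow, mul_pow, ← pow_mul, pow_add, pow_add, pow_add, pow_succ M, show 4 * B = 2 * B + 2 * B by ring, pow_add]
        field_simp
        ring
  have t5 : Q ^ 2 * (M * (Q ^ 2 * (n / l ^ (4 * B + 1 + E * (k - 1) + a0)))) ≤ 16 * (n * M / l ^ a0) := by
    calc _ ≤ 4 * l ^ (2 * B) * (M * (4 * l ^ (2 * B) * (n / (l ^ (4 * B + a0))))) := by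
          gcongr
          have := Nat.zero_le (E * (k - 1)); omega
      _ = _ := by
        rw [pow_add, show 4 * B = 2 * B + 2 * B by ring, pow_add]
        field_simp
        ring
  have t6 : Q ^ (-c0) * (n * M) ≤ n * M / l ^ a0 := by
    rw [mul_comm, div_eq_mul_inv]
    gcongr
    rw [rpow_neg Q0.le]
    gcongr
    calc l ^ a0 = l ^ (a0:ℝ) := (rpow_natCast _ _).symm
      _ ≤ l ^ (B * c0) := rpow_le_rpow_of_exponent_le l1 hB
      _ = (l ^ B) ^ c0 := by rw [rpow_mul l0.le, rpow_natCast]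
      _ ≤ _ := by gcongr
  have : n * l ^ 2 + M / l ^ (a0 + 2) * (n * l ^ 2) + Q ^ 2 * (n * (l * (D * l + Q ^ 2 * (n / l ^ (4 * B + 1 + E * (k - 1) + a0)) / D ^ (k - 1))) + M * (Q ^ 2 * (n / l ^ (4 * B + 1 + E * (k - 1) + a0)))) + Q ^ (-c0) * (n * M)
    = n * l ^ 2 + M / l ^ (a0 + 2) * (n * l ^ 2) + Q ^ 2 * (n * (l * (D * l))) + Q ^ 2 * (n * (l * (Q ^ 2 * (n / l ^ (4 * B + 1 + E * (k - 1) + a0)) / D ^ (k - 1)))) + Q ^ 2 * (M * (Q ^ 2 * (n / l ^ (4 * B + 1 + E * (k - 1) + a0)))) + Q ^ (-c0) * (n * M) := by ring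
  rw [this]
  linarith

set_option maxHeartbeats 800000 in
lemma fin_main (f : Polynomial ℤ) (k : ℕ) (hk : 1 ≤ k)
    (hdeg : f.natDegree = k) (hlead : 0 < f.leadingCoeff) (A : ℝ) :
    (fun N : ℕ => (Rf f k N : ℂ) -
        SingSeries f *
          (((1 / (f.leadingCoeff : ℝ) ^ ((1 : ℝ) / k)) * ((k : ℝ) / (k + 1)) *
            (N : ℝ) ^ (((k : ℝ) + 1) / k) : ℝ) : ℂ))
      =O[atTop]
    (fun N : ℕ => (N : ℝ) ^ (((k : ℝ) + 1) / k) / log N ^ A) := by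
  obtain ⟨c, hlc⟩ : ∃ c : ℕ, f.leadingCoeff = c := ⟨f.leadingCoeff.toNat, by omega⟩
  have hc : 1 ≤ c := by omega
  obtain ⟨w, hw⟩ := exists_w hc hk
  obtain ⟨C0, c0, c00, H⟩ := pre f hc hk hdeg hlead hlc hw
  obtain ⟨a0, ha0⟩ := exists_nat_ge A
  obtain ⟨B0, hB0⟩ := exists_nat_ge ((a0:ℝ) / c0)
  set B := (a0 + 2) * C0 + 1 + B0 with hB
  have hBc : (a0:ℝ) ≤ B * c0 := by
    rw [div_le_iff₀ c00] at hB0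
    refine hB0.trans ?_
    gcongr
    omega
  obtain ⟨C, C00, H⟩ := H (4 * B + 1 + (2 * B + 2 + a0) * (k - 1) + a0)
  set E := 2 * B + 2 + a0 with hE
  set p := (a0 + 2 + 2 * B) * (k + 1) + E with hp
  set X : ℝ := 8 ^ (k + 1) with hX
  have X8 : 8 ≤ X := by rw [hX]; exact le_self_pow₀ (by norm_num) (by omega)
  have ck : (1:ℝ) ≤ c := by exact_mod_cast hc
  have k0 : (0:ℝ) < k := by exact_mod_cast hk
  set C4 : ℝ := 2 * c * 2 ^ k with hC4
  have lgt : Tendsto (fun N : ℕ => log (N + 1 : ℕ)) atTop atTop :=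
    Real.tendsto_log_atTop.comp (tendsto_natCast_atTop_atTop.comp (tendsto_add_atTop_nat 1))
  set cst : ℝ := (C * (23 + 16 * C4 * 2 ^ (k - 1)) + ‖SingSeries f‖ * 5) * (2 * (1 / (c:ℝ) ^ ((1:ℝ) / k))) with hcst
  refine IsBigO.of_bound cst ?_
  filter_upwards [eventually_ge_atTop (3 + c), lgt.eventually_gt_atTop (((p * k + 1).factorial : ℝ) * (2 * (c * (X + 1) ^ k))),
    lgt.eventually_ge_atTop ((k.factorial:ℝ) * c), lgt.eventually_ge_atTop 2] with N hN hl1 hl2 hl3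
  have N3 : (3:ℝ) ≤ N := by exact_mod_cast (by omega : 3 ≤ N)
  have Nc : (c:ℝ) ≤ N := by exact_mod_cast (by omega : c ≤ N)
  set y : ℝ := ((N : ℝ) / c) ^ ((1 : ℝ) / k) with hy
  have y1 : 1 ≤ y := Real.one_le_rpow ((one_le_div (by linarith)).2 Nc) (by positivity)
  have yk : (c:ℝ) * y ^ k = N := by
    rw [hy, ← rpow_natCast, ← rpow_mul (by positivity), one_div_mul_cancel k0.ne', rpow_one]
    field_simp
  have yN : y ≤ N := by
    rw [← yk]
    have := le_self_pow₀ y1 (by omega : k ≠ 0)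
    nlinarith
  have hMf : Mf f k N = ⌊y⌋₊ := by rw [Mf, hlc, Int.cast_natCast]
  set M := Mf f k N with hM
  have My : (M:ℝ) ≤ y := by rw [hMf]; exact Nat.floor_le (by linarith)
  have yM : y ≤ M + 1 := by rw [hMf]; exact (Nat.lt_floor_add_one y).le
  have NM : (N:ℝ) ≤ c * (M + 1) ^ k := by rw [← yk]; gcongr
  have big := fin_M_big p (by positivity) (by omega) NM hl1
  set n := N + 1 with hn
  set l := log (n:ℕ) with hl
  have l1 : 1 ≤ l := by linarith
  have big' : ∀ i ≤ p, 8 * l ^ i ≤ M := fun i hi => le_trans (by gcongr) big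
  have M8 : (8:ℝ) ≤ M := by simpa using big' 0 (Nat.zero_le _)
  have n2 : (n:ℝ) ≤ 2 * N := by rw [hn]; push_cast; linarith
  have hnM : (n:ℝ) ≤ C4 * M ^ k := by
    calc (n:ℝ) ≤ 2 * N := n2
      _ ≤ 2 * (c * (2 * M) ^ k) := by
        rw [← yk]; gcongr; linarith
      _ = _ := by rw [mul_pow, hC4]; ring
  set Q := ⌈l ^ B⌉₊ with hQ
  have lB1 : 1 ≤ l ^ B := one_le_pow₀ l1
  have Q1 : l ^ B ≤ Q := Nat.le_ceil _
  have Q2 : (Q:ℝ) ≤ 2 * l ^ B := by have := Nat.ceil_lt_add_one (by positivity : 0 ≤ l ^ B); linarith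
  set D := ⌊(M:ℝ) / l ^ E⌋₊ with hD
  have E8 : 8 * l ^ E ≤ M := big' E (by omega)
  have lE0 : 0 < l ^ E := by positivity
  have ME : 8 ≤ (M:ℝ) / l ^ E := by rwa [le_div_iff₀ lE0]
  have D2 : (D:ℝ) ≤ M / l ^ E := Nat.floor_le (by positivity)
  have D1' : (M:ℝ) / l ^ E < D + 1 := Nat.lt_floor_add_one _
  have D1 : (M:ℝ) / (2 * l ^ E) ≤ D := by
    have : (M:ℝ) / (2 * l ^ E) = M / l ^ E / 2 := by field_simp
    rw [this]; linarith
  have Dp : 1 ≤ D := by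
    have : (1:ℝ) ≤ D := by linarith
    exact_mod_cast this
  have a2p : a0 + 2 ≤ p := by
    rw [hp, hE]; nlinarith [Nat.zero_le ((a0 + 2 + 2 * B) * k)]
  have la2 : l ^ (a0 + 2) ≤ M := by have := big' _ a2p; linarith [pow_pos (by linarith : 0 < l) (a0 + 2)]
  have la : l ^ a0 ≤ M := le_trans (pow_le_pow_right₀ l1 (by omega)) la2
  have hK2 : 2 ≤ l ^ (a0 + 2) := hl3.trans (le_self_pow₀ l1 (by omega))
  have hKQ : ((k.factorial:ℝ) * c) * (l ^ (a0 + 2)) ^ C0 ≤ Q := by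
    refine le_trans ?_ Q1
    calc ((k.factorial:ℝ) * c) * (l ^ (a0 + 2)) ^ C0 ≤ l * (l ^ (a0 + 2)) ^ C0 := by gcongr
      _ = l ^ ((a0 + 2) * C0 + 1) := by rw [← pow_mul, pow_succ']
      _ ≤ _ := pow_le_pow_right₀ l1 (by omega)
  have hKM : (2 * l ^ (a0 + 2) * (Q:ℝ) ^ 2) ^ (k + 1) ≤ (M:ℝ) := by
    calc (2 * l ^ (a0 + 2) * (Q:ℝ) ^ 2) ^ (k + 1) ≤ (2 * l ^ (a0 + 2) * (2 * l ^ B) ^ 2) ^ (k + 1) := by gcongr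
      _ = (8 * l ^ (a0 + 2 + 2 * B)) ^ (k + 1) := by congr 1; rw [pow_add l (a0 + 2), mul_pow, mul_comm 2 B, pow_mul l B 2]; ring
      _ = X * l ^ ((a0 + 2 + 2 * B) * (k + 1)) := by rw [mul_pow, ← pow_mul]
      _ ≤ X * l ^ p := by gcongr; omega
      _ ≤ M := big
  have m1 := H (l ^ (a0 + 2)) hK2 Q M D n hKQ hKM (by omega) Dp
  have m2 := fin_alg hk (n.cast_nonneg : (0:ℝ) ≤ n) (by linarith : (0:ℝ) < M) l1 c00 Q1 Q2 (by positivity) hnM hBc D1 D2 la2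
  have m3 := W_main hk hw y1 yN yk My yM
  have e1 : (1 / (f.leadingCoeff : ℝ) ^ ((1 : ℝ) / k)) * ((k : ℝ) / (k + 1)) * (N : ℝ) ^ (((k : ℝ) + 1) / k) = k / (k + 1) * (N * y) := by
    rw [hlc, hy, Real.div_rpow (by positivity) (by positivity), add_div, div_self k0.ne', rpow_add (by linarith), rpow_one, Int.cast_natCast]
    ring
  have e2 : (N : ℝ) ^ (((k : ℝ) + 1) / k) * (1 / (c:ℝ) ^ ((1:ℝ) / k)) = N * y := by
    rw [hy, Real.div_rpow (by positivity) (by positivity), add_div, div_self k0.ne', rpow_add (by linarith), rpow_one]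
    ring
  rw [e1, Rf_eq]
  have m4 : ‖∑ m ∈ range (c * M ^ k), (w m : ℂ) * (n - m : ℕ) - ((k / (k + 1) * (N * y) : ℝ) : ℂ)‖ ≤ 5 * n := by
    rw [← norm_eq_abs, ← Complex.norm_real] at m3
    refine le_trans (le_of_eq ?_) m3
    push_cast
    rfl
  have lN1 : 1 ≤ log N := one_le_log (by omega)
  have lNl : log N ≤ l := log_le_log (by linarith) (by rw [hn]; push_cast; linarith)
  have lA : log N ^ A ≤ l ^ a0 := by
    calc log N ^ A ≤ log N ^ (a0:ℝ) := rpow_le_rpow_of_exponent_le lN1 ha0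
      _ = log N ^ a0 := rpow_natCast _ _
      _ ≤ l ^ a0 := by gcongr
  have lA0 : 0 < log N ^ A := rpow_pos_of_pos (by linarith) _
  have T1 : (n:ℝ) ≤ n * M / l ^ a0 := by
    rw [le_div_iff₀ (by positivity)]; gcongr
  have T2 : n * M / l ^ a0 ≤ 2 * (N * y / log N ^ A) := by
    calc n * M / l ^ a0 ≤ 2 * N * y / log N ^ A := by gcongr
      _ = _ := by ring
  rw [norm_div, norm_of_nonneg (by positivity : (0:ℝ) ≤ (N : ℝ) ^ (((k : ℝ) + 1) / k)), norm_of_nonneg lA0.le]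
  set W : ℂ := ∑ m ∈ range (c * M ^ k), (w m : ℂ) * (n - m : ℕ) with hW
  push_cast at m1 m4 ⊢
  calc _ ≤ ‖∑ d ∈ Icc 1 M, (rr ArithmeticFunction.vonMangoldt n (f.eval (d:ℤ)) : ℂ) - SingSeries f * W‖
        + ‖SingSeries f * (W - (k / (k + 1) * (N * y) : ℂ))‖ := by
        refine le_trans (le_of_eq ?_) (norm_add_le _ _)
        congr 1; ring
    _ ≤ C * ((23 + 16 * C4 * 2 ^ (k - 1)) * (n * M / l ^ a0)) + ‖SingSeries f‖ * (5 * (n * M / l ^ a0)) := by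
        rw [norm_mul]
        refine add_le_add (m1.trans (mul_le_mul_of_nonneg_left m2 C00.le)) (mul_le_mul_of_nonneg_left (m4.trans (by linarith)) (norm_nonneg _))
    _ = (C * (23 + 16 * C4 * 2 ^ (k - 1)) + ‖SingSeries f‖ * 5) * (n * M / l ^ a0) := by ring
    _ ≤ (C * (23 + 16 * C4 * 2 ^ (k - 1)) + ‖SingSeries f‖ * 5) * (2 * (N * y / log N ^ A)) := by gcongr
    _ = _ := by rw [hcst, ← e2]; ring

theorem stmt1 (f : Polynomial ℤ) (k : ℕ) (hk : 1 ≤ k)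
    (hdeg : f.natDegree = k) (hlead : 0 < f.leadingCoeff) (A : ℝ) (hA : 0 < A) :
    (fun N : ℕ => (Rf f k N : ℂ) -
        SingSeries f *
          (((1 / (f.leadingCoeff : ℝ) ^ ((1 : ℝ) / k)) * ((k : ℝ) / (k + 1)) *
            (N : ℝ) ^ (((k : ℝ) + 1) / k) : ℝ) : ℂ))
      =O[atTop]
    (fun N : ℕ => (N : ℝ) ^ (((k : ℝ) + 1) / k) / Real.log N ^ A) := by
  exact fin_main f k hk hdeg hlead A
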